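/- Let p, q be coprime integers with 1 ≤ p < q, and define A₂(l; 1, 2^{p/q}) = #{d ∈ ℤ : 0 ≤ d ≤ l, ⌊2^d · 2^{p/q}⌋ odd}. Then lim_{l→∞} (1/l) ∑_{0<|n|≤2^l} ζ(2nπi/log 2) e^{2nπi p/q}/n = 0 if and only if 2^{p/q} is simply normal to base 2 (i.e., lim_{l→∞} A₂(l; 1, 2^{p/q})/l = 1/2). -/

import Mathlib

section

open Filter Topology Set MeasureTheory

/-- The square wave of period `2`: `1/2` where `⌊u⌋` is odd and `-1/2` where it is even. -/
noncomputable def sqWave (u : ℝ) : ℝ := if Odd ⌊u⌋ then 1 / 2 else -(1 / 2)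

lemma abs_sqWave (u : ℝ) : |sqWave u| = 1 / 2 := by
  unfold sqWave; split_ifs <;> norm_num [abs_of_pos]

lemma measurable_sqWave : Measurable sqWave := by
  have h : Measurable (fun n : ℤ => if Odd n then (1 / 2 : ℝ) else -(1 / 2)) := measurable_from_top
  exact h.comp Int.measurable_floor

lemma sqWave_periodic : Function.Periodic sqWave 2 := by
  intro u
  have : ⌊u + 2⌋ = ⌊u⌋ + 2 := by exact_mod_cast Int.floor_add_natCast u 2
  unfold sqWave
  rw [this]
  simp

lemma sqWave_intervalIntegrable (a b : ℝ) : IntervalIntegrable sqWave volume a b := by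
  refine IntervalIntegrable.mono_fun' (g := fun _ => (1 / 2 : ℝ)) intervalIntegrable_const
    measurable_sqWave.aestronglyMeasurable (Eventually.of_forall fun u => ?_)
  exact (abs_sqWave u).le

lemma sqWave_eventuallyEq {u : ℝ} (hu : ∀ n : ℤ, u ≠ n) :
    sqWave =ᶠ[𝓝 u] fun _ => sqWave u := by
  have h1 : (⌊u⌋ : ℝ) < u := lt_of_le_of_ne (Int.floor_le u) (hu _).symm
  filter_upwards [Ioo_mem_nhds h1 (Int.lt_floor_add_one u)] with v hv
  have : ⌊v⌋ = ⌊u⌋ := Int.floor_eq_iff.2 ⟨hv.1.le, hv.2⟩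
  simp [sqWave, this]

/-- The primitive of the square wave vanishing at `1`. -/
noncomputable def sqWavePrim (u : ℝ) : ℝ := ∫ t in (1 : ℝ)..u, sqWave t

lemma sqWavePrim_one : sqWavePrim 1 = 0 := by simp [sqWavePrim]

lemma continuous_sqWavePrim : Continuous sqWavePrim :=
  intervalIntegral.continuous_primitive sqWave_intervalIntegrable 1

lemma hasDerivAt_sqWavePrim {u : ℝ} (hu : ∀ n : ℤ, u ≠ n) :
    HasDerivAt sqWavePrim (sqWave u) u := by
  refine intervalIntegral.integral_hasDerivAt_right (sqWave_intervalIntegrable _ _)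
    (measurable_sqWave.stronglyMeasurable.stronglyMeasurableAtFilter) ?_
  exact ContinuousAt.congr continuousAt_const (sqWave_eventuallyEq hu).symm

lemma integral_sqWave_period : ∫ t in (1 : ℝ)..1 + 2, sqWave t = 0 := by
  rw [← intervalIntegral.integral_add_adjacent_intervals (b := 2)
    (sqWave_intervalIntegrable _ _) (sqWave_intervalIntegrable _ _)]
  have e1 : ∫ t in (1 : ℝ)..2, sqWave t = ∫ t in (1 : ℝ)..2, (1 / 2 : ℝ) := by
    refine intervalIntegral.integral_congr_Ioo_of_le (by norm_num) fun t ht => ?_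
    have : ⌊t⌋ = 1 := Int.floor_eq_iff.2 ⟨by simpa using ht.1.le, by norm_num; exact ht.2⟩
    simp [sqWave, this]
  have e2 : ∫ t in (2 : ℝ)..1 + 2, sqWave t = ∫ t in (2 : ℝ)..1 + 2, (-(1 / 2) : ℝ) := by
    refine intervalIntegral.integral_congr_Ioo_of_le (by norm_num) fun t ht => ?_
    have : ⌊t⌋ = 2 := Int.floor_eq_iff.2 ⟨by simpa using ht.1.le, by norm_num; linarith [ht.2]⟩
    have h2 : ¬ Odd (2 : ℤ) := by decide
    simp [sqWave, this, h2]
  rw [e1, e2]; simp; norm_num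

lemma sqWavePrim_periodic : Function.Periodic sqWavePrim 2 := by
  intro u
  unfold sqWavePrim
  rw [← intervalIntegral.integral_add_adjacent_intervals (b := u)
    (sqWave_intervalIntegrable _ _) (sqWave_intervalIntegrable _ _),
    sqWave_periodic.intervalIntegral_add_eq u 1, integral_sqWave_period, add_zero]

lemma abs_sqWavePrim_le (u : ℝ) : |sqWavePrim u| ≤ 1 := by
  obtain ⟨v, hv, e⟩ := sqWavePrim_periodic.exists_mem_Ico₀ (by norm_num) u
  rw [e]
  have := intervalIntegral.norm_integral_le_of_norm_le_const (a := 1) (b := v) (f := sqWave)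
    (C := 1 / 2) fun t _ => by rw [Real.norm_eq_abs, abs_sqWave]
  rw [Real.norm_eq_abs] at this
  have h2 : |v - 1| ≤ 1 := abs_le.2 ⟨by linarith [hv.1], by linarith [hv.2]⟩
  unfold sqWavePrim
  linarith

lemma sqWave_eq_sum (M : ℕ) {u : ℝ} (h0 : 0 ≤ u) (h1 : u < M + 1) :
    sqWave u = -(1 / 2) + ∑ m ∈ Finset.range M, (-1) ^ m * (if ((m : ℝ) + 1 ≤ u) then 1 else 0) := by
  induction M with
  | zero =>
    have : ⌊u⌋ = 0 := Int.floor_eq_iff.2 ⟨by simpa using h0, by simpa using h1⟩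
    simp [sqWave, this]
  | succ M ih =>
    rw [Finset.sum_range_succ]
    by_cases h : u < M + 1
    · rw [ih h, if_neg (not_le.2 h)]; ring
    · push Not at h
      have hf : ⌊u⌋ = (M + 1 : ℕ) := Int.floor_eq_iff.2 ⟨by push_cast; linarith, by push_cast at *; linarith⟩
      have hs : ∑ m ∈ Finset.range M, (-1 : ℝ) ^ m * (if ((m : ℝ) + 1 ≤ u) then 1 else 0)
          = ∑ m ∈ Finset.range M, (-1 : ℝ) ^ m := by
        refine Finset.sum_congr rfl fun m hm => ?_
        have : (m : ℝ) + 1 ≤ M := by exact_mod_cast Finset.mem_range.1 hm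
        rw [if_pos (by linarith)]; ring
      rw [hs, if_pos h, neg_one_geom_sum]
      unfold sqWave
      rw [hf]
      rcases Nat.even_or_odd M with hM | hM
      · have : Odd ((M + 1 : ℕ) : ℤ) := by exact_mod_cast hM.add_one
        rw [if_pos this, if_pos hM, hM.neg_one_pow]; norm_num
      · have : ¬ Odd ((M + 1 : ℕ) : ℤ) := by
          rw [Int.not_odd_iff_even]; exact_mod_cast hM.add_one
        rw [if_neg this, if_neg (Nat.not_even_iff_odd.2 hM), hM.neg_one_pow]; norm_num

/-- The Dirichlet kernel `∑_{|n| ≤ N} e^{2πinw}`. -/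
noncomputable def dirKer (N : ℕ) (w : ℝ) : ℝ :=
  1 + 2 * ∑ n ∈ Finset.range N, Real.cos (2 * Real.pi * (n + 1) * w)

lemma dirKer_mul_sin (N : ℕ) (w : ℝ) :
    dirKer N w * Real.sin (Real.pi * w) = Real.sin ((2 * N + 1) * Real.pi * w) := by
  induction N with
  | zero => simp [dirKer]
  | succ N ih =>
    have h : dirKer (N + 1) w = dirKer N w + 2 * Real.cos (2 * Real.pi * (N + 1) * w) := by
      unfold dirKer; rw [Finset.sum_range_succ]; ring
    rw [h, add_mul, ih]
    have e1 : (2 * (N : ℝ) + 1) * Real.pi * w = 2 * Real.pi * (N + 1) * w - Real.pi * w := by ring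
    have e2 : (2 * ((N + 1 : ℕ) : ℝ) + 1) * Real.pi * w
        = 2 * Real.pi * (N + 1) * w + Real.pi * w := by push_cast; ring
    rw [e1, e2, Real.sin_sub, Real.sin_add]; ring

lemma dirKer_neg (N : ℕ) (w : ℝ) : dirKer N (-w) = dirKer N w := by
  simp [dirKer]

lemma continuous_dirKer (N : ℕ) : Continuous (dirKer N) := by
  unfold dirKer; fun_prop

lemma dirKer_add_int (N : ℕ) (w : ℝ) (k : ℤ) : dirKer N (w + k) = dirKer N w := by
  unfold dirKer
  congr 2
  refine Finset.sum_congr rfl fun n _ => ?_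
  have : 2 * Real.pi * ((n : ℝ) + 1) * (w + k)
      = 2 * Real.pi * (n + 1) * w + (((n + 1 : ℤ) * k : ℤ) : ℝ) * (2 * Real.pi) := by
    push_cast; ring
  rw [this, Real.cos_add_int_mul_two_pi]

lemma abs_dirKer_le (N : ℕ) (w : ℝ) : |dirKer N w| ≤ 2 * N + 1 := by
  unfold dirKer
  have h : |∑ n ∈ Finset.range N, Real.cos (2 * Real.pi * (n + 1) * w)| ≤ N := by
    refine (Finset.abs_sum_le_sum_abs _ _).trans ?_
    refine (Finset.sum_le_sum fun n _ => Real.abs_cos_le_one _).trans ?_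
    simp
  rw [abs_le] at *
  constructor <;> linarith [h.1, h.2]

lemma two_mul_abs_le_abs_sin {w : ℝ} (hw : |w| ≤ 1 / 2) : 2 * |w| ≤ |Real.sin (Real.pi * w)| := by
  have h : |Real.sin (Real.pi * w)| = Real.sin (Real.pi * |w|) := by
    rcases abs_cases w with ⟨h1, h2⟩ | ⟨h1, h2⟩
    · rw [h1, abs_of_nonneg]
      exact Real.sin_nonneg_of_nonneg_of_le_pi (by positivity) (by
        rw [h1] at hw; nlinarith [Real.pi_pos])
    · have : Real.pi * w = - (Real.pi * |w|) := by rw [h1]; ring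
      rw [this, Real.sin_neg, abs_neg, abs_of_nonneg]
      exact Real.sin_nonneg_of_nonneg_of_le_pi (by positivity) (by nlinarith [Real.pi_pos])
  rw [h]
  have := Real.mul_le_sin (x := Real.pi * |w|) (by positivity) (by nlinarith [Real.pi_pos])
  calc 2 * |w| = 2 / Real.pi * (Real.pi * |w|) := by field_simp
    _ ≤ _ := this

lemma abs_dirKer_mul_le (N : ℕ) {w : ℝ} (hw : |w| ≤ 1 / 2) : |dirKer N w| * (2 * |w|) ≤ 1 := by
  calc |dirKer N w| * (2 * |w|) ≤ |dirKer N w| * |Real.sin (Real.pi * w)| := by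
        gcongr; exact two_mul_abs_le_abs_sin hw
    _ = |Real.sin ((2 * N + 1) * Real.pi * w)| := by rw [← abs_mul, dirKer_mul_sin]
    _ ≤ 1 := Real.abs_sin_le_one _

lemma integral_dirKer (N : ℕ) : ∫ w in (-(1 / 2) : ℝ)..1 / 2, dirKer N w = 1 := by
  unfold dirKer
  rw [intervalIntegral.integral_add (by simp) (Continuous.intervalIntegrable (by fun_prop) _ _),
    intervalIntegral.integral_const_mul, intervalIntegral.integral_finsetSum
      (fun n _ => Continuous.intervalIntegrable (by fun_prop) _ _)]
  have h : ∀ n : ℕ, ∫ w in (-(1 / 2) : ℝ)..1 / 2, Real.cos (2 * Real.pi * (n + 1) * w) = 0 := by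
    intro n
    have hn : 2 * Real.pi * ((n : ℝ) + 1) ≠ 0 := by positivity
    rw [intervalIntegral.integral_comp_mul_left (fun x => Real.cos x) hn, integral_cos]
    have e : 2 * Real.pi * ((n : ℝ) + 1) * (1 / 2) = ((n + 1 : ℕ) : ℝ) * Real.pi := by
      push_cast; ring
    have e' : 2 * Real.pi * ((n : ℝ) + 1) * (-(1 / 2)) = - (((n + 1 : ℕ) : ℝ) * Real.pi) := by
      push_cast; ring
    rw [e, e', Real.sin_neg, Real.sin_nat_mul_pi]; simp
  simp only [h]; simp; norm_num

lemma integral_dirKer_half (N : ℕ) : ∫ w in (0 : ℝ)..1 / 2, dirKer N w = 1 / 2 := by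
  have h1 := integral_dirKer N
  rw [← intervalIntegral.integral_add_adjacent_intervals (b := 0)
    ((continuous_dirKer N).intervalIntegrable _ _) ((continuous_dirKer N).intervalIntegrable _ _)] at h1
  have h2 : ∫ w in (-(1 / 2) : ℝ)..0, dirKer N w = ∫ w in (0 : ℝ)..1 / 2, dirKer N w := by
    have := intervalIntegral.integral_comp_neg (a := 0) (b := 1 / 2) (dirKer N)
    simp only [dirKer_neg, neg_zero] at this
    exact this.symm
  rw [h2] at h1; linarith

/-- The derivative of the Dirichlet kernel. -/
noncomputable def dirKerDeriv (N : ℕ) (w : ℝ) : ℝ :=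
  2 * ∑ n ∈ Finset.range N, -(2 * Real.pi * (n + 1)) * Real.sin (2 * Real.pi * (n + 1) * w)

lemma continuous_dirKerDeriv (N : ℕ) : Continuous (dirKerDeriv N) := by
  unfold dirKerDeriv; fun_prop

lemma hasDerivAt_dirKer (N : ℕ) (w : ℝ) : HasDerivAt (dirKer N) (dirKerDeriv N w) w := by
  unfold dirKer dirKerDeriv
  refine HasDerivAt.const_add _ (HasDerivAt.const_mul _ (HasDerivAt.fun_sum fun n _ => ?_))
  have := ((hasDerivAt_id w).const_mul (2 * Real.pi * ((n : ℝ) + 1))).cos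
  simp only [id, mul_one] at this
  convert! this using 1; ring

lemma abs_dirKerDeriv_le (N : ℕ) (w : ℝ) : |dirKerDeriv N w| ≤ 4 * Real.pi * (2 * N + 1) ^ 2 := by
  unfold dirKerDeriv
  rw [abs_mul, abs_two]
  have : |∑ n ∈ Finset.range N, -(2 * Real.pi * (n + 1)) * Real.sin (2 * Real.pi * (n + 1) * w)|
      ≤ ∑ n ∈ Finset.range N, 2 * Real.pi * N := by
    refine (Finset.abs_sum_le_sum_abs _ _).trans (Finset.sum_le_sum fun n hn => ?_)
    rw [abs_mul, abs_neg, abs_of_pos (by positivity : (0 : ℝ) < 2 * Real.pi * (n + 1))]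
    have h1 := Real.abs_sin_le_one (2 * Real.pi * (n + 1) * w)
    have h2 : (n : ℝ) + 1 ≤ N := by exact_mod_cast Finset.mem_range.1 hn
    calc _ ≤ 2 * Real.pi * (n + 1) * 1 := by gcongr
      _ ≤ _ := by rw [mul_one]; gcongr
  simp only [Finset.sum_const, Finset.card_range, nsmul_eq_mul] at this
  have hN : (0 : ℝ) ≤ N := N.cast_nonneg
  nlinarith [Real.pi_pos, mul_nonneg hN Real.pi_pos.le, mul_nonneg (mul_nonneg hN hN) Real.pi_pos.le]

lemma abs_dirKerDeriv_mul_le (N : ℕ) {w : ℝ} (hw : |w| ≤ 1 / 2) :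
    |dirKerDeriv N w| * |w| ≤ Real.pi * (2 * N + 1) := by
  have h1 : dirKerDeriv N w * Real.sin (Real.pi * w) + dirKer N w * (Real.cos (Real.pi * w) * Real.pi)
      = Real.cos ((2 * N + 1) * Real.pi * w) * ((2 * N + 1) * Real.pi) := by
    have a := (hasDerivAt_dirKer N w).mul (((hasDerivAt_id w).const_mul Real.pi).sin)
    have b := ((hasDerivAt_id w).const_mul ((2 * N + 1) * Real.pi)).sin
    simp only [id, mul_one] at a b
    refine a.unique (b.congr_of_eventuallyEq (Eventually.of_forall fun v => ?_))
    exact dirKer_mul_sin N v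
  have h2 : |dirKerDeriv N w * Real.sin (Real.pi * w)| ≤ 2 * (Real.pi * (2 * N + 1)) := by
    rw [eq_sub_of_add_eq h1]
    refine (abs_sub _ _).trans ?_
    rw [abs_mul, abs_mul (dirKer N w), abs_mul (Real.cos (Real.pi * w))]
    have c1 := Real.abs_cos_le_one ((2 * N + 1) * Real.pi * w)
    have c2 := Real.abs_cos_le_one (Real.pi * w)
    have c3 := abs_dirKer_le N w
    rw [abs_of_pos Real.pi_pos, abs_of_pos (by positivity : 0 < (2 * (N : ℝ) + 1) * Real.pi)]
    have : |dirKer N w| * (|Real.cos (Real.pi * w)| * Real.pi) ≤ (2 * N + 1) * (1 * Real.pi) := by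
      gcongr
    have : |Real.cos ((2 * N + 1) * Real.pi * w)| * ((2 * N + 1) * Real.pi)
      ≤ 1 * ((2 * N + 1) * Real.pi) := by gcongr
    linarith
  rw [abs_mul] at h2
  have h3 : |dirKerDeriv N w| * (2 * |w|) ≤ |dirKerDeriv N w| * |Real.sin (Real.pi * w)| := by
    gcongr; exact two_mul_abs_le_abs_sin hw
  linarith

/-- Tail bound for the integral of the Dirichlet kernel. -/
lemma abs_integral_dirKer_mul_le (N : ℕ) {w : ℝ} (h0 : 0 < w) (h1 : w ≤ 1 / 2) :
    |∫ t in w..1 / 2, dirKer N t| * ((2 * N + 1) * w) ≤ 1 := by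
  set c : ℝ := (2 * N + 1) * Real.pi with hc
  have hcpos : 0 < c := by positivity
  have hsin : ∀ t ∈ Icc w (1 / 2), 0 < Real.sin (Real.pi * t) := fun t ht =>
    Real.sin_pos_of_pos_of_lt_pi (by have := ht.1; have : 0 < t := by linarith
                                     positivity) (by nlinarith [ht.2, Real.pi_pos])
  have hu : uIcc w (1 / 2) = Icc w (1 / 2) := uIcc_of_le h1
  have hd1 : ∀ t, HasDerivAt (fun t => -Real.cos (c * t) / c) (Real.sin (c * t)) t := by
    intro t
    have := (((hasDerivAt_id t).const_mul c).cos.neg).div_const c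
    simp only [id, mul_one] at this
    convert! this using 1; field_simp
  have hd2 : ∀ t ∈ uIcc w (1 / 2), HasDerivAt (fun t => (Real.sin (Real.pi * t))⁻¹)
      (-(Real.cos (Real.pi * t) * Real.pi) / Real.sin (Real.pi * t) ^ 2) t := by
    intro t ht
    have := (((hasDerivAt_id t).const_mul Real.pi).sin).inv (hsin t (hu ▸ ht)).ne'
    simp only [id, mul_one] at this
    exact this
  have hcont : ContinuousOn (fun t => -(Real.cos (Real.pi * t) * Real.pi) / Real.sin (Real.pi * t) ^ 2)
      (uIcc w (1 / 2)) := by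
    refine ContinuousOn.div (by fun_prop) (by fun_prop) fun t ht => ?_
    exact pow_ne_zero _ (hsin t (hu ▸ ht)).ne'
  have ibp := intervalIntegral.integral_mul_deriv_eq_deriv_mul hd2 (fun t _ => hd1 t)
    hcont.intervalIntegrable (Continuous.intervalIntegrable (by fun_prop) _ _)
  have e0 : ∫ t in w..1 / 2, dirKer N t
      = ∫ t in w..1 / 2, (Real.sin (Real.pi * t))⁻¹ * Real.sin (c * t) := by
    refine intervalIntegral.integral_congr fun t ht => ?_
    have := hsin t (hu ▸ ht)
    rw [hc, ← dirKer_mul_sin N t]; field_simp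
  have hend : Real.cos (c * (1 / 2)) = 0 := by
    rw [Real.cos_eq_zero_iff]; exact ⟨N, by rw [hc]; push_cast; ring⟩
  rw [hend] at ibp
  rw [e0, ibp]
  have ftc := intervalIntegral.integral_eq_sub_of_hasDerivAt hd2 hcont.intervalIntegrable
  have e1 : Real.sin (Real.pi * (1 / 2)) = 1 := by rw [mul_one_div, Real.sin_pi_div_two]
  rw [e1] at ftc
  have hsw := hsin w ⟨le_rfl, h1⟩
  set S := Real.sin (Real.pi * w) with hS
  have b1 : |∫ t in w..1 / 2, -(Real.cos (Real.pi * t) * Real.pi) / Real.sin (Real.pi * t) ^ 2 *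
      (-Real.cos (c * t) / c)| ≤ (1 / c) * (S⁻¹ - 1) := by
    have := intervalIntegral.norm_integral_le_of_norm_le h1 (f := fun t =>
      -(Real.cos (Real.pi * t) * Real.pi) / Real.sin (Real.pi * t) ^ 2 * (-Real.cos (c * t) / c))
      (g := fun t => -(1 / c) * (-(Real.cos (Real.pi * t) * Real.pi) / Real.sin (Real.pi * t) ^ 2))
      (μ := volume) (Eventually.of_forall fun t ht => ?_) (hcont.intervalIntegrable.const_mul _)
    · rw [intervalIntegral.integral_const_mul, ftc] at this
      rw [← Real.norm_eq_abs]
      refine this.trans_eq ?_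
      rw [inv_one]; ring
    · have hs := hsin t ⟨ht.1.le, ht.2⟩
      have hcs : 0 ≤ Real.cos (Real.pi * t) := Real.cos_nonneg_of_neg_pi_div_two_le_of_le
        (by nlinarith [ht.1, Real.pi_pos, mul_pos Real.pi_pos (h0.trans ht.1)])
        (by nlinarith [ht.2, Real.pi_pos])
      rw [Real.norm_eq_abs, abs_mul, abs_div, abs_div, abs_neg, abs_neg,
        abs_of_nonneg (by positivity : 0 ≤ Real.cos (Real.pi * t) * Real.pi),
        abs_of_pos (by positivity : 0 < Real.sin (Real.pi * t) ^ 2), abs_of_pos hcpos]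
      have := Real.abs_cos_le_one (c * t)
      calc _ ≤ Real.cos (Real.pi * t) * Real.pi / Real.sin (Real.pi * t) ^ 2 * (1 / c) := by gcongr
        _ = _ := by ring
  have b2 : |S⁻¹ * (-Real.cos (c * w) / c)| ≤ (1 / c) * S⁻¹ := by
    rw [abs_mul, abs_div, abs_neg, abs_of_pos hcpos, abs_of_pos (by positivity : 0 < S⁻¹)]
    have := Real.abs_cos_le_one (c * w)
    calc _ ≤ S⁻¹ * (1 / c) := by gcongr
      _ = _ := by ring
  have hSw : 2 * w ≤ S := by
    have := two_mul_abs_le_abs_sin (w := w) (by rw [abs_of_pos h0]; exact h1)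
    rwa [abs_of_pos h0, abs_of_pos hsw] at this
  have tot : |(Real.sin (Real.pi * (1 / 2)))⁻¹ * (-0 / c) - S⁻¹ * (-Real.cos (c * w) / c) -
      ∫ t in w..1 / 2, -(Real.cos (Real.pi * t) * Real.pi) / Real.sin (Real.pi * t) ^ 2 *
      (-Real.cos (c * t) / c)| ≤ (2 / c) * S⁻¹ := by
    rw [neg_zero, zero_div, mul_zero, zero_sub]
    refine (abs_sub _ _).trans ?_
    rw [abs_neg]
    have : 0 < 1 / c := by positivity
    calc _ ≤ (1 / c) * S⁻¹ + (1 / c) * (S⁻¹ - 1) := add_le_add b2 b1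
      _ ≤ (2 / c) * S⁻¹ := by ring_nf at *; linarith
  calc _ ≤ (2 / c) * S⁻¹ * ((2 * N + 1) * w) := by gcongr
    _ ≤ (2 / c) * (2 * w)⁻¹ * ((2 * N + 1) * w) := by gcongr
    _ = 1 / Real.pi := by rw [hc]; field_simp
    _ ≤ 1 := by rw [div_le_one Real.pi_pos]; linarith [Real.pi_gt_three]

lemma abs_integral_dirKer_le (N : ℕ) {w : ℝ} (h0 : 0 ≤ w) (h1 : w ≤ 1 / 2) :
    |∫ t in w..1 / 2, dirKer N t| ≤ 2 := by
  set c : ℝ := 2 * N + 1 with hc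
  have hcpos : 0 < c := by positivity
  by_cases hw : 1 ≤ c * w
  · have hw0 : 0 < w := by
      rcases h0.eq_or_lt with h | h
      · rw [← h] at hw; simp at hw; linarith
      · exact h
    have := abs_integral_dirKer_mul_le N hw0 h1
    nlinarith [abs_nonneg (∫ t in w..1 / 2, dirKer N t)]
  · push Not at hw
    have e : ∫ t in w..1 / 2, dirKer N t = 1 / 2 - ∫ t in (0 : ℝ)..w, dirKer N t := by
      have := intervalIntegral.integral_add_adjacent_intervals (a := 0) (b := w) (c := 1 / 2)
        ((continuous_dirKer N).intervalIntegrable (μ := volume) _ _)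
        ((continuous_dirKer N).intervalIntegrable _ _)
      rw [integral_dirKer_half N] at this
      linarith
    have := intervalIntegral.norm_integral_le_of_norm_le_const (a := 0) (b := w) (f := dirKer N)
      (C := c) fun t _ => abs_dirKer_le N t
    rw [sub_zero, abs_of_nonneg h0, Real.norm_eq_abs] at this
    rw [e]
    refine (abs_sub _ _).trans ?_
    rw [abs_of_pos (by norm_num : (0 : ℝ) < 1 / 2)]
    linarith

/-- The truncated Fourier sum at `0` of `w ↦ sqWave (X * 2 ^ w)` on `[-1/2, 1/2]`. -/
noncomputable def sqWaveSum (N : ℕ) (X : ℝ) : ℝ :=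
  ∫ w in (-(1 / 2) : ℝ)..1 / 2, sqWave (X * 2 ^ w) * dirKer N w

lemma dirKer_intervalIntegrable (N : ℕ) (a b : ℝ) : IntervalIntegrable (dirKer N) volume a b :=
  (continuous_dirKer N).intervalIntegrable _ _

lemma integral_step_mul_dirKer (N : ℕ) {c : ℝ} (h0 : -(1 / 2) ≤ c) (h1 : c ≤ 1 / 2) :
    ∫ w in (-(1 / 2) : ℝ)..1 / 2, (if c ≤ w then 1 else 0) * dirKer N w
      = ∫ w in c..1 / 2, dirKer N w := by
  have hm : ∀ a b : ℝ, IntervalIntegrable (fun w => (if c ≤ w then 1 else 0) * dirKer N w) volume a b := by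
    intro a b
    refine (dirKer_intervalIntegrable N a b).norm.mono_fun' ?_ (Eventually.of_forall fun w => ?_)
    · exact ((Measurable.ite measurableSet_Ici measurable_const measurable_const).mul
        (continuous_dirKer N).measurable).aestronglyMeasurable
    · simp only []
      split_ifs <;> simp
  rw [← intervalIntegral.integral_add_adjacent_intervals (hm _ c) (hm c _)]
  have e1 : ∫ w in (-(1 / 2) : ℝ)..c, (if c ≤ w then 1 else 0) * dirKer N w
      = ∫ w in (-(1 / 2) : ℝ)..c, (0 : ℝ) :=
    intervalIntegral.integral_congr_Ioo_of_le h0 fun w hw => by simp [not_le.2 hw.2]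
  have e2 : ∫ w in c..1 / 2, (if c ≤ w then 1 else 0) * dirKer N w = ∫ w in c..1 / 2, dirKer N w :=
    intervalIntegral.integral_congr_Ioo_of_le h1 fun w hw => by simp [hw.1.le]
  rw [e1, e2]; simp

lemma step_error (N : ℕ) (c : ℝ) :
    |(∫ w in (-(1 / 2) : ℝ)..1 / 2, (if c ≤ w then 1 else 0) * dirKer N w)
      - (if c ≤ 0 then 1 else 0)| ≤ 2 ∧
    |(∫ w in (-(1 / 2) : ℝ)..1 / 2, (if c ≤ w then 1 else 0) * dirKer N w)
      - (if c ≤ 0 then 1 else 0)| * ((2 * N + 1) * |c|) ≤ 1 := by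
  rcases lt_or_ge (1 / 2) c with h | h
  · have : ∫ w in (-(1 / 2) : ℝ)..1 / 2, (if c ≤ w then 1 else 0) * dirKer N w
        = ∫ w in (-(1 / 2) : ℝ)..1 / 2, (0 : ℝ) :=
      intervalIntegral.integral_congr_Ioo_of_le (by norm_num) fun w hw => by
        simp [not_le.2 (hw.2.trans h)]
    rw [this, if_neg (by linarith)]; simp
  rcases lt_or_ge c (-(1 / 2)) with h' | h'
  · have : ∫ w in (-(1 / 2) : ℝ)..1 / 2, (if c ≤ w then 1 else 0) * dirKer N w
        = ∫ w in (-(1 / 2) : ℝ)..1 / 2, dirKer N w :=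
      intervalIntegral.integral_congr_Ioo_of_le (by norm_num) fun w hw => by
        simp [(h'.trans hw.1).le]
    rw [this, if_pos (by linarith), integral_dirKer]; simp
  rw [integral_step_mul_dirKer N h' h]
  rcases lt_or_ge 0 c with hc | hc
  · rw [if_neg (not_le.2 hc), sub_zero, abs_of_pos hc]
    exact ⟨abs_integral_dirKer_le N hc.le h, abs_integral_dirKer_mul_le N hc h⟩
  · rw [if_pos hc, abs_of_nonpos hc]
    have e : (∫ w in c..1 / 2, dirKer N w) - 1 = - ∫ w in -c..1 / 2, dirKer N w := by
      have h1 := integral_dirKer N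
      have h2 := intervalIntegral.integral_add_adjacent_intervals (a := -(1 / 2)) (b := c)
        (c := 1 / 2) (dirKer_intervalIntegrable N _ _) (dirKer_intervalIntegrable N _ _)
      have h3 := intervalIntegral.integral_comp_neg (a := -(1 / 2)) (b := c) (dirKer N)
      simp only [dirKer_neg, neg_neg] at h3
      linarith
    rw [e, abs_neg]
    refine ⟨abs_integral_dirKer_le N (by linarith) (by linarith), ?_⟩
    rcases hc.eq_or_lt with rfl | hc
    · simp
    · exact abs_integral_dirKer_mul_le N (by linarith) (by linarith)

lemma abs_sub_le_mul_abs_log {X m : ℝ} (hX : 0 < X) (hm : 0 < m) (h : m ≤ 2 * X) :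
    |m - X| ≤ 2 * X * |Real.logb 2 (m / X)| := by
  have hL : 0 < Real.log 2 := Real.log_pos (by norm_num)
  have hL1 : Real.log 2 ≤ 1 := by have := Real.log_two_lt_d9; linarith
  have h1 : |Real.log (m / X)| ≤ |Real.logb 2 (m / X)| := by
    unfold Real.logb
    rw [abs_div, abs_of_pos hL, le_div_iff₀ hL]
    nlinarith [abs_nonneg (Real.log (m / X))]
  refine le_trans ?_ (mul_le_mul_of_nonneg_left h1 (by positivity))
  have ht : 0 < m / X := by positivity
  rcases le_total m X with hmx | hmx
  · have h2 := Real.log_le_sub_one_of_pos ht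
    have h3 : m / X ≤ 1 := by rw [div_le_one hX]; exact hmx
    rw [abs_of_nonpos (by linarith), abs_of_nonpos (by linarith)]
    have : X * (m / X) = m := by field_simp
    nlinarith
  · have h2 := Real.one_sub_inv_le_log_of_pos ht
    have h3 : 1 ≤ m / X := by rw [le_div_iff₀ hX]; linarith
    have h4 : (m / X)⁻¹ ≤ 1 := inv_le_one_of_one_le₀ h3
    rw [abs_of_nonneg (by linarith), abs_of_nonneg (by linarith)]
    have h5 : m * (1 - (m / X)⁻¹) = m - X := by field_simp
    calc m - X = m * (1 - (m / X)⁻¹) := h5.symm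
      _ ≤ 2 * X * (1 - (m / X)⁻¹) := by gcongr
      _ ≤ _ := by gcongr

lemma sum_inv_abs_sub_le (M k : ℕ) (hk : k ≤ M) :
    ∑ m ∈ Finset.range M, 1 / (|(m : ℝ) - k| + 1) ≤ 2 * (1 + Real.log (M + 1)) := by
  have key : ∀ n : ℕ, n ≤ M → ∑ i ∈ Finset.range n, 1 / ((i : ℝ) + 1) ≤ 1 + Real.log (M + 1) := by
    intro n hn
    have h1 := harmonic_le_one_add_log n
    have h2 : ((harmonic n : ℚ) : ℝ) = ∑ i ∈ Finset.range n, 1 / ((i : ℝ) + 1) := by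
      simp [harmonic]
    rw [← h2]
    refine h1.trans ?_
    rcases Nat.eq_zero_or_pos n with rfl | hpos
    · simp; exact Real.log_nonneg (by linarith [(M.cast_nonneg : (0 : ℝ) ≤ M)])
    · gcongr
      have : (n : ℝ) ≤ M := by exact_mod_cast hn
      linarith
  rw [← Finset.sum_range_add_sum_Ico _ hk]
  have h1 : ∑ m ∈ Finset.range k, 1 / (|(m : ℝ) - k| + 1) ≤ 1 + Real.log (M + 1) := by
    rw [← Finset.sum_range_reflect]
    refine le_trans (Finset.sum_le_sum fun i hi => ?_) (key k hk)
    have hi' := Finset.mem_range.1 hi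
    have : ((k - 1 - i : ℕ) : ℝ) - k = -((i : ℝ) + 1) := by
      have : k - 1 - i + (i + 1) = k := by omega
      have : ((k - 1 - i : ℕ) : ℝ) + (i + 1) = k := by exact_mod_cast this
      linarith
    rw [this, abs_neg, abs_of_pos (by positivity)]
    gcongr; linarith
  have h2 : ∑ m ∈ Finset.Ico k M, 1 / (|(m : ℝ) - k| + 1) ≤ 1 + Real.log (M + 1) := by
    rw [Finset.sum_Ico_eq_sum_range]
    refine le_trans (Finset.sum_le_sum fun i hi => ?_) (key (M - k) (Nat.sub_le _ _))
    push_cast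
    rw [add_sub_cancel_left, abs_of_nonneg (by positivity)]
  linarith

/-- Below the truncation point, the truncated Fourier sum is close to the value of the wave. -/
lemma abs_sqWaveSum_sub_le (N : ℕ) {X δ : ℝ} (hX : 0 < X) (hδ : 0 < δ)
    (hδX : ∀ n : ℤ, δ ≤ |X - n|) :
    |sqWaveSum N X - sqWave X| ≤ 2 * min 2 (2 * X / (2 * N + 1) / δ)
      + 12 * X / (2 * N + 1) * (1 + Real.log (2 * X + 1)) := by
  set M := ⌊2 * X⌋₊ with hM
  have hMX : (M : ℝ) ≤ 2 * X := Nat.floor_le (by positivity)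
  have hMX' : 2 * X < M + 1 := Nat.lt_floor_add_one _
  set a : ℝ := 2 * X / (2 * N + 1) with ha
  have ha0 : 0 < a := by positivity
  set c : ℕ → ℝ := fun m => Real.logb 2 ((m + 1) / X) with hc
  set S : ℕ → ℝ := fun m => ∫ w in (-(1 / 2) : ℝ)..1 / 2, (if c m ≤ w then 1 else 0) * dirKer N w
    with hS
  set e : ℕ → ℝ := fun m => S m - (if c m ≤ 0 then 1 else 0) with he
  have hiff : ∀ (m : ℕ) (w : ℝ), (m : ℝ) + 1 ≤ X * 2 ^ w ↔ c m ≤ w := by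
    intro m w
    rw [hc, Real.logb_le_iff_le_rpow (by norm_num) (by positivity), div_le_iff₀ hX, mul_comm]
  have hInt : ∀ m : ℕ, IntervalIntegrable (fun w => (if c m ≤ w then 1 else 0) * dirKer N w)
      volume (-(1 / 2)) (1 / 2) := by
    intro m
    refine (dirKer_intervalIntegrable N _ _).norm.mono_fun' ?_ (Eventually.of_forall fun w => ?_)
    · exact ((Measurable.ite measurableSet_Ici measurable_const measurable_const).mul
        (continuous_dirKer N).measurable).aestronglyMeasurable
    · simp only []
      split_ifs <;> simp
  have hI : sqWaveSum N X = -(1 / 2) + ∑ m ∈ Finset.range M, (-1) ^ m * S m := by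
    have : sqWaveSum N X = ∫ w in (-(1 / 2) : ℝ)..1 / 2, (-(1 / 2) * dirKer N w
        + ∑ m ∈ Finset.range M, (-1) ^ m * ((if c m ≤ w then 1 else 0) * dirKer N w)) := by
      refine intervalIntegral.integral_congr fun w hw => ?_
      rw [uIcc_of_le (by norm_num)] at hw
      have h2 : (2 : ℝ) ^ w ≤ 2 := by
        calc (2 : ℝ) ^ w ≤ 2 ^ (1 : ℝ) := Real.rpow_le_rpow_of_exponent_le (by norm_num)
              (by linarith [hw.2])
          _ = 2 := Real.rpow_one 2
      rw [sqWave_eq_sum M (by positivity) (by nlinarith), add_mul, Finset.sum_mul]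
      congr 1
      refine Finset.sum_congr rfl fun m _ => ?_
      simp only [hiff]; ring
    have hsum : IntervalIntegrable (fun w => ∑ m ∈ Finset.range M,
        (-1) ^ m * ((if c m ≤ w then 1 else 0) * dirKer N w)) volume (-(1 / 2)) (1 / 2) := by
      have := IntervalIntegrable.sum (Finset.range M) fun m _ => (hInt m).const_mul ((-1) ^ m)
      convert! this using 1
      ext w
      simp
    rw [this, intervalIntegral.integral_add ((dirKer_intervalIntegrable N _ _).const_mul _) hsum,
      intervalIntegral.integral_const_mul, integral_dirKer,
      intervalIntegral.integral_finsetSum fun m _ => (hInt m).const_mul _]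
    simp only [intervalIntegral.integral_const_mul, mul_one, hS]
  have hr : sqWave X = -(1 / 2) + ∑ m ∈ Finset.range M, (-1) ^ m * (if c m ≤ 0 then 1 else 0) := by
    rw [sqWave_eq_sum M hX.le (by linarith)]
    congr 1
    refine Finset.sum_congr rfl fun m _ => ?_
    have := hiff m 0
    rw [Real.rpow_zero, mul_one] at this
    simp only [this]
  have hdiff : |sqWaveSum N X - sqWave X| ≤ ∑ m ∈ Finset.range M, |e m| := by
    rw [hI, hr, add_sub_add_left_eq_sub, ← Finset.sum_sub_distrib]
    refine (Finset.abs_sum_le_sum_abs _ _).trans (Finset.sum_le_sum fun m _ => ?_)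
    rw [← mul_sub, abs_mul, abs_pow, abs_neg, abs_one, one_pow, one_mul]
  have he2 : ∀ m, |e m| ≤ 2 := fun m => (step_error N (c m)).1
  have hea : ∀ m < M, |e m| * |(m : ℝ) + 1 - X| ≤ a := by
    intro m hm
    have h1 := (step_error N (c m)).2
    have h2 : (m : ℝ) + 1 ≤ 2 * X := by
      have : (m : ℝ) + 1 ≤ M := by exact_mod_cast hm
      linarith
    have h3 := abs_sub_le_mul_abs_log hX (by positivity : (0 : ℝ) < m + 1) h2
    calc |e m| * |(m : ℝ) + 1 - X| ≤ |e m| * (2 * X * |c m|) := by gcongr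
      _ = (|e m| * ((2 * N + 1) * |c m|)) * a := by rw [ha]; field_simp
      _ ≤ 1 * a := by gcongr
      _ = a := one_mul a
  set k := ⌊X⌋₊ with hk
  have hk1 : (k : ℝ) ≤ X := Nat.floor_le hX.le
  have hk2 : X < k + 1 := Nat.lt_floor_add_one _
  have hkM : k ≤ M := Nat.floor_mono (by linarith)
  have hpt : ∀ m ∈ Finset.range M, |e m| ≤ 3 * a * (1 / (|(m : ℝ) - k| + 1))
      + ((if m = k then min 2 (a / δ) else 0) + (if m + 1 = k then min 2 (a / δ) else 0)) := by
    intro m hm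
    have hm' := Finset.mem_range.1 hm
    have hmin : |e m| ≤ min 2 (a / δ) := by
      refine le_min (he2 m) ?_
      rw [le_div_iff₀ hδ]
      refine le_trans ?_ (hea m hm')
      have := hδX (m + 1)
      rw [abs_sub_comm] at this
      push_cast at this
      gcongr
    have hpos : 0 ≤ 3 * a * (1 / (|(m : ℝ) - k| + 1)) := by positivity
    have hmn : 0 ≤ min 2 (a / δ) := le_min (by norm_num) (by positivity)
    by_cases h1 : m = k
    · rw [if_pos h1, if_neg (by omega)]; linarith
    by_cases h2 : m + 1 = k
    · rw [if_neg h1, if_pos h2]; linarith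
    rw [if_neg h1, if_neg h2, add_zero, add_zero]
    have h3 : |(m : ℝ) - k| + 1 ≤ 3 * |(m : ℝ) + 1 - X| := by
      rcases lt_or_gt_of_ne h1 with h | h
      · have : m + 2 ≤ k := by omega
        have : (m : ℝ) + 2 ≤ k := by exact_mod_cast this
        rw [abs_of_nonpos (by linarith), abs_of_nonpos (by linarith)]; linarith
      · have : (k : ℝ) + 1 ≤ m := by exact_mod_cast h
        rw [abs_of_nonneg (by linarith), abs_of_nonneg (by linarith)]; linarith
    rw [mul_one_div, le_div_iff₀ (by positivity)]
    calc |e m| * (|(m : ℝ) - k| + 1) ≤ |e m| * (3 * |(m : ℝ) + 1 - X|) := by gcongr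
      _ = 3 * (|e m| * |(m : ℝ) + 1 - X|) := by ring
      _ ≤ 3 * a := by gcongr; exact hea m hm'
  refine hdiff.trans ((Finset.sum_le_sum hpt).trans ?_)
  rw [Finset.sum_add_distrib, ← Finset.mul_sum, Finset.sum_add_distrib]
  have s0 := sum_inv_abs_sub_le M k hkM
  have hmn : 0 ≤ min 2 (a / δ) := le_min (by norm_num) (by positivity)
  have s1 : ∑ m ∈ Finset.range M, (if m = k then min 2 (a / δ) else 0) ≤ min 2 (a / δ) := by
    rw [Finset.sum_ite_eq']; split_ifs <;> linarith
  have s2 : ∑ m ∈ Finset.range M, (if m + 1 = k then min 2 (a / δ) else 0) ≤ min 2 (a / δ) := by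
    rcases Nat.eq_zero_or_pos k with h | h
    · rw [Finset.sum_eq_zero]
      · exact hmn
      · intro m _; rw [if_neg (by omega)]
    · have : ∀ m : ℕ, (m + 1 = k) ↔ m = k - 1 := fun m => by omega
      simp only [this]
      rw [Finset.sum_ite_eq']; split_ifs <;> linarith
  have s3 : Real.log (M + 1) ≤ Real.log (2 * X + 1) := by
    apply Real.log_le_log <;> [positivity; linarith]
  have s4 : 3 * a * ∑ m ∈ Finset.range M, 1 / (|(m : ℝ) - k| + 1)
      ≤ 3 * a * (2 * (1 + Real.log (2 * X + 1))) := by gcongr; linarith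
  have s5 : 3 * a * (2 * (1 + Real.log (2 * X + 1)))
      = 12 * X / (2 * N + 1) * (1 + Real.log (2 * X + 1)) := by rw [ha]; ring
  linarith

lemma hasDerivAt_two_rpow (w : ℝ) :
    HasDerivAt (fun w : ℝ => (2 : ℝ) ^ w) (2 ^ w * Real.log 2) w := by
  have := (hasDerivAt_id w).const_rpow (a := (2 : ℝ)) (by norm_num)
  simp only [id] at this
  convert! this using 1; ring

lemma countable_mul_two_rpow_eq_int {X : ℝ} (hX : 0 < X) :
    {w : ℝ | ∃ n : ℤ, X * 2 ^ w = n}.Countable := by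
  have h : {w : ℝ | ∃ n : ℤ, X * 2 ^ w = n}
      = (fun w : ℝ => X * 2 ^ w) ⁻¹' (Set.range ((↑) : ℤ → ℝ)) := by
    ext w; simp [eq_comm]
  rw [h]
  refine (countable_range _).preimage_of_injOn fun w _ v _ hwv => ?_
  have h1 : (2 : ℝ) ^ w = 2 ^ v := mul_left_cancel₀ hX.ne' hwv
  exact (Real.rpow_right_inj (by norm_num) (by norm_num)).1 h1

/-- Integration by parts against a rapidly oscillating `φ (X * 2 ^ w)` whose primitive is
bounded. -/
lemma abs_integral_comp_mul_two_rpow_le {φ Φ G G' : ℝ → ℝ} {B K X a b : ℝ} (hΦc : Continuous Φ)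
    (hB : ∀ u, |Φ u| ≤ B) (hΦ : ∀ u : ℝ, (∀ n : ℤ, u ≠ n) → HasDerivAt Φ (φ u) u)
    (hφm : Measurable φ) (hφb : ∀ u, |φ u| ≤ K) (hX : 0 < X) (hab : a ≤ b)
    (ha : -(1 / 2) ≤ a) (hG : ∀ w ∈ Icc a b, HasDerivAt G (G' w) w)
    (hG' : ContinuousOn G' (Icc a b)) :
    |∫ w in a..b, φ (X * 2 ^ w) * G w|
      ≤ 4 * B / X * (|G a| + |G b| + ∫ w in a..b, (|G w| + |G' w|)) := by
  set L := Real.log 2 with hL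
  have hL0 : 0 < L := Real.log_pos (by norm_num)
  have hL1 : L ≤ 1 := by have := Real.log_two_lt_d9; linarith
  have hL2 : 1 / 2 ≤ L := by have := Real.log_two_gt_d9; linarith
  have hB0 : 0 ≤ B := (abs_nonneg _).trans (hB 0)
  have hGc : ContinuousOn G (Icc a b) := fun w hw => (hG w hw).continuousAt.continuousWithinAt
  have hpc : Continuous fun w : ℝ => (2 : ℝ) ^ (-w) :=
    (Real.continuous_const_rpow (by norm_num : (2 : ℝ) ≠ 0)).comp continuous_neg
  have hpc2 : Continuous fun w : ℝ => (2 : ℝ) ^ w :=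
    Real.continuous_const_rpow (by norm_num : (2 : ℝ) ≠ 0)
  have hp : ∀ w : ℝ, -(1 / 2) ≤ w → (2 : ℝ) ^ (-w) ≤ 2 := by
    intro w hw
    calc (2 : ℝ) ^ (-w) ≤ 2 ^ (1 : ℝ) :=
          Real.rpow_le_rpow_of_exponent_le (by norm_num) (by linarith)
      _ = 2 := Real.rpow_one 2
  have hXc : Continuous fun w : ℝ => X * 2 ^ w := continuous_const.mul hpc2
  set F : ℝ → ℝ := fun w => Φ (X * 2 ^ w) * (G w * 2 ^ (-w)) / (X * L) with hF
  set E : ℝ → ℝ := fun w => Φ (X * 2 ^ w) * ((G' w - L * G w) * 2 ^ (-w)) / (X * L) with hE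
  have hEc : ContinuousOn E (Icc a b) := by
    apply ContinuousOn.div_const
    exact (hΦc.comp hXc).continuousOn.mul ((hG'.sub (continuousOn_const.mul hGc)).mul hpc.continuousOn)
  have hEi : IntervalIntegrable E volume a b := by
    apply ContinuousOn.intervalIntegrable; rwa [uIcc_of_le hab]
  have hGi : IntervalIntegrable G volume a b := by
    apply ContinuousOn.intervalIntegrable; rwa [uIcc_of_le hab]
  have hφi : IntervalIntegrable (fun w => φ (X * 2 ^ w) * G w) volume a b := by
    refine (hGi.norm.const_mul K).mono_fun' ?_ (Eventually.of_forall fun w => ?_)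
    · rw [uIoc_of_le hab]
      refine AEStronglyMeasurable.mul (hφm.comp hXc.measurable).aestronglyMeasurable ?_
      exact (intervalIntegrable_iff_integrableOn_Ioc_of_le hab).1 hGi |>.aestronglyMeasurable
    · beta_reduce
      rw [norm_mul]
      gcongr
      exact hφb _
  have hFTC : ∫ w in a..b, (φ (X * 2 ^ w) * G w + E w) = F b - F a := by
    refine MeasureTheory.integral_eq_of_hasDerivAt_off_countable_of_le F _ hab
      (countable_mul_two_rpow_eq_int hX) ?_ (fun w hw => ?_) (hφi.add hEi)
    · apply ContinuousOn.div_const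
      exact (hΦc.comp hXc).continuousOn.mul (hGc.mul hpc.continuousOn)
    · have hw' : ∀ n : ℤ, X * 2 ^ w ≠ n := fun n hn => hw.2 ⟨n, hn⟩
      have h1 := (hΦ _ hw').comp w ((hasDerivAt_two_rpow w).const_mul X)
      have h2 : HasDerivAt (fun w : ℝ => (2 : ℝ) ^ (-w)) (2 ^ (-w) * L * (-1)) w :=
        (hasDerivAt_two_rpow (-w)).comp w (hasDerivAt_neg w)
      have h3 := (h1.mul ((hG w (Ioo_subset_Icc_self hw.1)).mul h2)).div_const (X * L)
      refine h3.congr_deriv ?_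
      have h4 : (2 : ℝ) ^ w * 2 ^ (-w) = 1 := by
        rw [← Real.rpow_add (by norm_num)]; simp
      simp only [hE, Function.comp, Pi.mul_apply, ← hL]
      have : (2 : ℝ) ^ (-w) = ((2 : ℝ) ^ w)⁻¹ := Real.rpow_neg (by norm_num) _
      rw [this]
      field_simp
      ring
  rw [intervalIntegral.integral_add hφi hEi] at hFTC
  have hFb : ∀ w : ℝ, -(1 / 2) ≤ w → |F w| ≤ 4 * B / X * |G w| := by
    intro w hw
    rw [hF]
    simp only [abs_div, abs_mul, abs_of_pos hX, abs_of_pos hL0,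
      abs_of_pos (Real.rpow_pos_of_pos (by norm_num : (0 : ℝ) < 2) (-w))]
    rw [div_mul_eq_mul_div, div_le_div_iff₀ (by positivity) hX]
    calc |Φ (X * 2 ^ w)| * (|G w| * 2 ^ (-w)) * X ≤ B * (|G w| * 2) * X := by
          gcongr
          · exact hB _
          · exact hp w hw
      _ = 4 * B * |G w| * (X * (1 / 2)) := by ring
      _ ≤ 4 * B * |G w| * (X * L) := by gcongr
  have hEb : ∀ w : ℝ, -(1 / 2) ≤ w → |E w| ≤ 4 * B / X * (|G w| + |G' w|) := by
    intro w hw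
    rw [hE]
    simp only [abs_div, abs_mul, abs_of_pos hX, abs_of_pos hL0,
      abs_of_pos (Real.rpow_pos_of_pos (by norm_num : (0 : ℝ) < 2) (-w))]
    rw [div_mul_eq_mul_div, div_le_div_iff₀ (by positivity) hX]
    have h5 : |G' w - L * G w| ≤ |G w| + |G' w| := by
      calc |G' w - L * G w| ≤ |G' w| + |L * G w| := abs_sub _ _
        _ ≤ |G' w| + 1 * |G w| := by rw [abs_mul, abs_of_pos hL0]; gcongr
        _ = _ := by ring
    calc |Φ (X * 2 ^ w)| * (|G' w - L * G w| * 2 ^ (-w)) * X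
        ≤ B * ((|G w| + |G' w|) * 2) * X := by
          gcongr
          · exact hB _
          · exact hp w hw
      _ = 4 * B * (|G w| + |G' w|) * (X * (1 / 2)) := by ring
      _ ≤ 4 * B * (|G w| + |G' w|) * (X * L) := by gcongr
  have hGG : IntervalIntegrable (fun w => |G w| + |G' w|) volume a b := by
    apply ContinuousOn.intervalIntegrable; rw [uIcc_of_le hab]; exact hGc.abs.add hG'.abs
  have hEI : |∫ w in a..b, E w| ≤ 4 * B / X * ∫ w in a..b, (|G w| + |G' w|) := by
    rw [← intervalIntegral.integral_const_mul]
    refine (intervalIntegral.abs_integral_le_integral_abs hab).trans ?_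
    exact intervalIntegral.integral_mono_on hab hEi.abs (hGG.const_mul _)
      fun w hw => hEb w (ha.trans hw.1)
  have e : ∫ w in a..b, φ (X * 2 ^ w) * G w = F b - F a - ∫ w in a..b, E w := by linarith
  rw [e]
  calc |F b - F a - ∫ w in a..b, E w| ≤ |F b - F a| + |∫ w in a..b, E w| := abs_sub _ _
    _ ≤ |F b| + |F a| + |∫ w in a..b, E w| := by gcongr; exact abs_sub _ _
    _ ≤ 4 * B / X * |G b| + 4 * B / X * |G a| + 4 * B / X * ∫ w in a..b, (|G w| + |G' w|) := by
        gcongr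
        · exact hFb b (ha.trans hab)
        · exact hFb a ha
    _ = _ := by ring

lemma integral_div_one_add_mul {c a : ℝ} (hc : 0 ≤ c) (ha : 0 ≤ a) :
    ∫ w in (0 : ℝ)..a, c / (1 + c * |w|) = Real.log (1 + c * a) := by
  have h1 : ∫ w in (0 : ℝ)..a, c / (1 + c * |w|) = ∫ w in (0 : ℝ)..a, c / (1 + c * w) :=
    intervalIntegral.integral_congr_Ioo_of_le ha fun w hw => by simp only [abs_of_pos hw.1]
  rw [h1, intervalIntegral.integral_eq_sub_of_hasDerivAt (f := fun w => Real.log (1 + c * w))]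
  · simp
  · intro w hw
    rw [uIcc_of_le ha] at hw
    have h2 : HasDerivAt (fun w => 1 + c * w) c w := by
      simpa using ((hasDerivAt_id w).const_mul c).const_add 1
    have : 0 ≤ c * w := mul_nonneg hc hw.1
    exact h2.log (by positivity)
  · apply ContinuousOn.intervalIntegrable
    rw [uIcc_of_le ha]
    refine ContinuousOn.div (by fun_prop) (by fun_prop) fun w hw => ?_
    have : 0 ≤ c * w := mul_nonneg hc hw.1
    positivity

/-- Above the truncation point, the truncated Fourier sum is small. -/
lemma abs_sqWaveSum_le (N : ℕ) {X : ℝ} (hX : 0 < X) :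
    |sqWaveSum N X| ≤ 140 * ((2 * N + 1) * (1 + Real.log (2 * N + 1))) / X := by
  set c : ℝ := 2 * N + 1 with hc
  have hc1 : 1 ≤ c := by rw [hc]; linarith [(N.cast_nonneg : (0 : ℝ) ≤ N)]
  have h := abs_integral_comp_mul_two_rpow_le (φ := sqWave) (Φ := sqWavePrim) (G := dirKer N)
    (G' := dirKerDeriv N) (B := 1) (K := 1 / 2) (X := X) (a := -(1 / 2)) (b := 1 / 2)
    continuous_sqWavePrim abs_sqWavePrim_le (fun u hu => hasDerivAt_sqWavePrim hu)
    measurable_sqWave (fun u => (abs_sqWave u).le) hX (by norm_num) le_rfl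
    (fun w _ => hasDerivAt_dirKer N w) (continuous_dirKerDeriv N).continuousOn
  have h1 : |dirKer N (1 / 2)| ≤ 1 := by
    have := abs_dirKer_mul_le N (w := 1 / 2) (by norm_num)
    norm_num at this ⊢; exact this
  have h2 : |dirKer N (-(1 / 2))| ≤ 1 := by rwa [dirKer_neg]
  have hcont : Continuous fun w : ℝ => c / (1 + c * |w|) :=
    continuous_const.div (by fun_prop) fun w => by positivity
  have hInt : ∫ w in (-(1 / 2) : ℝ)..1 / 2, c / (1 + c * |w|) = 2 * Real.log (1 + c * (1 / 2)) := by
    have e1 := integral_div_one_add_mul (c := c) (a := 1 / 2) (by positivity) (by norm_num)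
    have e2 := intervalIntegral.integral_comp_neg (a := 0) (b := 1 / 2)
      (fun w : ℝ => c / (1 + c * |w|))
    have e3 := intervalIntegral.integral_add_adjacent_intervals (a := -(1 / 2)) (b := 0) (c := 1 / 2)
      (hcont.intervalIntegrable (μ := volume) _ _) (hcont.intervalIntegrable _ _)
    simp only [abs_neg, neg_zero] at e2
    linarith
  have h3 : ∫ w in (-(1 / 2) : ℝ)..1 / 2, (|dirKer N w| + |dirKerDeriv N w|)
      ≤ c + 5 * Real.pi * c * (2 * Real.log (1 + c * (1 / 2))) := by
    rw [← hInt]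
    have e : c + 5 * Real.pi * c * (∫ w in (-(1 / 2) : ℝ)..1 / 2, c / (1 + c * |w|))
        = ∫ w in (-(1 / 2) : ℝ)..1 / 2, (c + 5 * Real.pi * c * (c / (1 + c * |w|))) := by
      rw [intervalIntegral.integral_add intervalIntegrable_const
        ((hcont.intervalIntegrable _ _).const_mul _), intervalIntegral.integral_const_mul,
        intervalIntegral.integral_const]
      norm_num
    rw [e]
    refine intervalIntegral.integral_mono_on (by norm_num)
      (((continuous_dirKer N).abs.add (continuous_dirKerDeriv N).abs).intervalIntegrable _ _)
      ((continuous_const.add (continuous_const.mul hcont)).intervalIntegrable _ _) fun w hw => ?_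
    refine add_le_add (abs_dirKer_le N w) ?_
    have b1 := abs_dirKerDeriv_le N w
    have b2 := abs_dirKerDeriv_mul_le N (w := w) (abs_le.2 hw)
    rw [← hc] at b1 b2
    rw [← mul_div_assoc, le_div_iff₀ (by positivity)]
    nlinarith
  have h4 : Real.log (1 + c * (1 / 2)) ≤ 1 + Real.log c := by
    have e : 1 + Real.log c = Real.log (Real.exp 1 * c) := by
      rw [Real.log_mul (by positivity) (by positivity), Real.log_exp]
    rw [e]
    apply Real.log_le_log (by positivity)
    nlinarith [Real.add_one_le_exp 1]
  have h5 : 0 ≤ Real.log c := Real.log_nonneg hc1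
  refine h.trans ?_
  have h7 : 0 ≤ Real.log (1 + c * (1 / 2)) := Real.log_nonneg (by linarith)
  have h6 : 5 * Real.pi * c * (2 * Real.log (1 + c * (1 / 2))) ≤ 5 * 3.2 * c * (2 * (1 + Real.log c)) := by
    gcongr
    linarith [Real.pi_lt_d2]
  rw [mul_one, div_mul_eq_mul_div]
  refine div_le_div_of_nonneg_right ?_ hX.le
  nlinarith [mul_nonneg (by linarith : 0 ≤ c) h5]

lemma abs_integral_sub_le_of_deriv_bound {f F F' B B' : ℝ → ℝ} {a b : ℝ} (hab : a ≤ b)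
    (hf : ContinuousOn f (Icc a b)) (hF : ∀ w ∈ Icc a b, HasDerivAt F (F' w) w)
    (hB : ∀ w ∈ Icc a b, HasDerivAt B (B' w) w) (h : ∀ w ∈ Icc a b, |f w - F' w| ≤ B' w) :
    |(∫ w in a..b, f w) - (F b - F a)| ≤ B b - B a := by
  have hfi : IntervalIntegrable f volume a b := by
    apply ContinuousOn.intervalIntegrable; rwa [uIcc_of_le hab]
  set G : ℝ → ℝ := fun x => (∫ w in a..x, f w) - F x with hG
  have hGc : ContinuousOn G (Icc a b) := by
    refine ContinuousOn.sub ?_ fun w hw => (hF w hw).continuousAt.continuousWithinAt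
    have := intervalIntegral.continuousOn_primitive_interval (μ := volume) (f := f) (a := a) (b := b)
      (by rw [uIcc_of_le hab]; exact hf.integrableOn_Icc)
    rwa [uIcc_of_le hab] at this
  have hBc : ContinuousOn B (Icc a b) := fun w hw => (hB w hw).continuousAt.continuousWithinAt
  have hGd : ∀ w ∈ Ioo a b, HasDerivAt G (f w - F' w) w := by
    intro w hw
    have hw' := Ioo_subset_Icc_self hw
    refine HasDerivAt.sub ?_ (hF w hw')
    have hnhds : Icc a b ∈ 𝓝 w := Icc_mem_nhds hw.1 hw.2
    refine intervalIntegral.integral_hasDerivAt_right (hfi.mono_set ?_) ?_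
      (hf.continuousAt hnhds)
    · rw [uIcc_of_le hab, uIcc_of_le hw'.1]; exact Icc_subset_Icc le_rfl hw'.2
    · exact ContinuousOn.stronglyMeasurableAtFilter_nhdsWithin hf measurableSet_Icc w |>.filter_mono
        (by rw [nhdsWithin_eq_nhds.2 hnhds])
  have hInt : interior (Icc a b) = Ioo a b := interior_Icc
  have m1 : MonotoneOn (fun x => B x - G x) (Icc a b) := by
    refine monotoneOn_of_hasDerivWithinAt_nonneg (f' := fun w => B' w - (f w - F' w))
      (convex_Icc a b) (hBc.sub hGc) (fun w hw => ?_) fun w hw => ?_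
    · rw [hInt] at hw ⊢
      exact ((hB w (Ioo_subset_Icc_self hw)).sub (hGd w hw)).hasDerivWithinAt
    · rw [hInt] at hw
      have := (abs_le.1 (h w (Ioo_subset_Icc_self hw))).2
      linarith
  have m2 : MonotoneOn (fun x => B x + G x) (Icc a b) := by
    refine monotoneOn_of_hasDerivWithinAt_nonneg (f' := fun w => B' w + (f w - F' w))
      (convex_Icc a b) (hBc.add hGc) (fun w hw => ?_) fun w hw => ?_
    · rw [hInt] at hw ⊢
      exact ((hB w (Ioo_subset_Icc_self hw)).add (hGd w hw)).hasDerivWithinAt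
    · rw [hInt] at hw
      have := (abs_le.1 (h w (Ioo_subset_Icc_self hw))).1
      linarith
  have h1 := m1 (left_mem_Icc.2 hab) (right_mem_Icc.2 hab) hab
  have h2 := m2 (left_mem_Icc.2 hab) (right_mem_Icc.2 hab) hab
  simp only [hG, intervalIntegral.integral_same] at h1 h2
  rw [abs_le]
  constructor <;> linarith

/-- Van der Corput's second derivative test with a decreasing amplitude. -/
lemma abs_integral_mul_cos_le {g g' ψ ψ' ψ'' : ℝ → ℝ} {a b μ : ℝ} (hab : a ≤ b) (hμ : 0 < μ)
    (hg : ∀ w ∈ Icc a b, HasDerivAt g (g' w) w) (hg' : ∀ w ∈ Icc a b, g' w ≤ 0)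
    (hg0 : ∀ w ∈ Icc a b, 0 ≤ g w)
    (hψ : ∀ w ∈ Icc a b, HasDerivAt ψ (ψ' w) w) (hψ' : ∀ w ∈ Icc a b, HasDerivAt ψ' (ψ'' w) w)
    (hψ'' : ∀ w ∈ Icc a b, μ ≤ ψ'' w) :
    |∫ w in a..b, g w * Real.cos (ψ w)| ≤ 8 * g a / √μ := by
  set τ := √μ with hτ
  have hτ0 : 0 < τ := Real.sqrt_pos.2 hμ
  have hτ2 : τ ^ 2 = μ := Real.sq_sqrt hμ.le
  have hgc : ContinuousOn g (Icc a b) := fun w hw => (hg w hw).continuousAt.continuousWithinAt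
  have hψc : ContinuousOn ψ (Icc a b) := fun w hw => (hψ w hw).continuousAt.continuousWithinAt
  have hanti : AntitoneOn g (Icc a b) :=
    antitoneOn_of_hasDerivWithinAt_nonpos (convex_Icc a b) hgc
      (fun w hw => (hg w (interior_subset hw)).hasDerivWithinAt) fun w hw => hg' w (interior_subset hw)
  have hga : ∀ w ∈ Icc a b, g w ≤ g a := fun w hw => hanti (left_mem_Icc.2 hab) hw hw.1
  have hga0 : 0 ≤ g a := hg0 a (left_mem_Icc.2 hab)
  have hD : ∀ w, 0 < ψ' w ^ 2 + τ ^ 2 := fun w => by positivity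
  have hAb : ∀ w, |ψ' w / (ψ' w ^ 2 + τ ^ 2)| ≤ 1 / (2 * τ) := by
    intro w
    rw [abs_div, abs_of_pos (hD w), div_le_div_iff₀ (hD w) (by positivity), ← sq_abs]
    nlinarith [sq_nonneg (|ψ' w| - τ)]
  set A : ℝ → ℝ := fun w => g w * (ψ' w / (ψ' w ^ 2 + τ ^ 2)) with hA
  set A' : ℝ → ℝ := fun w => g' w * (ψ' w / (ψ' w ^ 2 + τ ^ 2))
    + g w * (ψ'' w * (τ ^ 2 - ψ' w ^ 2) / (ψ' w ^ 2 + τ ^ 2) ^ 2) with hA'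
  have hAd : ∀ w ∈ Icc a b, HasDerivAt A (A' w) w := by
    intro w hw
    have h1 := (hψ' w hw).div (((hψ' w hw).pow 2).add_const (τ ^ 2)) (hD w).ne'
    refine ((hg w hw).mul h1).congr_deriv ?_
    simp only [hA', Pi.div_apply, Pi.pow_apply]
    congr 2
    congr 1
    push_cast; ring
  have hFd : ∀ w ∈ Icc a b, HasDerivAt (fun w => A w * Real.sin (ψ w))
      (A' w * Real.sin (ψ w) + A w * (Real.cos (ψ w) * ψ' w)) w :=
    fun w hw => (hAd w hw).mul (hψ w hw).sin
  have hBd : ∀ w ∈ Icc a b, HasDerivAt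
      (fun w => -(1 / (2 * τ)) * g w + (2 * g a / τ) * Real.arctan (ψ' w / τ))
      (-(1 / (2 * τ)) * g' w + (2 * g a / τ) * (1 / (1 + (ψ' w / τ) ^ 2) * (ψ'' w / τ))) w :=
    fun w hw => ((hg w hw).const_mul _).add ((((hψ' w hw).div_const τ).arctan).const_mul _)
  have key := abs_integral_sub_le_of_deriv_bound (f := fun w => g w * Real.cos (ψ w)) hab
    (hgc.mul (Real.continuous_cos.comp_continuousOn hψc)) hFd hBd (fun w hw => by
      have hψp : 0 < ψ'' w := hμ.trans_le (hψ'' w hw)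
      have e : g w * Real.cos (ψ w) - (A' w * Real.sin (ψ w) + A w * (Real.cos (ψ w) * ψ' w))
          = g w * (τ ^ 2 / (ψ' w ^ 2 + τ ^ 2)) * Real.cos (ψ w) - A' w * Real.sin (ψ w) := by
        simp only [hA]
        have := (hD w).ne'
        field_simp
        ring
      have e2 : (2 * g a / τ) * (1 / (1 + (ψ' w / τ) ^ 2) * (ψ'' w / τ))
          = 2 * (g a * (ψ'' w / (ψ' w ^ 2 + τ ^ 2))) := by
        have := (hD w).ne'
        have h3 : 1 + (ψ' w / τ) ^ 2 = (ψ' w ^ 2 + τ ^ 2) / τ ^ 2 := by field_simp; ring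
        rw [h3]; field_simp
      rw [e, e2]
      have b1 : |g w * (τ ^ 2 / (ψ' w ^ 2 + τ ^ 2)) * Real.cos (ψ w)|
          ≤ g a * (ψ'' w / (ψ' w ^ 2 + τ ^ 2)) := by
        rw [abs_mul, abs_mul, abs_of_nonneg (hg0 w hw), abs_of_pos (div_pos (by positivity) (hD w))]
        calc g w * (τ ^ 2 / (ψ' w ^ 2 + τ ^ 2)) * |Real.cos (ψ w)|
            ≤ g w * (τ ^ 2 / (ψ' w ^ 2 + τ ^ 2)) * 1 := by
              gcongr
              · exact mul_nonneg (hg0 w hw) (div_pos (by positivity) (hD w)).le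
              · exact Real.abs_cos_le_one _
          _ ≤ g a * (ψ'' w / (ψ' w ^ 2 + τ ^ 2)) := by
              rw [mul_one, hτ2]
              gcongr
              · exact hga w hw
              · exact hψ'' w hw
      have b2 : |A' w * Real.sin (ψ w)|
          ≤ -(1 / (2 * τ)) * g' w + g a * (ψ'' w / (ψ' w ^ 2 + τ ^ 2)) := by
        rw [abs_mul]
        have c1 : |g' w * (ψ' w / (ψ' w ^ 2 + τ ^ 2))| ≤ -(1 / (2 * τ)) * g' w := by
          rw [abs_mul, abs_of_nonpos (hg' w hw)]
          have := mul_le_mul_of_nonneg_left (hAb w) (neg_nonneg.2 (hg' w hw))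
          linarith
        have c2 : |g w * (ψ'' w * (τ ^ 2 - ψ' w ^ 2) / (ψ' w ^ 2 + τ ^ 2) ^ 2)|
            ≤ g a * (ψ'' w / (ψ' w ^ 2 + τ ^ 2)) := by
          rw [abs_mul, abs_of_nonneg (hg0 w hw), abs_div, abs_mul, abs_of_pos hψp,
            abs_of_pos (pow_pos (hD w) 2)]
          have c3 : |τ ^ 2 - ψ' w ^ 2| ≤ ψ' w ^ 2 + τ ^ 2 := by
            rw [abs_le]; constructor <;> nlinarith [sq_nonneg τ, sq_nonneg (ψ' w)]
          calc g w * (ψ'' w * |τ ^ 2 - ψ' w ^ 2| / (ψ' w ^ 2 + τ ^ 2) ^ 2)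
              ≤ g a * (ψ'' w * (ψ' w ^ 2 + τ ^ 2) / (ψ' w ^ 2 + τ ^ 2) ^ 2) := by
                have := hg0 w hw
                gcongr
                exact hga w hw
            _ = g a * (ψ'' w / (ψ' w ^ 2 + τ ^ 2)) := by
                have := (hD w).ne'
                field_simp
        calc |A' w| * |Real.sin (ψ w)| ≤ |A' w| * 1 := by gcongr; exact Real.abs_sin_le_one _
          _ ≤ _ := by
              rw [mul_one]
              exact (abs_add_le _ _).trans (add_le_add c1 c2)
      calc _ ≤ _ := abs_sub _ _
        _ ≤ _ := add_le_add b1 b2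
        _ = _ := by ring)
  have hAs : ∀ w ∈ Icc a b, |A w * Real.sin (ψ w)| ≤ g a * (1 / (2 * τ)) := by
    intro w hw
    rw [abs_mul, hA, abs_mul, abs_of_nonneg (hg0 w hw)]
    calc g w * |ψ' w / (ψ' w ^ 2 + τ ^ 2)| * |Real.sin (ψ w)| ≤ g a * (1 / (2 * τ)) * 1 := by
          gcongr
          · exact hga w hw
          · exact hAb w
          · exact Real.abs_sin_le_one _
      _ = _ := mul_one _
  have h1 := hAs a (left_mem_Icc.2 hab)
  have h2 := hAs b (right_mem_Icc.2 hab)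
  have h3 : (2 * g a / τ) * Real.arctan (ψ' b / τ) ≤ (2 * g a / τ) * (Real.pi / 2) := by
    gcongr; exact (Real.arctan_lt_pi_div_two _).le
  have h4 : (2 * g a / τ) * (-(Real.pi / 2)) ≤ (2 * g a / τ) * Real.arctan (ψ' a / τ) := by
    gcongr; exact (Real.neg_pi_div_two_lt_arctan _).le
  have h5 : 0 ≤ 1 / (2 * τ) * g b := mul_nonneg (by positivity) (hg0 b (right_mem_Icc.2 hab))
  have h6 : (2 * g a / τ) * (Real.pi / 2) ≤ (2 * g a / τ) * (3.2 / 2) := by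
    gcongr; linarith [Real.pi_lt_d2]
  have e1 : g a * (1 / (2 * τ)) = (1 / 2) * (g a / τ) := by field_simp
  have e2 : (2 * g a / τ) * (3.2 / 2) = 3.2 * (g a / τ) := by field_simp
  have e3 : 8 * g a / τ = 8 * (g a / τ) := by ring
  have e4 : 1 / (2 * τ) * g a = (1 / 2) * (g a / τ) := by field_simp
  have h7 : 0 ≤ g a / τ := by positivity
  beta_reduce at key
  rw [abs_le] at key h1 h2 ⊢
  rw [e3]
  constructor <;> linarith [key.1, key.2, h1.1, h1.2, h2.1, h2.2]

lemma sin_pi_mul_pos {w : ℝ} (h0 : 0 < w) (h1 : w ≤ 1 / 2) : 0 < Real.sin (Real.pi * w) :=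
  Real.sin_pos_of_pos_of_lt_pi (by positivity) (by nlinarith [Real.pi_pos])

lemma hasDerivAt_inv_sin {w : ℝ} (h0 : 0 < w) (h1 : w ≤ 1 / 2) :
    HasDerivAt (fun w => 1 / Real.sin (Real.pi * w))
      (-(Real.cos (Real.pi * w) * Real.pi) / Real.sin (Real.pi * w) ^ 2) w := by
  have h := (((hasDerivAt_id w).const_mul Real.pi).sin).inv (sin_pi_mul_pos h0 h1).ne'
  simp only [id, mul_one] at h
  simp only [one_div]
  exact h

lemma deriv_inv_sin_nonpos {w : ℝ} (h0 : 0 < w) (h1 : w ≤ 1 / 2) :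
    -(Real.cos (Real.pi * w) * Real.pi) / Real.sin (Real.pi * w) ^ 2 ≤ 0 := by
  have : 0 ≤ Real.cos (Real.pi * w) :=
    Real.cos_nonneg_of_neg_pi_div_two_le_of_le (by nlinarith [Real.pi_pos]) (by nlinarith [Real.pi_pos])
  rw [neg_div]
  have := Real.pi_pos
  rw [Left.neg_nonpos_iff]
  positivity

lemma inv_sin_le {w : ℝ} (h0 : 0 < w) (h1 : w ≤ 1 / 2) :
    1 / Real.sin (Real.pi * w) ≤ 1 / (2 * w) := by
  have h := two_mul_abs_le_abs_sin (w := w) (by rwa [abs_of_pos h0])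
  rw [abs_of_pos h0, abs_of_pos (sin_pi_mul_pos h0 h1)] at h
  gcongr

lemma abs_integral_sin_div_sin_le_of_pos {b a : ℝ} (hb : 0 < b) (ha0 : 0 < a) (ha : a ≤ 1 / 2) :
    |∫ w in (0 : ℝ)..a, Real.sin (b * w) * (1 / Real.sin (Real.pi * w))| ≤ 2 := by
  set f : ℝ → ℝ := fun w => Real.sin (b * w) * (1 / Real.sin (Real.pi * w)) with hf
  have hfm : Measurable f := by
    apply Measurable.mul
    · exact (Real.measurable_sin.comp (measurable_const_mul b))
    · exact measurable_const.div (Real.measurable_sin.comp (measurable_const_mul _))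
  have hfb : ∀ w, 0 < w → w ≤ 1 / 2 → |f w| ≤ b / 2 := by
    intro w h0 h1
    have hs := sin_pi_mul_pos h0 h1
    rw [hf, abs_mul, abs_of_pos (one_div_pos.2 hs)]
    calc |Real.sin (b * w)| * (1 / Real.sin (Real.pi * w)) ≤ (b * w) * (1 / (2 * w)) := by
          refine mul_le_mul ?_ (inv_sin_le h0 h1) (one_div_pos.2 hs).le (by positivity)
          exact Real.abs_sin_le_abs.trans_eq (abs_of_pos (by positivity))
      _ = b / 2 := by field_simp
  have hfi : ∀ x y, 0 ≤ x → x ≤ y → y ≤ 1 / 2 → IntervalIntegrable f volume x y := by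
    intro x y hx hxy hy
    refine (intervalIntegrable_const (c := b / 2)).mono_fun' hfm.aestronglyMeasurable ?_
    rw [uIoc_of_le hxy]
    exact (ae_restrict_iff' measurableSet_Ioc).2 (Eventually.of_forall fun w hw =>
      hfb w (hx.trans_lt hw.1) (hw.2.trans hy))
  have hsmall : ∀ x, 0 < x → x ≤ 1 / 2 → x ≤ 1 / b → |∫ w in (0 : ℝ)..x, f w| ≤ 1 / 2 := by
    intro x h0 h1 h2
    have := intervalIntegral.norm_integral_le_of_norm_le_const (a := 0) (b := x) (f := f)
      (C := b / 2) fun w hw => by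
        rw [uIoc_of_le h0.le] at hw
        exact hfb w hw.1 (hw.2.trans h1)
    rw [sub_zero, abs_of_pos h0, Real.norm_eq_abs] at this
    refine this.trans ?_
    calc b / 2 * x ≤ b / 2 * (1 / b) := by gcongr
      _ = 1 / 2 := by field_simp
  rcases le_or_gt a (1 / b) with h | h
  · linarith [hsmall a ha0 ha h]
  have hb0 : 0 < 1 / b := by positivity
  rw [← intervalIntegral.integral_add_adjacent_intervals (b := 1 / b)
    (hfi _ _ le_rfl hb0.le (h.le.trans ha)) (hfi _ _ hb0.le h.le ha)]
  have h1 := hsmall (1 / b) hb0 (h.le.trans ha) le_rfl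
  set g : ℝ → ℝ := fun w => 1 / Real.sin (Real.pi * w) with hg
  set g' : ℝ → ℝ := fun w => -(Real.cos (Real.pi * w) * Real.pi) / Real.sin (Real.pi * w) ^ 2 with hg'
  have hgd : ∀ w ∈ Icc (1 / b) a, HasDerivAt g (g' w) w := fun w hw =>
    hasDerivAt_inv_sin (hb0.trans_le hw.1) (hw.2.trans ha)
  have key := abs_integral_sub_le_of_deriv_bound (f := f) (a := 1 / b) (b := a)
    (F := fun w => -Real.cos (b * w) / b * g w)
    (F' := fun w => Real.sin (b * w) * g w + -Real.cos (b * w) / b * g' w)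
    (B := fun w => -(1 / b) * g w) (B' := fun w => -(1 / b) * g' w) h.le
    (ContinuousOn.mul (by fun_prop) fun w hw => (hgd w hw).continuousAt.continuousWithinAt)
    (fun w hw => by
      have h2 := (((((hasDerivAt_id w).const_mul b).cos).neg).div_const b).mul (hgd w hw)
      refine h2.congr_deriv ?_
      simp only [id, Pi.neg_apply]
      field_simp)
    (fun w hw => (hgd w hw).const_mul _)
    (fun w hw => by
      have e : f w - (Real.sin (b * w) * g w + -Real.cos (b * w) / b * g' w)
          = (1 / b * g' w) * Real.cos (b * w) := by simp only [hf, hg]; ring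
      have h3 : g' w ≤ 0 := deriv_inv_sin_nonpos (hb0.trans_le hw.1) (hw.2.trans ha)
      rw [e, abs_mul, abs_mul, abs_of_pos hb0, abs_of_nonpos h3]
      calc 1 / b * -g' w * |Real.cos (b * w)| ≤ 1 / b * -g' w * 1 := by
            gcongr
            · exact mul_nonneg hb0.le (neg_nonneg.2 h3)
            · exact Real.abs_cos_le_one _
        _ = _ := by ring)
  beta_reduce at key
  have hga : ∀ w, 1 / b ≤ w → w ≤ a → 0 < g w ∧ 1 / b * g w ≤ 1 / 2 := by
    intro w h2 h3
    have hw := hb0.trans_le h2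
    refine ⟨one_div_pos.2 (sin_pi_mul_pos hw (h3.trans ha)), ?_⟩
    calc 1 / b * g w ≤ w * (1 / (2 * w)) := by
          gcongr
          · exact (one_div_pos.2 (sin_pi_mul_pos hw (h3.trans ha))).le
          · exact inv_sin_le hw (h3.trans ha)
      _ = 1 / 2 := by field_simp
  have hbd : ∀ w, 1 / b ≤ w → w ≤ a → |-Real.cos (b * w) / b * g w| ≤ 1 / 2 := by
    intro w h2 h3
    obtain ⟨h4, h5⟩ := hga w h2 h3
    rw [abs_mul, abs_div, abs_neg, abs_of_pos hb, abs_of_pos h4]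
    calc |Real.cos (b * w)| / b * g w ≤ 1 / b * g w := by
          gcongr; exact Real.abs_cos_le_one _
      _ ≤ 1 / 2 := h5
  have b1 := hbd a h.le le_rfl
  have b2 := hbd (1 / b) le_rfl h.le
  obtain ⟨c1, c2⟩ := hga a h.le le_rfl
  obtain ⟨c3, c4⟩ := hga (1 / b) le_rfl h.le
  have c5 : 0 < 1 / b * g a := mul_pos hb0 c1
  rw [abs_le] at *
  constructor <;> linarith [b1.1, b1.2, b2.1, b2.2, key.1, key.2, h1.1, h1.2]

lemma abs_integral_sin_div_sin_le (b : ℝ) {a : ℝ} (ha0 : 0 < a) (ha : a ≤ 1 / 2) :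
    |∫ w in (0 : ℝ)..a, Real.sin (b * w) * (1 / Real.sin (Real.pi * w))| ≤ 2 := by
  rcases lt_trichotomy b 0 with hb | rfl | hb
  · have h := abs_integral_sin_div_sin_le_of_pos (neg_pos.2 hb) ha0 ha
    simpa [neg_mul, Real.sin_neg, intervalIntegral.integral_neg] using h
  · simp
  · exact abs_integral_sin_div_sin_le_of_pos hb ha0 ha

lemma dirKer_eq_div {N : ℕ} {w : ℝ} (h0 : 0 < w) (h1 : w ≤ 1 / 2) :
    dirKer N w = Real.sin ((2 * N + 1) * Real.pi * w) * (1 / Real.sin (Real.pi * w)) := by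
  have h := sin_pi_mul_pos h0 h1
  rw [← dirKer_mul_sin]; field_simp

lemma intervalIntegrable_sin_div_sin (b : ℝ) {a : ℝ} (ha0 : 0 ≤ a) (ha : a ≤ 1 / 2) :
    IntervalIntegrable (fun w => Real.sin (b * w) * (1 / Real.sin (Real.pi * w))) volume 0 a := by
  refine (intervalIntegrable_const (c := |b| / 2)).mono_fun' (Measurable.aestronglyMeasurable ?_) ?_
  · apply Measurable.mul
    · exact (Real.measurable_sin.comp (measurable_const_mul b))
    · exact measurable_const.div (Real.measurable_sin.comp (measurable_const_mul _))
  rw [uIoc_of_le ha0]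
  refine (ae_restrict_iff' measurableSet_Ioc).2 (Eventually.of_forall fun w hw => ?_)
  have h0 := hw.1
  have h1 := hw.2.trans ha
  have hs := sin_pi_mul_pos h0 h1
  beta_reduce
  rw [Real.norm_eq_abs, abs_mul, abs_of_pos (one_div_pos.2 hs)]
  calc |Real.sin (b * w)| * (1 / Real.sin (Real.pi * w)) ≤ (|b| * w) * (1 / (2 * w)) := by
        refine mul_le_mul ?_ (inv_sin_le h0 h1) (one_div_pos.2 hs).le (by positivity)
        exact Real.abs_sin_le_abs.trans_eq (by rw [abs_mul, abs_of_pos h0])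
    _ = |b| / 2 := by field_simp

lemma abs_integral_cos_two_rpow_div_sin_le {l a γ : ℝ} (hγ : γ = 1 ∨ γ = -1) (ha0 : 0 < a)
    (ha : a ≤ 1 / 2) (hl : l * a ^ 2 = 1) (β θ : ℝ) :
    |∫ w in a..1 / 2, 1 / Real.sin (Real.pi * w) * Real.cos (l * 2 ^ (γ * w) + β * w + θ)| ≤ 12 := by
  have hγ2 : γ ^ 2 = 1 := by rcases hγ with rfl | rfl <;> norm_num
  have hl0 : 0 < l := by
    by_contra h
    push Not at h
    nlinarith [sq_nonneg a]
  set L := Real.log 2 with hL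
  have hL2 : 2 / 3 ≤ L := by have := Real.log_two_gt_d9; linarith
  have hd : ∀ w, HasDerivAt (fun w : ℝ => (2 : ℝ) ^ (γ * w)) (2 ^ (γ * w) * L * γ) w := fun w => by
    have := (hasDerivAt_two_rpow (γ * w)).comp w ((hasDerivAt_id w).const_mul γ)
    simp only [mul_one] at this
    exact this
  have key := abs_integral_mul_cos_le (g := fun w => 1 / Real.sin (Real.pi * w))
    (g' := fun w => -(Real.cos (Real.pi * w) * Real.pi) / Real.sin (Real.pi * w) ^ 2)
    (ψ := fun w => l * 2 ^ (γ * w) + β * w + θ) (ψ' := fun w => l * (2 ^ (γ * w) * L * γ) + β)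
    (ψ'' := fun w => l * (2 ^ (γ * w) * L * γ * L * γ)) (a := a) (b := 1 / 2)
    (μ := (1 / (3 * a)) ^ 2) ha (by positivity)
    (fun w hw => hasDerivAt_inv_sin (ha0.trans_le hw.1) hw.2)
    (fun w hw => deriv_inv_sin_nonpos (ha0.trans_le hw.1) hw.2)
    (fun w hw => (one_div_pos.2 (sin_pi_mul_pos (ha0.trans_le hw.1) hw.2)).le)
    (fun w hw => by
      have := (((hd w).const_mul l).add ((hasDerivAt_id w).const_mul β)).add_const θ
      simpa using this)
    (fun w hw => ((((hd w).mul_const L).mul_const γ).const_mul l).add_const β)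
    (fun w hw => by
      have h2 : (1 / 2 : ℝ) ≤ 2 ^ (γ * w) := by
        have hw0 : 0 < w := ha0.trans_le hw.1
        have : -1 ≤ γ * w := by rcases hγ with rfl | rfl <;> linarith [hw.2]
        calc (1 / 2 : ℝ) = 2 ^ (-1 : ℝ) := by rw [Real.rpow_neg_one]; norm_num
          _ ≤ 2 ^ (γ * w) := Real.rpow_le_rpow_of_exponent_le (by norm_num) this
      have h3 : (1 / (3 * a)) ^ 2 = l * (1 / 9) := by
        have : l = 1 / a ^ 2 := by field_simp; exact hl
        rw [this]; field_simp; norm_num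
      rw [h3]
      have h4 : (2 : ℝ) ^ (γ * w) * L * γ * L * γ = 2 ^ (γ * w) * L ^ 2 * γ ^ 2 := by ring
      rw [h4, hγ2, mul_one]
      gcongr
      nlinarith)
  refine key.trans ?_
  rw [Real.sqrt_sq (by positivity)]
  have := inv_sin_le ha0 ha
  calc 8 * (1 / Real.sin (Real.pi * a)) / (1 / (3 * a)) ≤ 8 * (1 / (2 * a)) / (1 / (3 * a)) := by
        gcongr
    _ = 12 := by field_simp; norm_num

lemma abs_two_rpow_sub_le {γ w : ℝ} (hγ : γ = 1 ∨ γ = -1) (h0 : 0 ≤ w) (h1 : w ≤ 1 / 2) :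
    |(2 : ℝ) ^ (γ * w) - 1 - γ * (Real.log 2 * w)| ≤ w ^ 2 := by
  have hL0 : 0 < Real.log 2 := Real.log_pos (by norm_num)
  have hL1 : Real.log 2 ≤ 1 := by have := Real.log_two_lt_d9; linarith
  have hγ2 : |γ| = 1 := by rcases hγ with rfl | rfl <;> simp
  rw [Real.rpow_def_of_pos (by norm_num)]
  have h2 : |Real.log 2 * (γ * w)| ≤ w := by
    rw [abs_mul, abs_mul, hγ2, abs_of_pos hL0, abs_of_nonneg h0]; nlinarith
  have h := Real.abs_exp_sub_one_sub_id_le (h2.trans (by linarith))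
  have e : γ * (Real.log 2 * w) = Real.log 2 * (γ * w) := by ring
  rw [e]
  refine h.trans ?_
  rw [← sq_abs]
  gcongr

lemma abs_cos_sub_cos_le (x y : ℝ) : |Real.cos x - Real.cos y| ≤ |x - y| := by
  have h := Real.lipschitzWith_cos.dist_le_mul x y
  simpa [Real.dist_eq] using h

lemma abs_integral_cos_mul_dirKer_le_of_nonneg (N : ℕ) {l : ℝ} (hl : 0 ≤ l) (θ : ℝ) :
    |∫ w in (-(1 / 2) : ℝ)..1 / 2, Real.cos (l * 2 ^ w + θ) * dirKer N w| ≤ 30 := by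
  set L := Real.log 2 with hL
  have hpc : ∀ γ : ℝ, Continuous fun w : ℝ => (2 : ℝ) ^ (γ * w) := fun γ =>
    (Real.continuous_const_rpow (by norm_num : (2 : ℝ) ≠ 0)).comp (continuous_const_mul γ)
  have hDc := continuous_dirKer N
  have hcc : ∀ γ : ℝ, Continuous fun w : ℝ => Real.cos (l * 2 ^ (γ * w) + θ) := fun γ =>
    Real.continuous_cos.comp ((continuous_const.mul (hpc γ)).add continuous_const)
  set h : ℝ → ℝ := fun w => (Real.cos (l * 2 ^ (1 * w) + θ) + Real.cos (l * 2 ^ (-1 * w) + θ)) * dirKer N w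
    with hh
  have hhc : Continuous h := ((hcc 1).add (hcc (-1))).mul hDc
  have hi : ∀ γ a b : ℝ, IntervalIntegrable (fun w => Real.cos (l * 2 ^ (γ * w) + θ) * dirKer N w)
      volume a b := fun γ a b => ((hcc γ).mul hDc).intervalIntegrable _ _
  have e0 : ∫ w in (-(1 / 2) : ℝ)..1 / 2, Real.cos (l * 2 ^ w + θ) * dirKer N w
      = ∫ w in (0 : ℝ)..1 / 2, h w := by
    have e1 := intervalIntegral.integral_add_adjacent_intervals (hi 1 (-(1 / 2)) 0) (hi 1 0 (1 / 2))
    have e2 := intervalIntegral.integral_comp_neg (a := 0) (b := 1 / 2)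
      (fun w => Real.cos (l * 2 ^ (1 * w) + θ) * dirKer N w)
    have e3 := intervalIntegral.integral_add (hi 1 0 (1 / 2)) (hi (-1) 0 (1 / 2))
    simp only [← add_mul] at e3
    simp only [dirKer_neg, neg_zero, one_mul, neg_one_mul] at e1 e2 e3 hh
    rw [← e1, ← e2, hh, e3]; ring
  rw [e0]
  obtain ⟨a, ha0, ha, hla, hcase⟩ : ∃ a : ℝ, 0 < a ∧ a ≤ 1 / 2 ∧ l * a ^ 2 ≤ 1 ∧
      (a = 1 / 2 ∨ l * a ^ 2 = 1) := by
    rcases le_or_gt l 4 with h4 | h4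
    · exact ⟨1 / 2, by norm_num, le_rfl, by linarith, Or.inl rfl⟩
    · have hs : 0 < √l := Real.sqrt_pos.2 (by linarith)
      have e : l * (1 / √l) ^ 2 = 1 := by
        rw [div_pow, Real.sq_sqrt hl, one_pow, mul_one_div_cancel (by linarith)]
      refine ⟨1 / √l, by positivity, ?_, e.le, Or.inr e⟩
      rw [div_le_div_iff₀ hs (by norm_num)]
      have : (2 : ℝ) ≤ √l := Real.le_sqrt_of_sq_le (by linarith)
      linarith
  rw [← intervalIntegral.integral_add_adjacent_intervals (b := a) (hhc.intervalIntegrable _ _)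
    (hhc.intervalIntegrable _ _)]
  -- the part near `0`
  have p1 : |∫ w in (0 : ℝ)..a, h w| ≤ 5 := by
    set k : ℝ → ℝ := fun w => 2 * Real.cos (l + θ) * (Real.cos (l * L * w) * dirKer N w) with hk
    have hkc : Continuous k := by fun_prop
    have hdiff : |∫ w in (0 : ℝ)..a, (h w - k w)| ≤ 1 := by
      have hb : ∀ w ∈ uIoc 0 a, ‖h w - k w‖ ≤ l * a := by
        intro w hw
        rw [uIoc_of_le ha0.le] at hw
        have hw1 : w ≤ 1 / 2 := hw.2.trans ha
        have c1 : ∀ γ : ℝ, (γ = 1 ∨ γ = -1) → |Real.cos (l * 2 ^ (γ * w) + θ)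
            - Real.cos (l + θ + γ * (l * L * w))| ≤ l * w ^ 2 := by
          intro γ hγ
          refine (abs_cos_sub_cos_le _ _).trans ?_
          have := abs_two_rpow_sub_le hγ hw.1.le hw1
          have e : l * 2 ^ (γ * w) + θ - (l + θ + γ * (l * L * w))
              = l * (2 ^ (γ * w) - 1 - γ * (L * w)) := by ring
          rw [e, abs_mul, abs_of_nonneg hl]
          gcongr
        have c2 : h w - k w = ((Real.cos (l * 2 ^ (1 * w) + θ) - Real.cos (l + θ + 1 * (l * L * w)))
            + (Real.cos (l * 2 ^ (-1 * w) + θ) - Real.cos (l + θ + -1 * (l * L * w))))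
              * dirKer N w := by
          have : 2 * Real.cos (l + θ) * Real.cos (l * L * w)
              = Real.cos (l + θ + 1 * (l * L * w)) + Real.cos (l + θ + -1 * (l * L * w)) := by
            rw [one_mul, neg_one_mul, ← sub_eq_add_neg, Real.cos_add (l + θ), Real.cos_sub (l + θ)]; ring
          simp only [hh, hk]
          rw [← mul_assoc, this]; ring
        have c3 := abs_dirKer_mul_le N (w := w) (by rw [abs_of_pos hw.1]; exact hw1)
        rw [abs_of_pos hw.1] at c3
        rw [c2, Real.norm_eq_abs, abs_mul]
        calc _ ≤ (l * w ^ 2 + l * w ^ 2) * |dirKer N w| := by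
              gcongr
              exact (abs_add_le _ _).trans (add_le_add (c1 1 (Or.inl rfl)) (c1 (-1) (Or.inr rfl)))
          _ = l * w * (|dirKer N w| * (2 * w)) := by ring
          _ ≤ l * w * 1 := by
              have := hw.1
              gcongr
          _ ≤ l * a := by rw [mul_one]; gcongr; exact hw.2
      have := intervalIntegral.norm_integral_le_of_norm_le_const hb
      rw [sub_zero, abs_of_pos ha0, Real.norm_eq_abs] at this
      nlinarith
    have hki : |∫ w in (0 : ℝ)..a, k w| ≤ 4 := by
      have hJ : ∫ w in (0 : ℝ)..a, Real.cos (l * L * w) * dirKer N w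
          = (1 / 2) * (∫ w in (0 : ℝ)..a, Real.sin (((2 * N + 1) * Real.pi + l * L) * w)
              * (1 / Real.sin (Real.pi * w)))
            + (1 / 2) * (∫ w in (0 : ℝ)..a, Real.sin (((2 * N + 1) * Real.pi - l * L) * w)
              * (1 / Real.sin (Real.pi * w))) := by
        rw [← mul_add, ← intervalIntegral.integral_add (intervalIntegrable_sin_div_sin _ ha0.le ha)
          (intervalIntegrable_sin_div_sin _ ha0.le ha), ← intervalIntegral.integral_const_mul]
        refine intervalIntegral.integral_congr_Ioo_of_le ha0.le fun w hw => ?_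
        rw [dirKer_eq_div hw.1 (hw.2.le.trans ha), add_mul _ (l * L), sub_mul _ (l * L),
          Real.sin_add, Real.sin_sub]
        ring
      have j1 := abs_integral_sin_div_sin_le ((2 * N + 1) * Real.pi + l * L) ha0 ha
      have j2 := abs_integral_sin_div_sin_le ((2 * N + 1) * Real.pi - l * L) ha0 ha
      have j3 : |∫ w in (0 : ℝ)..a, Real.cos (l * L * w) * dirKer N w| ≤ 2 := by
        rw [hJ]; rw [abs_le] at *; constructor <;> linarith [j1.1, j1.2, j2.1, j2.2]
      rw [hk, intervalIntegral.integral_const_mul, abs_mul, abs_mul, abs_two]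
      calc 2 * |Real.cos (l + θ)| * |∫ w in (0 : ℝ)..a, Real.cos (l * L * w) * dirKer N w|
          ≤ 2 * 1 * 2 := by gcongr; exact Real.abs_cos_le_one _
        _ = 4 := by norm_num
    rw [intervalIntegral.integral_sub (hhc.intervalIntegrable _ _) (hkc.intervalIntegrable _ _)] at hdiff
    rw [abs_le] at *
    constructor <;> linarith [hdiff.1, hdiff.2, hki.1, hki.2]
  -- the part away from `0`
  have p2 : |∫ w in a..1 / 2, h w| ≤ 24 := by
    rcases hcase with rfl | hla1
    · simp
    set c : ℝ := (2 * N + 1) * Real.pi with hc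
    have hgc : ∀ γ β θ' : ℝ, IntervalIntegrable (fun w => 1 / Real.sin (Real.pi * w)
        * Real.cos (l * 2 ^ (γ * w) + β * w + θ')) volume a (1 / 2) := by
      intro γ β θ'
      apply ContinuousOn.intervalIntegrable
      rw [uIcc_of_le ha]
      refine ContinuousOn.mul (fun w hw => (hasDerivAt_inv_sin (ha0.trans_le hw.1)
        hw.2).continuousAt.continuousWithinAt) ?_
      exact (Real.continuous_cos.comp (((continuous_const.mul (hpc γ)).add
        (continuous_const_mul β)).add continuous_const)).continuousOn
    have hsplit : ∫ w in a..1 / 2, h w = (1 / 2) * (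
        (∫ w in a..1 / 2, 1 / Real.sin (Real.pi * w) * Real.cos (l * 2 ^ (1 * w) + c * w + (θ - Real.pi / 2)))
        - (∫ w in a..1 / 2, 1 / Real.sin (Real.pi * w) * Real.cos (l * 2 ^ (1 * w) + -c * w + (θ - Real.pi / 2)))
        + ((∫ w in a..1 / 2, 1 / Real.sin (Real.pi * w) * Real.cos (l * 2 ^ (-1 * w) + c * w + (θ - Real.pi / 2)))
        - (∫ w in a..1 / 2, 1 / Real.sin (Real.pi * w) * Real.cos (l * 2 ^ (-1 * w) + -c * w + (θ - Real.pi / 2))))) := by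
      rw [← intervalIntegral.integral_sub (hgc _ _ _) (hgc _ _ _),
        ← intervalIntegral.integral_sub (hgc _ _ _) (hgc _ _ _),
        ← intervalIntegral.integral_add ((hgc _ _ _).sub (hgc _ _ _)) ((hgc _ _ _).sub (hgc _ _ _)),
        ← intervalIntegral.integral_const_mul]
      refine intervalIntegral.integral_congr_Ioo_of_le ha fun w hw => ?_
      have e1 : ∀ y, 2 * (Real.cos (y + θ) * Real.sin (c * w))
          = Real.cos (y + c * w + (θ - Real.pi / 2)) - Real.cos (y + -c * w + (θ - Real.pi / 2)) := by
        intro y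
        have a1 : y + c * w + (θ - Real.pi / 2) = (y + θ) + c * w - Real.pi / 2 := by ring
        have a2 : y + -c * w + (θ - Real.pi / 2) = (y + θ) - c * w - Real.pi / 2 := by ring
        rw [a1, a2, Real.cos_sub_pi_div_two, Real.cos_sub_pi_div_two, Real.sin_add, Real.sin_sub]
        ring
      have e2 := e1 (l * 2 ^ (1 * w))
      have e3 := e1 (l * 2 ^ (-1 * w))
      simp only [hh]
      rw [dirKer_eq_div (ha0.trans hw.1) hw.2.le, ← mul_sub, ← mul_sub, ← e2, ← e3]
      ring
    have v1 := abs_integral_cos_two_rpow_div_sin_le (Or.inl rfl) ha0 ha hla1 c (θ - Real.pi / 2)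
    have v2 := abs_integral_cos_two_rpow_div_sin_le (Or.inl rfl) ha0 ha hla1 (-c) (θ - Real.pi / 2)
    have v3 := abs_integral_cos_two_rpow_div_sin_le (Or.inr rfl) ha0 ha hla1 c (θ - Real.pi / 2)
    have v4 := abs_integral_cos_two_rpow_div_sin_le (Or.inr rfl) ha0 ha hla1 (-c) (θ - Real.pi / 2)
    rw [hsplit]
    rw [abs_le] at *
    constructor <;> linarith [v1.1, v1.2, v2.1, v2.2, v3.1, v3.2, v4.1, v4.2]
  exact (abs_add_le _ _).trans (by linarith)

/-- Uniform bound for a chirp against the Dirichlet kernel. -/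
lemma abs_integral_cos_mul_dirKer_le (N : ℕ) (l θ : ℝ) :
    |∫ w in (-(1 / 2) : ℝ)..1 / 2, Real.cos (l * 2 ^ w + θ) * dirKer N w| ≤ 30 := by
  rcases le_total 0 l with hl | hl
  · exact abs_integral_cos_mul_dirKer_le_of_nonneg N hl θ
  · have h := abs_integral_cos_mul_dirKer_le_of_nonneg N (neg_nonneg.2 hl) (-θ)
    have e : ∀ w : ℝ, Real.cos (-l * 2 ^ w + -θ) = Real.cos (l * 2 ^ w + θ) := fun w => by
      rw [← Real.cos_neg]; congr 1; ring
    simpa only [e] using h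

lemma exists_trig_approx {g : ℝ → ℝ} (hg : Continuous g) (hper : Function.Periodic g 2) {δ : ℝ}
    (hδ : 0 < δ) : ∃ (s : Finset ℤ) (A θ : ℤ → ℝ),
      ∀ u, |g u - ∑ k ∈ s, A k * Real.cos (Real.pi * k * u + θ k)| ≤ δ := by
  have : Fact (0 < (2 : ℝ)) := ⟨by norm_num⟩
  have hperC : Function.Periodic (fun u => (g u : ℂ)) 2 := fun u => by simp [hper u]
  have hlift : Continuous hperC.lift :=
    continuous_coinduced_dom.2 (Complex.continuous_ofReal.comp hg)
  set f : C(AddCircle (2 : ℝ), ℂ) := ⟨hperC.lift, hlift⟩ with hf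
  have hmem : f ∈ (Submodule.span ℂ (Set.range (@fourier 2))).topologicalClosure := by
    rw [span_fourier_closure_eq_top]; trivial
  rw [← SetLike.mem_coe, Submodule.topologicalClosure_coe, Metric.mem_closure_iff] at hmem
  obtain ⟨P, hP, hd⟩ := hmem δ hδ
  obtain ⟨c, rfl⟩ := (Finsupp.mem_span_range_iff_exists_finsupp).1 hP
  refine ⟨c.support, fun k => ‖c k‖, fun k => Complex.arg (c k), fun u => ?_⟩
  set P : C(AddCircle (2 : ℝ), ℂ) := c.sum fun i a => a • fourier i with hPdef
  have h1 : ‖(f - P) (u : AddCircle (2 : ℝ))‖ ≤ δ := by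
    rw [dist_eq_norm] at hd
    exact (ContinuousMap.norm_coe_le_norm (f - P) _).trans hd.le
  have h2 : (f - P) (u : AddCircle (2 : ℝ)) = (g u : ℂ) - ∑ k ∈ c.support, c k * Complex.exp (2 * Real.pi * Complex.I * k * u / (2 : ℝ)) := by
    rw [ContinuousMap.sub_apply, hPdef, Finsupp.sum, ContinuousMap.coe_sum, Finset.sum_apply]
    congr 1
    refine Finset.sum_congr rfl fun k _ => ?_
    rw [ContinuousMap.smul_apply, fourier_coe_apply, smul_eq_mul]
  rw [h2] at h1
  refine le_trans ?_ ((Complex.abs_re_le_norm _).trans h1)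
  rw [Complex.sub_re, Complex.ofReal_re, Complex.re_sum]
  apply le_of_eq
  congr 2
  refine Finset.sum_congr rfl fun k _ => ?_
  conv_rhs => rw [← Complex.norm_mul_exp_arg_mul_I (c k)]
  rw [mul_assoc (‖c k‖ : ℂ), ← Complex.exp_add]
  have : (Complex.arg (c k) : ℂ) * Complex.I + 2 * Real.pi * Complex.I * k * u / (2 : ℝ)
      = ((Real.pi * k * u + Complex.arg (c k) : ℝ) : ℂ) * Complex.I := by push_cast; ring
  rw [this, Complex.re_ofReal_mul, Complex.exp_ofReal_mul_I_re]

/-- The running average of the square wave over `[u, u + δ]`. -/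
noncomputable def sqWaveAvg (δ u : ℝ) : ℝ := (sqWavePrim (u + δ) - sqWavePrim u) / δ

lemma continuous_sqWaveAvg (δ : ℝ) : Continuous (sqWaveAvg δ) :=
  ((continuous_sqWavePrim.comp (continuous_add_const δ)).sub continuous_sqWavePrim).div_const δ

lemma sqWaveAvg_periodic (δ : ℝ) : Function.Periodic (sqWaveAvg δ) 2 := by
  intro u
  unfold sqWaveAvg
  rw [add_right_comm, sqWavePrim_periodic, sqWavePrim_periodic]

lemma sqWaveAvg_eq_integral (δ u : ℝ) : sqWaveAvg δ u = (∫ t in u..u + δ, sqWave t) / δ := by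
  unfold sqWaveAvg sqWavePrim
  rw [intervalIntegral.integral_interval_sub_left (sqWave_intervalIntegrable _ _)
    (sqWave_intervalIntegrable _ _)]

lemma abs_sqWaveAvg_le {δ : ℝ} (hδ : 0 < δ) (u : ℝ) : |sqWaveAvg δ u| ≤ 1 / 2 := by
  rw [sqWaveAvg_eq_integral, abs_div, abs_of_pos hδ, div_le_iff₀ hδ]
  have := intervalIntegral.norm_integral_le_of_norm_le_const (a := u) (b := u + δ) (f := sqWave)
    (C := 1 / 2) fun t _ => by rw [Real.norm_eq_abs, abs_sqWave]
  rwa [add_sub_cancel_left, abs_of_pos hδ] at this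

lemma sqWaveAvg_eq {δ u : ℝ} (hδ : 0 < δ) {n : ℤ} (h0 : n ≤ u) (h1 : u + δ ≤ n + 1) :
    sqWaveAvg δ u = sqWave u := by
  have hfl : ⌊u⌋ = n := Int.floor_eq_iff.2 ⟨h0, by linarith⟩
  rw [sqWaveAvg_eq_integral, intervalIntegral.integral_congr_Ioo_of_le (g := fun _ => sqWave u)
    (by linarith) fun t ht => ?_, intervalIntegral.integral_const, add_sub_cancel_left, smul_eq_mul,
    mul_div_cancel_left₀ _ hδ.ne']
  have : ⌊t⌋ = n := Int.floor_eq_iff.2 ⟨h0.trans ht.1.le, ht.2.trans_le h1⟩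
  simp [sqWave, hfl, this]

lemma abs_sub_sqWaveAvg_le {δ : ℝ} (hδ : 0 < δ) (u : ℝ) : |sqWave u - sqWaveAvg δ u| ≤ 1 := by
  refine (abs_sub _ _).trans ?_
  rw [abs_sqWave]; linarith [abs_sqWaveAvg_le hδ u]

lemma intervalIntegrable_abs_sub_sqWaveAvg (δ a b : ℝ) :
    IntervalIntegrable (fun u => |sqWave u - sqWaveAvg δ u|) volume a b :=
  ((sqWave_intervalIntegrable a b).sub ((continuous_sqWaveAvg δ).intervalIntegrable _ _)).abs

lemma integral_abs_sub_sqWaveAvg_le {δ : ℝ} (hδ : 0 < δ) (hδ1 : δ ≤ 1) (n : ℤ) :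
    ∫ u in (n : ℝ)..n + 1, |sqWave u - sqWaveAvg δ u| ≤ δ := by
  rw [← intervalIntegral.integral_add_adjacent_intervals (b := (n : ℝ) + 1 - δ)
    (intervalIntegrable_abs_sub_sqWaveAvg _ _ _) (intervalIntegrable_abs_sub_sqWaveAvg _ _ _)]
  have h1 : ∫ u in (n : ℝ)..n + 1 - δ, |sqWave u - sqWaveAvg δ u|
      = ∫ u in (n : ℝ)..n + 1 - δ, (0 : ℝ) :=
    intervalIntegral.integral_congr_Ioo_of_le (by linarith) fun u hu => by
      rw [sqWaveAvg_eq hδ hu.1.le (by linarith [hu.2]), sub_self, abs_zero]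
  have h2 := intervalIntegral.norm_integral_le_of_norm_le_const (a := (n : ℝ) + 1 - δ) (b := n + 1)
    (f := fun u => |sqWave u - sqWaveAvg δ u|) (C := 1) fun t _ => by
      rw [Real.norm_eq_abs, abs_abs]; exact abs_sub_sqWaveAvg_le hδ t
  rw [Real.norm_eq_abs, sub_sub_cancel, abs_of_pos hδ, one_mul] at h2
  rw [h1, intervalIntegral.integral_zero, zero_add]
  exact (le_abs_self _).trans h2

/-- A bounded primitive of a bounded `2`-periodic function with its mean removed. -/
lemma exists_bounded_primitive {h : ℝ → ℝ} {K : ℝ} (hm : Measurable h) (hK : ∀ u, |h u| ≤ K)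
    (hper : Function.Periodic h 2) (hc : ∀ u : ℝ, (∀ n : ℤ, u ≠ n) → ContinuousAt h u) :
    ∃ Φ : ℝ → ℝ, Continuous Φ ∧ (∀ u, |Φ u| ≤ 4 * K) ∧
      ∀ u : ℝ, (∀ n : ℤ, u ≠ n) → HasDerivAt Φ (h u - (∫ t in (0 : ℝ)..2, h t) / 2) u := by
  have hi : ∀ a b, IntervalIntegrable h volume a b := fun a b =>
    (intervalIntegrable_const (c := K)).mono_fun' hm.aestronglyMeasurable
      (Eventually.of_forall fun u => hK u)
  set m := (∫ t in (0 : ℝ)..2, h t) / 2 with hmdef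
  have hmK : |m| ≤ K := by
    have := intervalIntegral.norm_integral_le_of_norm_le_const (a := (0 : ℝ)) (b := 2) (f := h)
      (C := K) fun t _ => hK t
    rw [Real.norm_eq_abs, sub_zero, abs_two] at this
    rw [hmdef, abs_div, abs_two, div_le_iff₀ (by norm_num)]
    exact this
  have hi' : ∀ a b, IntervalIntegrable (fun u => h u - m) volume a b := fun a b =>
    (hi a b).sub intervalIntegrable_const
  have hper' : Function.Periodic (fun u => ∫ t in (0 : ℝ)..u, (h t - m)) 2 := by
    intro u
    beta_reduce
    rw [← intervalIntegral.integral_add_adjacent_intervals (hi' 0 u) (hi' u (u + 2))]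
    have h1 : Function.Periodic (fun u => h u - m) 2 := fun u => by simp [hper u]
    have h2 : ∫ t in (0 : ℝ)..2, h t = 2 * m := by rw [hmdef]; ring
    have h3 : ∫ t in (0 : ℝ)..2, (h t - m) = 0 := by
      rw [intervalIntegral.integral_sub (hi _ _) intervalIntegrable_const,
        intervalIntegral.integral_const, h2, smul_eq_mul]
      ring
    rw [h1.intervalIntegral_add_eq u 0, zero_add, h3, add_zero]
  refine ⟨fun u => ∫ t in (0 : ℝ)..u, (h t - m), intervalIntegral.continuous_primitive hi' 0,
    fun u => ?_, fun u hu => ?_⟩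
  · obtain ⟨v, hv, hvu⟩ := hper'.exists_mem_Ico₀ (by norm_num) u
    beta_reduce at hvu ⊢
    rw [hvu]
    have := intervalIntegral.norm_integral_le_of_norm_le_const (a := (0 : ℝ)) (b := v)
      (f := fun u => h u - m) (C := 2 * K) fun t _ => by
        rw [Real.norm_eq_abs]; exact (abs_sub _ _).trans (by linarith [hK t])
    rw [Real.norm_eq_abs, sub_zero, abs_of_nonneg hv.1] at this
    have hK0 : 0 ≤ K := (abs_nonneg _).trans hmK
    nlinarith [hv.2, hv.1]
  · exact intervalIntegral.integral_hasDerivAt_right (hi' 0 u)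
      ((hm.sub_const m).stronglyMeasurable.stronglyMeasurableAtFilter) ((hc u hu).sub_const m)

lemma integral_inv_two_mul_sq {a b : ℝ} (ha : 0 < a) (hab : a ≤ b) :
    ∫ w in a..b, 1 / (2 * w ^ 2) = 1 / (2 * a) - 1 / (2 * b) := by
  have hd : ∀ w ∈ uIcc a b, HasDerivAt (fun w : ℝ => -(1 / (2 * w))) (1 / (2 * w ^ 2)) w := by
    intro w hw
    rw [uIcc_of_le hab] at hw
    have hw0 : w ≠ 0 := (ha.trans_le hw.1).ne'
    have := (((hasDerivAt_id w).const_mul 2).inv (by simpa using hw0)).neg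
    simp only [id] at this
    refine (this.congr_of_eventuallyEq (Eventually.of_forall fun x => ?_)).congr_deriv ?_
    · simp
    · field_simp
  rw [intervalIntegral.integral_eq_sub_of_hasDerivAt hd]
  · ring
  · apply ContinuousOn.intervalIntegrable
    rw [uIcc_of_le hab]
    refine ContinuousOn.div continuousOn_const (by fun_prop) fun w hw => ?_
    have := ha.trans_le hw.1
    positivity

lemma integral_inv_two_mul_bound {X : ℝ} (hX : 2 ≤ X) :
    |1 / (2 * (1 / X))| + |1 / (2 * (1 / 2 : ℝ))|
      + ∫ w in 1 / X..1 / 2, (|1 / (2 * w)| + |-(1 / (2 * w ^ 2))|) ≤ 2 * X := by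
  have hX0 : 0 < X := by linarith
  have hle : 1 / X ≤ 1 / 2 := one_div_le_one_div_of_le (by norm_num) hX
  have hc2 : IntervalIntegrable (fun w : ℝ => 1 / (2 * w ^ 2)) volume (1 / X) (1 / 2) := by
    apply ContinuousOn.intervalIntegrable
    rw [uIcc_of_le hle]
    refine ContinuousOn.div continuousOn_const (by fun_prop) fun w hw => ?_
    have : 0 < w := lt_of_lt_of_le (by positivity) hw.1
    positivity
  have h1 : ∫ w in 1 / X..1 / 2, (|1 / (2 * w)| + |-(1 / (2 * w ^ 2))|)
      ≤ ∫ w in 1 / X..1 / 2, (X / 2 + 1 / (2 * w ^ 2)) := by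
    refine intervalIntegral.integral_mono_on hle ?_ (intervalIntegrable_const.add hc2) fun w hw => ?_
    · apply ContinuousOn.intervalIntegrable
      rw [uIcc_of_le hle]
      have : ∀ w ∈ Icc (1 / X) (1 / 2), w ≠ 0 := fun w hw =>
        (lt_of_lt_of_le (by positivity) hw.1).ne'
      refine ContinuousOn.add ?_ ?_
      · exact (ContinuousOn.div continuousOn_const (by fun_prop) fun w hw => by
          simpa using this w hw).abs
      · exact (ContinuousOn.div continuousOn_const (by fun_prop) fun w hw => by
          simpa using this w hw).neg.abs
    · have hw0 : 0 < w := lt_of_lt_of_le (by positivity) hw.1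
      have h2 : 1 / (2 * w) ≤ X / 2 := by
        have := (div_le_iff₀ hX0).1 hw.1
        rw [div_le_div_iff₀ (by positivity) (by positivity)]; nlinarith
      rw [abs_neg, abs_of_pos (by positivity), abs_of_pos (by positivity)]
      linarith
  rw [intervalIntegral.integral_add intervalIntegrable_const hc2, integral_inv_two_mul_sq
    (by positivity) hle, intervalIntegral.integral_const, smul_eq_mul] at h1
  have e1 : 1 / (2 * (1 / X)) = X / 2 := by field_simp
  have e2 : (1 / 2 - 1 / X) * (X / 2) = X / 4 - 1 / 2 := by field_simp; ring
  rw [e1, e2] at h1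
  rw [e1, abs_of_pos (by positivity), abs_of_pos (by norm_num)]
  linarith

lemma integral_comp_mul_inv_le {h Φ : ℝ → ℝ} {m B K X : ℝ} (hhm : Measurable h)
    (hK : ∀ u, |h u| ≤ K) (hΦc : Continuous Φ)
    (hB : ∀ u, |Φ u| ≤ B) (hΦ : ∀ u : ℝ, (∀ n : ℤ, u ≠ n) → HasDerivAt Φ (h u - m) u)
    (hX : 2 ≤ X) :
    ∫ w in 1 / X..1 / 2, h (X * 2 ^ w) * (1 / (2 * w)) ≤ m / 2 * Real.log (X / 2) + 8 * B ∧
    ∫ w in 1 / X..1 / 2, h (X * 2 ^ (-w)) * (1 / (2 * w)) ≤ m / 2 * Real.log (X / 2) + 8 * B := by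
  have hX0 : 0 < X := by linarith
  have hB0 : 0 ≤ B := (abs_nonneg _).trans (hB 0)
  have hle : 1 / X ≤ 1 / 2 := one_div_le_one_div_of_le (by norm_num) hX
  have hXpos : 0 < 1 / X := by positivity
  have hcont : ∀ s : Set ℝ, (∀ w ∈ s, w ≠ 0) → ContinuousOn (fun w : ℝ => 1 / (2 * w)) s :=
    fun s hs => ContinuousOn.div continuousOn_const (by fun_prop) fun w hw => by
      simpa using hs w hw
  have hinv : IntervalIntegrable (fun w : ℝ => 1 / (2 * w)) volume (1 / X) (1 / 2) := by
    apply ContinuousOn.intervalIntegrable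
    rw [uIcc_of_le hle]
    exact hcont _ fun w hw => (hXpos.trans_le hw.1).ne'
  have hd : ∀ w : ℝ, w ≠ 0 → HasDerivAt (fun w : ℝ => 1 / (2 * w)) (-(1 / (2 * w ^ 2))) w := by
    intro w hw0
    have := (((hasDerivAt_id w).const_mul 2).inv (by simpa using hw0))
    simp only [id] at this
    refine (this.congr_of_eventuallyEq (Eventually.of_forall fun x => ?_)).congr_deriv ?_
    · simp
    · field_simp
  have hd2 : ∀ s : Set ℝ, (∀ w ∈ s, w ≠ 0) → ContinuousOn (fun w : ℝ => -(1 / (2 * w ^ 2))) s :=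
    fun s hs => (ContinuousOn.div continuousOn_const (by fun_prop) fun w hw => by
      simpa using hs w hw).neg
  have hlog : ∫ w in 1 / X..1 / 2, m * (1 / (2 * w)) = m / 2 * Real.log (X / 2) := by
    have : ∀ w : ℝ, m * (1 / (2 * w)) = m / 2 * (1 / w) := fun w => by ring
    simp_rw [this]
    rw [intervalIntegral.integral_const_mul, integral_one_div_of_pos hXpos (by norm_num)]
    congr 2; field_simp
  have hhi : ∀ c : ℝ, IntervalIntegrable (fun w => h (X * 2 ^ (c * w)) * (1 / (2 * w))) volume
      (1 / X) (1 / 2) := by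
    intro c
    rw [intervalIntegrable_iff] at hinv ⊢
    refine hinv.bdd_mul (c := K) ?_ (Eventually.of_forall fun w => hK _)
    exact (hhm.comp (by fun_prop)).aestronglyMeasurable
  have hmi : IntervalIntegrable (fun w : ℝ => m * (1 / (2 * w))) volume (1 / X) (1 / 2) :=
    hinv.const_mul m
  have hfin : 4 * B / X * (2 * X) = 8 * B := by field_simp; ring
  have hbd := mul_le_mul_of_nonneg_left (integral_inv_two_mul_bound hX)
    (by positivity : 0 ≤ 4 * B / X)
  rw [hfin] at hbd
  have hφb : ∀ u, |h u - m| ≤ K + |m| := fun u => (abs_sub _ _).trans (by linarith [hK u])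
  constructor
  · have k1 := (abs_integral_comp_mul_two_rpow_le hΦc hB hΦ (hhm.sub_const m) hφb hX0 hle
      (by linarith) (fun w hw => hd w (hXpos.trans_le hw.1).ne')
      (hd2 _ fun w hw => (hXpos.trans_le hw.1).ne')).trans hbd
    have e := hhi 1
    simp only [one_mul] at e
    simp only [sub_mul] at k1
    rw [intervalIntegral.integral_sub e hmi, hlog] at k1
    linarith [le_abs_self ((∫ w in 1 / X..1 / 2, h (X * 2 ^ w) * (1 / (2 * w)))
      - m / 2 * Real.log (X / 2))]
  · have k1 := abs_integral_comp_mul_two_rpow_le (G := fun w => 1 / (2 * w)) hΦc hB hΦ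
      (hhm.sub_const m) hφb hX0
      (neg_le_neg hle) le_rfl (fun w hw => hd w (by have := hw.2; linarith : w < 0).ne)
      (hd2 _ fun w hw => (by have := hw.2; linarith : w < 0).ne)
    have e1 := intervalIntegral.integral_comp_neg (a := 1 / X) (b := 1 / 2)
      (fun w : ℝ => (h (X * 2 ^ w) - m) * (1 / (2 * w)))
    have e2 := intervalIntegral.integral_comp_neg (a := 1 / X) (b := 1 / 2)
      (fun w : ℝ => |1 / (2 * w)| + |-(1 / (2 * w ^ 2))|)
    rw [← e1, ← e2] at k1
    have n1 : ∀ w : ℝ, 1 / (2 * -w) = -(1 / (2 * w)) := fun w => by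
      rw [mul_neg, one_div, one_div, inv_neg]
    simp only [n1, abs_neg, neg_sq] at k1
    simp only [abs_neg] at hbd
    rw [add_comm |1 / (2 * (1 / 2 : ℝ))|] at k1
    have k2 := k1.trans hbd
    have e := hhi (-1)
    simp only [neg_one_mul] at e
    simp only [mul_neg, sub_mul] at k2
    rw [intervalIntegral.integral_neg, abs_neg, intervalIntegral.integral_sub e hmi, hlog] at k2
    linarith [le_abs_self ((∫ w in 1 / X..1 / 2, h (X * 2 ^ (-w)) * (1 / (2 * w)))
      - m / 2 * Real.log (X / 2))]

/-- Near the truncation point, the truncated Fourier sum is `o(log X)`. -/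
lemma exists_abs_sqWaveSum_le {δ : ℝ} (hδ : 0 < δ) (hδ1 : δ ≤ 1) :
    ∃ K : ℝ, 0 ≤ K ∧ ∀ (N : ℕ) (X : ℝ), 2 ≤ X →
      |sqWaveSum N X| ≤ K + 4 * (2 * N + 1) / X + 2 * δ * Real.log X := by
  obtain ⟨s, A, θ, hP⟩ := exists_trig_approx (continuous_sqWaveAvg δ) (sqWaveAvg_periodic δ) hδ
  set P : ℝ → ℝ := fun u => ∑ k ∈ s, A k * Real.cos (Real.pi * k * u + θ k) with hPdef
  set h : ℝ → ℝ := fun u => |sqWave u - sqWaveAvg δ u| + δ with hh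
  have hPc : Continuous P := by rw [hPdef]; fun_prop
  have hhm : Measurable h :=
    ((measurable_sqWave.sub (continuous_sqWaveAvg δ).measurable).abs).add_const δ
  have hh0 : ∀ u, 0 ≤ h u := fun u => by positivity
  have hhK : ∀ u, |h u| ≤ 2 := fun u => by
    rw [abs_of_nonneg (hh0 u)]; linarith [abs_sub_sqWaveAvg_le hδ u]
  have hper : Function.Periodic h 2 := fun u => by
    simp only [hh]; rw [sqWave_periodic u, sqWaveAvg_periodic δ u]
  have hrP : ∀ u, |sqWave u - P u| ≤ h u := fun u => by
    have := hP u
    calc |sqWave u - P u| ≤ |sqWave u - sqWaveAvg δ u| + |sqWaveAvg δ u - P u| := abs_sub_le _ _ _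
      _ ≤ h u := by simp only [hh]; linarith
  obtain ⟨Φ, hΦc, hB, hΦ⟩ := exists_bounded_primitive hhm hhK hper fun u hu => by
    have : ContinuousAt sqWave u := continuousAt_const.congr (sqWave_eventuallyEq hu).symm
    exact ((this.sub (continuous_sqWaveAvg δ).continuousAt).abs).add continuousAt_const
  set m := (∫ t in (0 : ℝ)..2, h t) / 2 with hm
  have hm0 : 0 ≤ m := div_nonneg (intervalIntegral.integral_nonneg (by norm_num) fun u _ => hh0 u)
    (by norm_num)
  have hmδ : m ≤ 2 * δ := by
    have ia := intervalIntegrable_abs_sub_sqWaveAvg δ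
    have e1 := integral_abs_sub_sqWaveAvg_le hδ hδ1 0
    have e2 := integral_abs_sub_sqWaveAvg_le hδ hδ1 1
    have e3 := intervalIntegral.integral_add_adjacent_intervals (ia 0 1) (ia 1 2)
    norm_num at e1 e2
    have e4 : ∫ t in (0 : ℝ)..2, h t = (∫ t in (0 : ℝ)..2, |sqWave t - sqWaveAvg δ t|) + 2 * δ := by
      simp only [hh]
      rw [intervalIntegral.integral_add (ia _ _) intervalIntegrable_const,
        intervalIntegral.integral_const, sub_zero, smul_eq_mul]
    rw [hm, e4]; linarith
  refine ⟨30 * ∑ k ∈ s, |A k| + 128, by positivity, fun N X hX => ?_⟩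
  have hX0 : 0 < X := by linarith
  have hle : 1 / X ≤ 1 / 2 := one_div_le_one_div_of_le (by norm_num) hX
  have hXpos : 0 < 1 / X := by positivity
  have hcX : Continuous fun w : ℝ => X * 2 ^ w :=
    continuous_const.mul (Real.continuous_const_rpow (by norm_num : (2 : ℝ) ≠ 0))
  have hD := continuous_dirKer N
  have iP : IntervalIntegrable (fun w => P (X * 2 ^ w) * dirKer N w) volume (-(1 / 2)) (1 / 2) :=
    ((hPc.comp hcX).mul hD).intervalIntegrable _ _
  have ir : IntervalIntegrable (fun w => sqWave (X * 2 ^ w) * dirKer N w) volume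
      (-(1 / 2)) (1 / 2) := by
    have := dirKer_intervalIntegrable N (-(1 / 2)) (1 / 2)
    rw [intervalIntegrable_iff] at this ⊢
    exact this.bdd_mul (c := 1 / 2) (measurable_sqWave.comp hcX.measurable).aestronglyMeasurable
      (Eventually.of_forall fun w => (abs_sqWave _).le)
  have iJ : ∀ a b, IntervalIntegrable (fun w => h (X * 2 ^ w) * |dirKer N w|) volume a b := by
    intro a b
    have := hD.abs.intervalIntegrable (μ := volume) a b
    rw [intervalIntegrable_iff] at this ⊢
    exact this.bdd_mul (c := 2) (hhm.comp hcX.measurable).aestronglyMeasurable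
      (Eventually.of_forall fun w => hhK _)
  have p1 : |∫ w in (-(1 / 2) : ℝ)..1 / 2, P (X * 2 ^ w) * dirKer N w| ≤ 30 * ∑ k ∈ s, |A k| := by
    have e : ∀ w : ℝ, P (X * 2 ^ w) * dirKer N w
        = ∑ k ∈ s, A k * (Real.cos (Real.pi * k * X * 2 ^ w + θ k) * dirKer N w) := fun w => by
      simp only [hPdef]
      rw [Finset.sum_mul]
      exact Finset.sum_congr rfl fun k _ => by rw [mul_assoc (Real.pi * k)]; ring
    simp_rw [e]
    rw [intervalIntegral.integral_finsetSum fun k _ => Continuous.intervalIntegrable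
      (by fun_prop (disch := norm_num)) _ _]
    refine (Finset.abs_sum_le_sum_abs _ _).trans ?_
    rw [Finset.mul_sum]
    refine Finset.sum_le_sum fun k _ => ?_
    rw [intervalIntegral.integral_const_mul, abs_mul, mul_comm]
    exact mul_le_mul_of_nonneg_right (abs_integral_cos_mul_dirKer_le N _ _) (abs_nonneg _)
  have p2 : |∫ w in (-(1 / 2) : ℝ)..1 / 2, (sqWave (X * 2 ^ w) - P (X * 2 ^ w)) * dirKer N w|
      ≤ ∫ w in (-(1 / 2) : ℝ)..1 / 2, h (X * 2 ^ w) * |dirKer N w| := by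
    have h12 : (-(1 / 2) : ℝ) ≤ 1 / 2 := by norm_num
    rw [← Real.norm_eq_abs]
    refine intervalIntegral.norm_integral_le_of_norm_le h12
      (Eventually.of_forall fun w _ => ?_) (iJ _ _)
    rw [Real.norm_eq_abs, abs_mul]
    exact mul_le_mul_of_nonneg_right (hrP _) (abs_nonneg _)
  have hker : ∀ w ∈ Icc (1 / X) (1 / 2), |dirKer N w| ≤ 1 / (2 * w) := fun w hw => by
    have hw0 : 0 < w := hXpos.trans_le hw.1
    have := abs_dirKer_mul_le N (w := w) (by rw [abs_of_pos hw0]; exact hw.2)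
    rw [abs_of_pos hw0] at this
    rwa [le_div_iff₀ (by positivity)]
  have hinv : ∀ c : ℝ, IntervalIntegrable (fun w => h (X * 2 ^ (c * w)) * (1 / (2 * w))) volume
      (1 / X) (1 / 2) := by
    intro c
    have : IntervalIntegrable (fun w : ℝ => 1 / (2 * w)) volume (1 / X) (1 / 2) := by
      apply ContinuousOn.intervalIntegrable
      rw [uIcc_of_le hle]
      exact ContinuousOn.div continuousOn_const (by fun_prop) fun w hw => by
        simpa using (hXpos.trans_le hw.1).ne'
    rw [intervalIntegrable_iff] at this ⊢
    refine this.bdd_mul (c := 2) ?_ (Eventually.of_forall fun w => hhK _)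
    exact (hhm.comp (by fun_prop)).aestronglyMeasurable
  have i1 := hinv 1
  have i2 := hinv (-1)
  simp only [one_mul, neg_one_mul] at i1 i2
  obtain ⟨m1, m2⟩ := integral_comp_mul_inv_le hhm hhK hΦc hB hΦ hX
  have q1 : ∫ w in 1 / X..1 / 2, h (X * 2 ^ w) * |dirKer N w|
      ≤ ∫ w in 1 / X..1 / 2, h (X * 2 ^ w) * (1 / (2 * w)) :=
    intervalIntegral.integral_mono_on hle (iJ _ _) i1 fun w hw =>
      mul_le_mul_of_nonneg_left (hker w hw) (hh0 _)
  have iJ' : IntervalIntegrable (fun w => h (X * 2 ^ (-w)) * |dirKer N w|) volume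
      (1 / X) (1 / 2) := by
    have := hD.abs.intervalIntegrable (μ := volume) (1 / X) (1 / 2)
    rw [intervalIntegrable_iff] at this ⊢
    exact this.bdd_mul (c := 2) (hhm.comp (by fun_prop)).aestronglyMeasurable
      (Eventually.of_forall fun w => hhK _)
  have q2 : ∫ w in -(1 / 2)..-(1 / X), h (X * 2 ^ w) * |dirKer N w|
      ≤ ∫ w in 1 / X..1 / 2, h (X * 2 ^ (-w)) * (1 / (2 * w)) := by
    rw [← intervalIntegral.integral_comp_neg]
    simp only [dirKer_neg]
    exact intervalIntegral.integral_mono_on hle iJ' i2 fun w hw =>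
      mul_le_mul_of_nonneg_left (hker w hw) (hh0 _)
  have q3 : ∫ w in -(1 / X)..1 / X, h (X * 2 ^ w) * |dirKer N w| ≤ 4 * (2 * N + 1) / X := by
    have := intervalIntegral.norm_integral_le_of_norm_le_const (a := -(1 / X)) (b := 1 / X)
      (f := fun w => h (X * 2 ^ w) * |dirKer N w|) (C := 2 * (2 * N + 1)) fun w _ => by
        rw [Real.norm_eq_abs, abs_mul, abs_abs]
        exact mul_le_mul (hhK _) (abs_dirKer_le N w) (abs_nonneg _) (by norm_num)
    rw [sub_neg_eq_add, abs_of_pos (by positivity : 0 < 1 / X + 1 / X)] at this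
    refine (le_abs_self _).trans (this.trans (le_of_eq ?_))
    field_simp; ring
  have a1 := intervalIntegral.integral_add_adjacent_intervals (iJ (-(1 / 2)) (-(1 / X)))
    (iJ (-(1 / X)) (1 / X))
  have a2 := intervalIntegral.integral_add_adjacent_intervals (iJ (-(1 / 2)) (1 / X))
    (iJ (1 / X) (1 / 2))
  have l1 : Real.log (X / 2) ≤ Real.log X := Real.log_le_log (by positivity) (by linarith)
  have l2 : 0 ≤ Real.log (X / 2) := Real.log_nonneg (by linarith)
  have l3 : m * Real.log (X / 2) ≤ 2 * δ * Real.log X := mul_le_mul hmδ l1 l2 (by positivity)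
  have e : sqWaveSum N X = (∫ w in (-(1 / 2) : ℝ)..1 / 2, P (X * 2 ^ w) * dirKer N w)
      + ∫ w in (-(1 / 2) : ℝ)..1 / 2, (sqWave (X * 2 ^ w) - P (X * 2 ^ w)) * dirKer N w := by
    simp only [sub_mul]
    rw [intervalIntegral.integral_sub ir iP, sqWaveSum]; ring
  rw [e]
  refine (abs_add_le _ _).trans ?_
  linarith

lemma lseriesHasSum_alternating {s : ℂ} (hs : 1 < s.re) :
    LSeriesHasSum (fun n => if Even n then -1 else 1) s
      ((1 - (2 : ℂ) ^ (1 - s)) * riemannZeta s) := by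
  have h1 : HasSum (LSeries.term 1 s) (riemannZeta s) := LSeriesHasSum_one hs
  have h2 : HasSum (LSeries.term (fun n => if Even n then 1 else 0) s)
      ((2 : ℂ) ^ (-s) * riemannZeta s + 0) := by
    refine HasSum.even_add_odd ?_ ?_
    · refine (h1.mul_left ((2 : ℂ) ^ (-s))).congr_fun fun k => ?_
      rcases eq_or_ne k 0 with rfl | hk
      · simp
      · rw [LSeries.term_of_ne_zero hk, LSeries.term_of_ne_zero (by positivity), if_pos (by simp)]
        rw [Nat.cast_mul, Complex.natCast_mul_natCast_cpow, Complex.cpow_neg]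
        simp [div_eq_mul_inv, mul_comm]
    · convert! hasSum_zero using 2 with k
      rw [LSeries.term_of_ne_zero (by positivity), if_neg (by simp), zero_div]
  have h3 := h1.sub (h2.mul_left 2)
  have e : riemannZeta s - 2 * ((2 : ℂ) ^ (-s) * riemannZeta s + 0)
      = (1 - (2 : ℂ) ^ (1 - s)) * riemannZeta s := by
    rw [sub_eq_add_neg 1 s, Complex.cpow_add _ _ two_ne_zero, Complex.cpow_one]; ring
  rw [e] at h3
  refine h3.congr_fun fun k => ?_
  rcases eq_or_ne k 0 with rfl | hk
  · simp
  · simp only [LSeries.term_of_ne_zero hk]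
    split_ifs
    · simp; ring
    · simp

lemma sum_alternating_eq {t : ℝ} (ht : 0 ≤ t) :
    ∑ k ∈ Finset.Icc 1 ⌊t⌋₊, (if Even k then -1 else 1 : ℂ) = (sqWave t : ℂ) + 1 / 2 := by
  have h1 : ∀ n : ℕ, ∑ k ∈ Finset.Icc 1 n, (if Even k then -1 else 1 : ℂ)
      = if Odd n then 1 else 0 := by
    intro n
    induction n with
    | zero => simp
    | succ n ih =>
      rw [Finset.sum_Icc_succ_top (by omega), ih]
      rcases Nat.even_or_odd n with h | h
      · simp [h, Nat.not_even_iff_odd.2 h.add_one, h.add_one]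
      · simp [h, h.add_one, Nat.not_odd_iff_even.2 h.add_one]
  have h2 : Odd ⌊t⌋ ↔ Odd ⌊t⌋₊ := by rw [← Int.natCast_floor_eq_floor ht]; exact Int.odd_coe_nat _
  rw [h1, sqWave]
  by_cases h : Odd ⌊t⌋₊ <;> simp [h2, h]; norm_num

lemma integrableOn_mul_cpow {f : ℝ → ℝ} {K : ℝ} {z : ℂ} (hf : Measurable f) (hK : ∀ u, |f u| ≤ K)
    (hz : z.re < -1) : IntegrableOn (fun u : ℝ => (f u : ℂ) * (u : ℂ) ^ z) (Ioi 1) := by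
  have h1 : IntegrableOn (fun u : ℝ => (u : ℂ) ^ z) (Ioi 1) :=
    integrableOn_Ioi_cpow_of_lt hz (by norm_num)
  exact h1.bdd_mul (c := K) (Complex.measurable_ofReal.comp hf).aestronglyMeasurable
    (Eventually.of_forall fun u => by simpa using hK u)

lemma intervalIntegrable_sqWave_mul_cpow {a b : ℝ} (ha : 0 < a) (hab : a ≤ b) (z : ℂ) :
    IntervalIntegrable (fun u : ℝ => (sqWave u : ℂ) * (u : ℂ) ^ z) volume a b := by
  have h1 : IntervalIntegrable (fun u : ℝ => (u : ℂ) ^ z) volume a b :=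
    intervalIntegral.intervalIntegrable_cpow (Or.inr (by
      rw [uIcc_of_le hab]; exact fun h => absurd h.1 (by linarith)))
  rw [intervalIntegrable_iff] at h1 ⊢
  exact h1.bdd_mul (c := 1 / 2) (Complex.measurable_ofReal.comp measurable_sqWave).aestronglyMeasurable
    (Eventually.of_forall fun u => by simpa using (abs_sqWave u).le)

lemma integral_sqWave_mul_cpow (s : ℂ) {U : ℝ} (hU : 1 ≤ U) :
    ∫ u in (1 : ℝ)..U, (sqWave u : ℂ) * (u : ℂ) ^ (-(s + 1))
      = sqWavePrim U * (U : ℂ) ^ (-(s + 1))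
        + (s + 1) * ∫ u in (1 : ℝ)..U, (sqWavePrim u : ℂ) * (u : ℂ) ^ (-(s + 2)) := by
  have hpos : ∀ u ∈ Icc 1 U, (0 : ℝ) < u := fun u hu => by linarith [hu.1]
  have hc : ∀ z : ℂ, ContinuousOn (fun u : ℝ => (u : ℂ) ^ z) (Icc 1 U) := fun z u hu =>
    (Complex.continuousAt_ofReal_cpow_const u z (Or.inr (hpos u hu).ne')).continuousWithinAt
  have hPc : Continuous fun u => (sqWavePrim u : ℂ) :=
    Complex.continuous_ofReal.comp continuous_sqWavePrim
  have i1 := intervalIntegrable_sqWave_mul_cpow one_pos hU (-(s + 1))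
  have i2 : IntervalIntegrable (fun u : ℝ => (sqWavePrim u : ℂ) * (u : ℂ) ^ (-(s + 2))) volume 1 U := by
    apply ContinuousOn.intervalIntegrable
    rw [uIcc_of_le hU]
    exact hPc.continuousOn.mul (hc _)
  have h := integral_eq_of_hasDerivAt_off_countable
    (fun u : ℝ => (sqWavePrim u : ℂ) * (u : ℂ) ^ (-(s + 1)))
    (fun u : ℝ => (sqWave u : ℂ) * (u : ℂ) ^ (-(s + 1))
      - (s + 1) * ((sqWavePrim u : ℂ) * (u : ℂ) ^ (-(s + 2)))) (a := 1) (b := U)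
    (countable_range ((↑) : ℤ → ℝ)) (by
      rw [uIcc_of_le hU]
      exact hPc.continuousOn.mul (hc _)) (fun u hu => by
      rw [min_eq_left hU, max_eq_right hU] at hu
      have hu0 : 0 < u := hpos u ⟨hu.1.1.le, hu.1.2.le⟩
      have d1 := (hasDerivAt_sqWavePrim (u := u) fun n hn => hu.2 ⟨n, hn.symm⟩).ofReal_comp
      have d2 : HasDerivAt (fun u : ℝ => (u : ℂ) ^ (-(s + 1)))
          (-(s + 1) * (u : ℂ) ^ (-(s + 1) - 1)) u := by
        have := (hasDerivAt_id (u : ℂ)).cpow_const (c := -(s + 1))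
          (by simp [Complex.slitPlane, hu0])
        simpa using this.comp_ofReal
      refine (d1.mul d2).congr_deriv ?_
      rw [show -(s + 1) - 1 = -(s + 2) by ring]
      ring) (i1.sub (i2.const_mul _))
  rw [intervalIntegral.integral_sub i1 (i2.const_mul _), intervalIntegral.integral_const_mul] at h
  simp only [sqWavePrim_one, Complex.ofReal_zero, zero_mul, sub_zero] at h
  rw [← h]; ring

/-- The continuation of `(1 - 2 ^ (1 - s)) ζ(s)` to `-1 < re s`. -/
noncomputable def etaAux (s : ℂ) : ℂ :=
  1 / 2 + s * ((s + 1) * ∫ u in Ioi (1 : ℝ), (sqWavePrim u : ℂ) * (u : ℂ) ^ (-(s + 2)))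

lemma tendsto_integral_sqWave_mul_cpow {s : ℂ} (hs : -1 < s.re) :
    Tendsto (fun U : ℝ => 1 / 2 + s * ∫ u in (1 : ℝ)..U, (sqWave u : ℂ) * (u : ℂ) ^ (-(s + 1)))
      atTop (𝓝 (etaAux s)) := by
  unfold etaAux
  refine (Tendsto.const_mul s ?_).const_add _
  have i := integrableOn_mul_cpow continuous_sqWavePrim.measurable abs_sqWavePrim_le
    (z := -(s + 2)) (by simp; linarith)
  have t1 := (intervalIntegral_tendsto_integral_Ioi 1 i tendsto_id).const_mul (s + 1)
  have t2 : Tendsto (fun U : ℝ => (sqWavePrim U : ℂ) * (U : ℂ) ^ (-(s + 1))) atTop (𝓝 0) := by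
    have e : Tendsto (fun U : ℝ => U ^ (-(s.re + 1))) atTop (𝓝 0) :=
      tendsto_rpow_neg_atTop (by linarith)
    refine squeeze_zero_norm' ?_ e
    filter_upwards [eventually_gt_atTop 0] with U hU
    rw [norm_mul, Complex.norm_cpow_eq_rpow_re_of_pos hU]
    have := abs_sqWavePrim_le U
    have h0 := Real.rpow_nonneg hU.le (-(s + 1)).re
    simp only [Complex.norm_real, Real.norm_eq_abs]
    calc |sqWavePrim U| * U ^ (-(s + 1)).re ≤ 1 * U ^ (-(s + 1)).re := by gcongr
      _ = _ := by simp
  have t3 := t2.add t1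
  rw [zero_add] at t3
  refine t3.congr' ?_
  filter_upwards [eventually_ge_atTop 1] with U hU
  rw [integral_sqWave_mul_cpow s hU]; rfl

lemma etaAux_eq_of_one_lt_re {s : ℂ} (hs : 1 < s.re) :
    etaAux s = (1 - (2 : ℂ) ^ (1 - s)) * riemannZeta s := by
  have hS := lseriesHasSum_alternating hs
  have h := LSeries_eq_mul_integral (fun n => if Even n then -1 else 1 : ℕ → ℂ) le_rfl
    (by linarith : (0 : ℝ) < s.re) hS.LSeriesSummable (by
      refine Asymptotics.isBigO_of_le _ fun n => ?_
      have := sum_alternating_eq (t := (n : ℝ)) (by positivity)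
      rw [Nat.floor_natCast] at this
      rw [this]
      simp only [Real.rpow_zero, norm_one]
      refine (norm_add_le _ _).trans ?_
      rw [Complex.norm_real, Real.norm_eq_abs, abs_sqWave]
      norm_num)
  rw [hS.LSeries_eq] at h
  have i1 := integrableOn_mul_cpow measurable_sqWave (fun u => (abs_sqWave u).le)
    (z := -(s + 1)) (by simp; linarith)
  have i2 : IntegrableOn (fun u : ℝ => (u : ℂ) ^ (-(s + 1))) (Ioi 1) :=
    integrableOn_Ioi_cpow_of_lt (by simp; linarith) (by norm_num)
  have e1 : ∫ t in Ioi (1 : ℝ), (∑ k ∈ Finset.Icc 1 ⌊t⌋₊, (if Even k then -1 else 1 : ℂ))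
        * (t : ℂ) ^ (-(s + 1))
      = (∫ t in Ioi (1 : ℝ), (sqWave t : ℂ) * (t : ℂ) ^ (-(s + 1)))
        + 1 / 2 * ∫ t in Ioi (1 : ℝ), (t : ℂ) ^ (-(s + 1)) := by
    rw [← integral_const_mul, ← integral_add i1 (i2.const_mul _)]
    refine setIntegral_congr_fun measurableSet_Ioi fun t ht => ?_
    rw [sum_alternating_eq (by linarith [mem_Ioi.1 ht]), add_mul]
  have hs0 : s ≠ 0 := fun h => by rw [h] at hs; norm_num at hs
  have e2 : ∫ t in Ioi (1 : ℝ), (t : ℂ) ^ (-(s + 1)) = 1 / s := by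
    rw [integral_Ioi_cpow_of_lt (by simp; linarith) one_pos]
    simp
  rw [e1, e2] at h
  rw [h]
  have t1 := tendsto_integral_sqWave_mul_cpow (s := s) (by linarith)
  have t2 := ((intervalIntegral_tendsto_integral_Ioi 1 i1 tendsto_id).const_mul s).const_add (1 / 2)
  refine tendsto_nhds_unique t1 (t2.congr fun U => rfl) |>.trans ?_
  field_simp
  ring

lemma differentiableAt_etaAux {s : ℂ} (hs : -1 < s.re) : DifferentiableAt ℂ etaAux s := by
  set f : ℝ → ℂ := (Ioi (1 : ℝ)).indicator fun u => (sqWavePrim u : ℂ) with hf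
  have hcont : Continuous fun u => (sqWavePrim u : ℂ) :=
    Complex.continuous_ofReal.comp continuous_sqWavePrim
  have hfb : ∀ u, ‖f u‖ ≤ 1 := fun u =>
    (norm_indicator_le_norm_self _ _).trans (by simpa using abs_sqWavePrim_le u)
  have hloc : LocallyIntegrableOn f (Ioi 0) :=
    (hcont.locallyIntegrable.indicator measurableSet_Ioi).locallyIntegrableOn _
  have hd : ∀ z : ℂ, z.re < 0 → DifferentiableAt ℂ (mellin f) z := by
    intro z hz
    refine mellin_differentiableAt_of_isBigO_rpow (a := 0) (b := z.re - 1) hloc ?_ hz ?_ (by linarith)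
    · exact Asymptotics.isBigO_of_le _ fun u => by simpa using hfb u
    · refine Asymptotics.IsBigO.congr' (Asymptotics.isBigO_zero _ _) ?_ EventuallyEq.rfl
      have : ∀ᶠ u : ℝ in 𝓝[>] 0, u < 1 := nhdsWithin_le_nhds (Iio_mem_nhds one_pos)
      filter_upwards [this] with u hu
      simp [hf, hu.le]
  have he : etaAux = fun s => 1 / 2 + s * ((s + 1) * mellin f (-(s + 1))) := by
    funext s
    unfold etaAux mellin
    congr 3
    have : ∀ t : ℝ, (t : ℂ) ^ (-(s + 1) - 1) • f t
        = (Ioi (1 : ℝ)).indicator (fun u => (sqWavePrim u : ℂ) * (u : ℂ) ^ (-(s + 2))) t := by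
      intro t
      rw [hf, show -(s + 1) - 1 = -(s + 2) by ring, smul_eq_mul]
      by_cases ht : t ∈ Ioi (1 : ℝ)
      · rw [indicator_of_mem ht, indicator_of_mem ht, mul_comm]
      · rw [indicator_of_notMem ht, indicator_of_notMem ht, mul_zero]
    simp_rw [this]
    rw [setIntegral_indicator measurableSet_Ioi, inter_eq_right.2 (Ioi_subset_Ioi zero_le_one)]
  rw [he]
  have h1 : DifferentiableAt ℂ (fun s : ℂ => mellin f (-(s + 1))) s :=
    DifferentiableAt.comp (g := mellin f) (f := fun s : ℂ => -(s + 1)) s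
      (hd _ (by simp; linarith)) (by fun_prop)
  exact (differentiableAt_id.mul ((differentiableAt_id.add_const _).mul h1)).const_add _

lemma etaAux_eq {s : ℂ} (hs : -1 < s.re) (hs' : s.im ≠ 0) :
    etaAux s = (1 - (2 : ℂ) ^ (1 - s)) * riemannZeta s := by
  have hz : ∀ z : ℂ, z.im ≠ 0 →
      DifferentiableAt ℂ (fun s => (1 - (2 : ℂ) ^ (1 - s)) * riemannZeta s) z := by
    intro z hz
    refine DifferentiableAt.mul ?_ (differentiableAt_riemannZeta fun h => hz (by simp [h]))
    exact (DifferentiableAt.const_cpow (by fun_prop) (Or.inl two_ne_zero)).const_sub _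
  have hre : IsOpen {z : ℂ | 1 < z.re} := isOpen_lt continuous_const Complex.continuous_re
  have key : ∀ U : Set ℂ, IsOpen U → Convex ℝ U → (∀ z ∈ U, -1 < z.re ∧ z.im ≠ 0) →
      (∃ z ∈ U, 1 < z.re) → s ∈ U →
      etaAux s = (1 - (2 : ℂ) ^ (1 - s)) * riemannZeta s := by
    intro U hU hconv hsub ⟨z, hzU, hz1⟩ hsU
    refine AnalyticOnNhd.eqOn_of_preconnected_of_eventuallyEq (𝕜 := ℂ) (f := etaAux)
      (g := fun s => (1 - (2 : ℂ) ^ (1 - s)) * riemannZeta s) (U := U) (z₀ := z)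
      ?_ ?_ hconv.isPreconnected hzU ?_ hsU
    · exact DifferentiableOn.analyticOnNhd
        (fun z hz => (differentiableAt_etaAux (hsub z hz).1).differentiableWithinAt) hU
    · exact DifferentiableOn.analyticOnNhd
        (fun w hw => (hz w (hsub w hw).2).differentiableWithinAt) hU
    · filter_upwards [hre.mem_nhds hz1] with w hw using etaAux_eq_of_one_lt_re hw
  rcases lt_or_gt_of_ne hs' with h | h
  · refine key ({z | -1 < z.re} ∩ {z | z.im < 0}) ?_ ?_ (fun z hz => ⟨hz.1, hz.2.ne⟩)
      ⟨⟨2, -1⟩, ⟨by norm_num, by norm_num⟩, by norm_num⟩ ⟨hs, h⟩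
    · exact (isOpen_lt continuous_const Complex.continuous_re).inter
        (isOpen_lt Complex.continuous_im continuous_const)
    · exact (convex_halfSpace_re_gt _).inter (convex_halfSpace_im_lt _)
  · refine key ({z | -1 < z.re} ∩ {z | 0 < z.im}) ?_ ?_ (fun z hz => ⟨hz.1, hz.2.ne'⟩)
      ⟨⟨2, 1⟩, ⟨by norm_num, by norm_num⟩, by norm_num⟩ ⟨hs, h⟩
    · exact (isOpen_lt continuous_const Complex.continuous_re).inter
        (isOpen_lt continuous_const Complex.continuous_im)
    · exact (convex_halfSpace_re_gt _).inter (convex_halfSpace_im_gt _)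

lemma tendsto_integral_sqWave_mul_cpow_of_le {s : ℂ} (hs : -1 < s.re) (hs0 : s ≠ 0) {a : ℝ}
    (ha : 0 < a) (ha1 : a ≤ 1) :
    Tendsto (fun U : ℝ => (a : ℂ) ^ (-s) / 2
      + s * ∫ u in a..U, (sqWave u : ℂ) * (u : ℂ) ^ (-(s + 1))) atTop (𝓝 (etaAux s)) := by
  refine (tendsto_integral_sqWave_mul_cpow hs).congr' ?_
  filter_upwards [eventually_ge_atTop 1] with U hU
  have h1 : ∫ u in a..1, (sqWave u : ℂ) * (u : ℂ) ^ (-(s + 1)) = ((a : ℂ) ^ (-s) - 1) * (-1 / (2 * s)) := by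
    rw [intervalIntegral.integral_congr_Ioo_of_le (g := fun u : ℝ => (-(1 / 2) : ℂ) * (u : ℂ) ^ (-(s + 1)))
      ha1 fun u hu => ?_]
    · rw [intervalIntegral.integral_const_mul, integral_cpow]
      · rw [show -(s + 1) + 1 = -s by ring, Complex.ofReal_one, Complex.one_cpow]
        field_simp; ring
      · refine Or.inr ⟨fun h => hs0 (by linear_combination -h), ?_⟩
        rw [uIcc_of_le ha1]; exact fun h => absurd h.1 (by linarith)
    · have : ⌊u⌋ = 0 := Int.floor_eq_iff.2 ⟨by simpa using (ha.trans hu.1).le, by simpa using hu.2⟩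
      simp [sqWave, this]
  rw [← intervalIntegral.integral_add_adjacent_intervals
    (intervalIntegrable_sqWave_mul_cpow ha ha1 (-(s + 1)))
    (intervalIntegrable_sqWave_mul_cpow one_pos hU (-(s + 1))), h1]
  field_simp
  ring

lemma integral_sqWave_mul_cpow_comp (s : ℂ) {x : ℝ} (hx : 0 < x) {α V : ℝ} (h : α ≤ V) :
    ∫ u in x * 2 ^ α..x * 2 ^ V, (sqWave u : ℂ) * (u : ℂ) ^ (-(s + 1))
      = Real.log 2 * ∫ v in α..V, (sqWave (x * 2 ^ v) : ℂ) * ((x * 2 ^ v : ℝ) : ℂ) ^ (-s) := by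
  have hL : 0 < Real.log 2 := Real.log_pos (by norm_num)
  have hmono : StrictMono fun v : ℝ => x * (2 : ℝ) ^ v := fun v w hvw =>
    mul_lt_mul_of_pos_left (Real.rpow_lt_rpow_of_exponent_lt (by norm_num) hvw) hx
  have hcont : Continuous fun v : ℝ => x * (2 : ℝ) ^ v :=
    continuous_const.mul (Real.continuous_const_rpow two_ne_zero)
  have himg : (fun v : ℝ => x * (2 : ℝ) ^ v) '' Ioc α V = Ioc (x * 2 ^ α) (x * 2 ^ V) := by
    apply Subset.antisymm
    · rintro _ ⟨v, hv, rfl⟩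
      exact ⟨hmono hv.1, hmono.monotone hv.2⟩
    · exact intermediate_value_Ioc h hcont.continuousOn
  rw [intervalIntegral.integral_of_le (hmono.monotone h), ← himg,
    integral_image_eq_integral_abs_deriv_smul measurableSet_Ioc
      (fun v _ => ((hasDerivAt_two_rpow v).const_mul x).hasDerivWithinAt) hmono.injective.injOn,
    intervalIntegral.integral_of_le h, ← integral_const_mul]
  refine setIntegral_congr_fun measurableSet_Ioc fun v _ => ?_
  have hp : 0 < x * (2 : ℝ) ^ v := by positivity
  have hp' : ((x * 2 ^ v : ℝ) : ℂ) ≠ 0 := by exact_mod_cast hp.ne'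
  have e : -s = -(s + 1) + 1 := by ring
  rw [e, Complex.cpow_add _ _ hp', Complex.cpow_one, abs_of_pos (by positivity), Complex.real_smul]
  push_cast
  ring

/-- The zeros `2πin / log 2` of `1 - 2 ^ (-s)`. -/
noncomputable def zetaPt (n : ℤ) : ℂ := 2 * (n : ℂ) * (Real.pi : ℂ) * Complex.I / (Real.log 2 : ℂ)

lemma ofReal_log_two_ne_zero : (Real.log 2 : ℂ) ≠ 0 := by
  exact_mod_cast (Real.log_pos (by norm_num : (1 : ℝ) < 2)).ne'

lemma zetaPt_eq (n : ℤ) : zetaPt n = ((2 * n * Real.pi / Real.log 2 : ℝ) : ℂ) * Complex.I := by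
  unfold zetaPt; push_cast; ring

lemma zetaPt_re (n : ℤ) : (zetaPt n).re = 0 := by
  rw [zetaPt_eq, Complex.re_ofReal_mul, Complex.I_re, mul_zero]

lemma zetaPt_im (n : ℤ) : (zetaPt n).im = 2 * n * Real.pi / Real.log 2 := by
  rw [zetaPt_eq, Complex.im_ofReal_mul, Complex.I_im, mul_one]

lemma zetaPt_im_ne_zero {n : ℤ} (hn : n ≠ 0) : (zetaPt n).im ≠ 0 := by
  have hL : 0 < Real.log 2 := Real.log_pos (by norm_num)
  have hnC : (n : ℝ) ≠ 0 := by exact_mod_cast hn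
  rw [zetaPt_im]
  exact div_ne_zero (mul_ne_zero (mul_ne_zero two_ne_zero hnC) Real.pi_ne_zero) hL.ne'

lemma etaAux_zetaPt {n : ℤ} (hn : n ≠ 0) : etaAux (zetaPt n) = -riemannZeta (zetaPt n) := by
  have h2 : (2 : ℂ) ^ (1 - zetaPt n) = 2 := by
    rw [sub_eq_add_neg, Complex.cpow_add _ _ two_ne_zero, Complex.cpow_one,
      Complex.cpow_def_of_ne_zero two_ne_zero]
    have : Complex.log 2 * -zetaPt n = (-n : ℤ) * (2 * Real.pi * Complex.I) := by
      have e : Complex.log 2 = (Real.log 2 : ℂ) := by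
        rw [Complex.ofReal_log (by norm_num)]; simp
      rw [e, zetaPt]
      have := ofReal_log_two_ne_zero
      rw [mul_neg, mul_div_cancel₀ _ this]
      push_cast; ring
    rw [this, Complex.exp_int_mul_two_pi_mul_I, mul_one]
  rw [etaAux_eq, h2]
  · ring
  · rw [zetaPt_re]; norm_num
  · exact zetaPt_im_ne_zero hn

lemma cpow_neg_zetaPt (n : ℤ) (y v : ℝ) :
    (((2 : ℝ) ^ y * 2 ^ v : ℝ) : ℂ) ^ (-zetaPt n)
      = Complex.exp (-(2 * n * Real.pi * Complex.I * y))
        * Complex.exp (-(2 * n * Real.pi * Complex.I * v)) := by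
  have hp : (0 : ℝ) < (2 : ℝ) ^ y * 2 ^ v := by positivity
  have hL := ofReal_log_two_ne_zero
  rw [Complex.cpow_def_of_ne_zero (by exact_mod_cast hp.ne'), ← Complex.exp_add,
    ← Complex.ofReal_log hp.le, ← Real.rpow_add (by norm_num), Real.log_rpow (by norm_num), zetaPt]
  congr 1
  push_cast
  field_simp
  ring

lemma tendsto_integral_sqWave_mul_exp {n : ℤ} (hn : n ≠ 0) {y : ℝ} (hy : y ≤ 3 / 2) :
    Tendsto (fun V : ℝ => ∫ v in (-(3 / 2) : ℝ)..V, (sqWave (2 ^ y * 2 ^ v) : ℂ)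
        * Complex.exp (-(2 * n * Real.pi * Complex.I * v))) atTop
      (𝓝 (-(riemannZeta (zetaPt n) * Complex.exp (2 * n * Real.pi * Complex.I * y) / n)
          / (2 * Real.pi * Complex.I)
        - Complex.exp (3 * n * Real.pi * Complex.I) / (4 * n * Real.pi * Complex.I))) := by
  have hx : (0 : ℝ) < 2 ^ y := by positivity
  have hL := ofReal_log_two_ne_zero
  have hnC : (n : ℂ) ≠ 0 := by exact_mod_cast hn
  have hpi : (Real.pi : ℂ) ≠ 0 := by exact_mod_cast Real.pi_ne_zero
  have hs0 : zetaPt n ≠ 0 := fun h => zetaPt_im_ne_zero hn (by rw [h, Complex.zero_im])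
  have hre : -1 < (zetaPt n).re := by rw [zetaPt_re]; norm_num
  have hE : Complex.exp (2 * n * Real.pi * Complex.I * y) ≠ 0 := Complex.exp_ne_zero _
  have ha1 : (2 : ℝ) ^ y * 2 ^ (-(3 / 2) : ℝ) ≤ 1 := by
    rw [← Real.rpow_add (by norm_num)]
    exact Real.rpow_le_one_of_one_le_of_nonpos (by norm_num) (by linarith)
  have hU : Tendsto (fun V : ℝ => (2 : ℝ) ^ y * 2 ^ V) atTop atTop :=
    (tendsto_rpow_atTop_of_base_gt_one 2 (by norm_num)).const_mul_atTop hx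
  have t := (tendsto_integral_sqWave_mul_cpow_of_le hre hs0 (by positivity) ha1).comp hU
  rw [etaAux_zetaPt hn] at t
  have t2 := ((t.sub_const ((((2 : ℝ) ^ y * 2 ^ (-(3 / 2) : ℝ) : ℝ) : ℂ) ^ (-zetaPt n) / 2)).mul_const
    (Complex.exp (2 * n * Real.pi * Complex.I * y) / (2 * n * Real.pi * Complex.I)))
  have e0 : Complex.exp (-(2 * n * Real.pi * Complex.I * y))
      = (Complex.exp (2 * n * Real.pi * Complex.I * y))⁻¹ := Complex.exp_neg _
  convert! t2.congr' ?_ using 1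
  · rw [cpow_neg_zetaPt, e0]
    have : -(2 * (n : ℂ) * Real.pi * Complex.I * ((-(3 / 2) : ℝ) : ℂ)) = 3 * n * Real.pi * Complex.I := by
      push_cast; ring
    rw [this]
    congr 1
    field_simp
    ring
  · filter_upwards [eventually_ge_atTop (-(3 / 2) : ℝ)] with V hV
    simp only [Function.comp_apply]
    rw [integral_sqWave_mul_cpow_comp _ hx hV]
    simp_rw [cpow_neg_zetaPt, e0]
    have : ∀ v : ℝ, (sqWave (2 ^ y * 2 ^ v) : ℂ) * ((Complex.exp (2 * n * Real.pi * Complex.I * y))⁻¹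
        * Complex.exp (-(2 * n * Real.pi * Complex.I * v)))
        = (Complex.exp (2 * n * Real.pi * Complex.I * y))⁻¹ * ((sqWave (2 ^ y * 2 ^ v) : ℂ)
          * Complex.exp (-(2 * n * Real.pi * Complex.I * v))) := fun v => by ring
    simp_rw [this]
    rw [intervalIntegral.integral_const_mul]
    generalize (∫ v in (-(3 / 2) : ℝ)..V, (sqWave (2 ^ y * 2 ^ v) : ℂ)
        * Complex.exp (-(2 * n * Real.pi * Complex.I * v))) = J
    rw [add_sub_cancel_left, zetaPt]
    field_simp

/-- The summand of the zeta sum at `2 ^ y`. -/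
noncomputable def zetaTerm (y : ℝ) (n : ℤ) : ℂ :=
  riemannZeta (zetaPt n) * Complex.exp (2 * n * Real.pi * Complex.I * y) / n

lemma tendsto_integral_sqWave_mul_cos (n : ℕ) {y : ℝ} (hy : y ≤ 3 / 2) :
    Tendsto (fun V : ℝ => ((∫ v in (-(3 / 2) : ℝ)..V, sqWave (2 ^ y * 2 ^ v)
        * (2 * Real.cos (2 * Real.pi * (n + 1) * v)) : ℝ) : ℂ)) atTop
      (𝓝 (-(zetaTerm y (n + 1) + zetaTerm y (-(n + 1))) / (2 * Real.pi * Complex.I))) := by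
  have hn1 : ((n : ℤ) + 1) ≠ 0 := by positivity
  have hn2 : -((n : ℤ) + 1) ≠ 0 := neg_ne_zero.2 hn1
  have t := (tendsto_integral_sqWave_mul_exp hn1 hy).add (tendsto_integral_sqWave_mul_exp hn2 hy)
  have hm : Measurable fun v : ℝ => (sqWave (2 ^ y * 2 ^ v) : ℂ) :=
    Complex.measurable_ofReal.comp (measurable_sqWave.comp (by fun_prop))
  have hi : ∀ (c : ℂ) (V : ℝ), IntervalIntegrable (fun v : ℝ => (sqWave (2 ^ y * 2 ^ v) : ℂ)
        * Complex.exp (-(c * v))) volume (-(3 / 2)) V := by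
    intro c V
    have h1 : IntervalIntegrable (fun v : ℝ => Complex.exp (-(c * v))) volume (-(3 / 2)) V :=
      Continuous.intervalIntegrable (by fun_prop) _ _
    rw [intervalIntegrable_iff] at h1 ⊢
    exact h1.bdd_mul (c := 1 / 2) hm.aestronglyMeasurable
      (Eventually.of_forall fun u => by simpa using (abs_sqWave _).le)
  convert! t using 1
  · funext V
    rw [← intervalIntegral.integral_add (hi _ V) (hi _ V), ← intervalIntegral.integral_ofReal]
    refine intervalIntegral.integral_congr fun v _ => ?_
    rw [← mul_add, Complex.ofReal_mul]
    congr 1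
    push_cast
    rw [Complex.cos, mul_div_cancel₀ _ two_ne_zero, add_comm]
    congr 2 <;> ring
  · have hE : Complex.exp (3 * ((-((n : ℤ) + 1) : ℤ) : ℂ) * Real.pi * Complex.I)
        = Complex.exp (3 * (((n : ℤ) + 1 : ℤ) : ℂ) * Real.pi * Complex.I) := by
      rw [Complex.exp_eq_exp_iff_exists_int]
      exact ⟨-3 * (n + 1), by push_cast; ring⟩
    rw [hE]
    congr 1
    unfold zetaTerm
    have h0 : (((n : ℤ) + 1 : ℤ) : ℂ) ≠ 0 := by exact_mod_cast hn1
    have hpi : (Real.pi : ℂ) ≠ 0 := by exact_mod_cast Real.pi_ne_zero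
    have hI := Complex.I_ne_zero
    rw [Int.cast_neg]
    generalize (((n : ℤ) + 1 : ℤ) : ℂ) = m at *
    field_simp
    ring

lemma sum_erase_zero_Icc (N : ℕ) (f : ℤ → ℂ) :
    ∑ n ∈ (Finset.Icc (-(N : ℤ)) N).erase 0, f n
      = ∑ k ∈ Finset.range N, (f (k + 1) + f (-(k + 1))) := by
  induction N with
  | zero => simp
  | succ N ih =>
    rw [Finset.sum_range_succ, ← ih]
    have : (Finset.Icc (-((N + 1 : ℕ) : ℤ)) (N + 1 : ℕ)).erase 0
        = insert ((N : ℤ) + 1) (insert (-((N : ℤ) + 1)) ((Finset.Icc (-(N : ℤ)) N).erase 0)) := by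
      ext z
      simp only [Finset.mem_erase, Finset.mem_Icc, Finset.mem_insert]
      push_cast
      omega
    rw [this, Finset.sum_insert, Finset.sum_insert]
    · ring
    · simp
    · simp; omega

lemma integral_sub_one_unit (N : ℕ) {y : ℝ} (j : ℕ) :
    ∫ v in ((j : ℝ) - 3 / 2)..((j + 1 : ℕ) - 3 / 2), sqWave (2 ^ y * 2 ^ v) * (dirKer N v - 1)
      = sqWaveSum N (2 ^ y / 2 * 2 ^ j) - sqWaveSum 0 (2 ^ y / 2 * 2 ^ j) := by
  have e1 : ((j : ℝ) - 3 / 2) = -(1 / 2) + ((j : ℝ) - 1) := by ring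
  have e2 : (((j + 1 : ℕ) : ℝ) - 3 / 2) = 1 / 2 + ((j : ℝ) - 1) := by push_cast; ring
  have hi : ∀ M, IntervalIntegrable (fun w : ℝ => sqWave (2 ^ y / 2 * 2 ^ j * 2 ^ w) * dirKer M w)
      volume (-(1 / 2)) (1 / 2) := by
    intro M
    have := dirKer_intervalIntegrable M (-(1 / 2)) (1 / 2)
    rw [intervalIntegrable_iff] at this ⊢
    exact this.bdd_mul (c := 1 / 2) (measurable_sqWave.comp (by fun_prop)).aestronglyMeasurable
      (Eventually.of_forall fun w => (abs_sqWave _).le)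
  rw [e1, e2, ← intervalIntegral.integral_comp_add_right, sqWaveSum, sqWaveSum,
    ← intervalIntegral.integral_sub (hi N) (hi 0)]
  refine intervalIntegral.integral_congr fun w _ => ?_
  have h1 : dirKer N (w + ((j : ℝ) - 1)) = dirKer N w := by
    have := dirKer_add_int N w ((j : ℤ) - 1)
    push_cast at this; exact this
  have h2 : (2 : ℝ) ^ (w + ((j : ℝ) - 1)) = 2 ^ j * 2 ^ w / 2 := by
    rw [Real.rpow_add (by norm_num), Real.rpow_sub (by norm_num), Real.rpow_one, Real.rpow_natCast]
    ring
  have h3 : dirKer 0 w = 1 := by simp [dirKer]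
  rw [h1, h2, h3, mul_sub]
  congr 3 <;> ring

/-- The truncated zeta sum as a sum over binary scales. -/
lemma exists_zetaSum_eq {y : ℝ} (hy : y ≤ 3 / 2) (N : ℕ) :
    ∃ F : ℝ, ∑ n ∈ (Finset.Icc (-(N : ℤ)) N).erase 0, zetaTerm y n = -(2 * Real.pi * Complex.I) * F ∧
      Tendsto (fun T : ℕ => ∑ j ∈ Finset.range T,
        (sqWaveSum N (2 ^ y / 2 * 2 ^ j) - sqWaveSum 0 (2 ^ y / 2 * 2 ^ j))) atTop (𝓝 F) := by
  have hpi : (Real.pi : ℂ) ≠ 0 := by exact_mod_cast Real.pi_ne_zero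
  set Z := ∑ n ∈ (Finset.Icc (-(N : ℤ)) N).erase 0, zetaTerm y n with hZ
  have t : Tendsto (fun V : ℝ => ∑ k ∈ Finset.range N, ((∫ v in (-(3 / 2) : ℝ)..V,
      sqWave (2 ^ y * 2 ^ v) * (2 * Real.cos (2 * Real.pi * (k + 1) * v)) : ℝ) : ℂ)) atTop
      (𝓝 (-Z / (2 * Real.pi * Complex.I))) := by
    have := tendsto_finsetSum (Finset.range N) fun k _ => tendsto_integral_sqWave_mul_cos k hy
    rwa [← Finset.sum_div, Finset.sum_neg_distrib, ← sum_erase_zero_Icc N (zetaTerm y)] at this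
  have hT : Tendsto (fun T : ℕ => (T : ℝ) - 3 / 2) atTop atTop :=
    tendsto_atTop_add_const_right _ _ tendsto_natCast_atTop_atTop
  have hi : ∀ g : ℝ → ℝ, Continuous g → ∀ a b,
      IntervalIntegrable (fun v : ℝ => sqWave (2 ^ y * 2 ^ v) * g v) volume a b := by
    intro g hg a b
    have := hg.intervalIntegrable (μ := volume) a b
    rw [intervalIntegrable_iff] at this ⊢
    exact this.bdd_mul (c := 1 / 2) (measurable_sqWave.comp (by fun_prop)).aestronglyMeasurable
      (Eventually.of_forall fun w => (abs_sqWave _).le)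
  have t2 := t.comp hT
  have hD1 : Continuous fun v => dirKer N v - 1 := (continuous_dirKer N).sub continuous_const
  have key : ∀ T : ℕ, ((∑ j ∈ Finset.range T,
      (sqWaveSum N (2 ^ y / 2 * 2 ^ j) - sqWaveSum 0 (2 ^ y / 2 * 2 ^ j)) : ℝ) : ℂ)
      = ∑ k ∈ Finset.range N, ((∫ v in (-(3 / 2) : ℝ)..((T : ℝ) - 3 / 2),
      sqWave (2 ^ y * 2 ^ v) * (2 * Real.cos (2 * Real.pi * (k + 1) * v)) : ℝ) : ℂ) := by
    intro T
    rw [← Complex.ofReal_sum]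
    congr 1
    simp_rw [← integral_sub_one_unit]
    rw [intervalIntegral.sum_integral_adjacent_intervals (a := fun j : ℕ => (j : ℝ) - 3 / 2)
      fun j _ => hi _ hD1 _ _,
      ← intervalIntegral.integral_finsetSum fun k _ => hi _ (by fun_prop) _ _]
    simp only [Nat.cast_zero, zero_sub]
    refine intervalIntegral.integral_congr fun v _ => ?_
    rw [← Finset.mul_sum, dirKer, add_sub_cancel_left, Finset.mul_sum]
  have t3 := t2.congr fun T => (key T).symm
  have t4 := (Complex.continuous_re.tendsto _).comp t3
  simp only [Function.comp_def, Complex.ofReal_re] at t4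
  refine ⟨_, ?_, t4⟩
  have t5 := (Complex.continuous_ofReal.tendsto _).comp t4
  have := tendsto_nhds_unique t5 t3
  rw [this]
  field_simp [Complex.I_ne_zero]

/-- Distance to the nearest integer. -/
noncomputable def distInt (u : ℝ) : ℝ := |u - round u|

lemma distInt_le (u : ℝ) (n : ℤ) : distInt u ≤ |u - n| := round_le u n

lemma distInt_pos {u : ℝ} (hu : Irrational u) : 0 < distInt u :=
  abs_pos.2 (sub_ne_zero.2 (hu.ne_int _))

lemma abs_sub_sum_sqWaveSum_le {x F : ℝ} (hx : 1 ≤ x) (N : ℕ)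
    (hF : Tendsto (fun T : ℕ => ∑ j ∈ Finset.range T,
        (sqWaveSum N (x / 2 * 2 ^ j) - sqWaveSum 0 (x / 2 * 2 ^ j))) atTop (𝓝 F)) (m : ℕ) :
    |F - ∑ j ∈ Finset.range m, sqWaveSum N (x / 2 * 2 ^ j)|
      ≤ 560 + 560 * ((2 * N + 1) * (1 + Real.log (2 * N + 1))) / 2 ^ m := by
  set A : ℝ := (2 * N + 1) * (1 + Real.log (2 * N + 1)) with hA
  have hA0 : 0 ≤ A := by
    have : 0 ≤ Real.log (2 * N + 1) := Real.log_nonneg (by linarith [(N.cast_nonneg : (0 : ℝ) ≤ N)])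
    positivity
  have b : ∀ j : ℕ, |sqWaveSum N (x / 2 * 2 ^ j)| ≤ 280 * A / 2 ^ j := by
    intro j
    refine (abs_sqWaveSum_le N (by positivity)).trans ?_
    rw [← hA, div_le_div_iff₀ (by positivity) (by positivity)]
    have : 280 * A * (x / 2 * 2 ^ j) = 140 * A * 2 ^ j * x := by ring
    rw [this]
    exact le_mul_of_one_le_right (by positivity) hx
  have b0 : ∀ j : ℕ, |sqWaveSum 0 (x / 2 * 2 ^ j)| ≤ 280 / 2 ^ j := by
    intro j
    refine (abs_sqWaveSum_le 0 (by positivity)).trans ?_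
    rw [div_le_div_iff₀ (by positivity) (by positivity)]
    have : 280 * (x / 2 * 2 ^ j) = 140 * 2 ^ j * x := by ring
    rw [this]
    simp only [Nat.cast_zero, mul_zero, zero_add, Real.log_one, add_zero, mul_one]
    exact le_mul_of_one_le_right (by positivity) hx
  have geo : ∀ a T : ℕ, ∑ j ∈ Finset.range T, (1 : ℝ) / 2 ^ (a + j) ≤ 2 / 2 ^ a := by
    intro a T
    have : ∑ j ∈ Finset.range T, (1 : ℝ) / 2 ^ (a + j) = 2 / 2 ^ a - 2 / 2 ^ (a + T) := by
      induction T with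
      | zero => simp
      | succ T ih => rw [Finset.sum_range_succ, ih, ← add_assoc, pow_succ (2 : ℝ) (a + T)]; field_simp; ring
    rw [this]
    linarith [(by positivity : (0 : ℝ) ≤ 2 / 2 ^ (a + T))]
  have hlim : Tendsto (fun T : ℕ => |(∑ j ∈ Finset.range (m + T),
        (sqWaveSum N (x / 2 * 2 ^ j) - sqWaveSum 0 (x / 2 * 2 ^ j)))
        - ∑ j ∈ Finset.range m, sqWaveSum N (x / 2 * 2 ^ j)|) atTop
      (𝓝 |F - ∑ j ∈ Finset.range m, sqWaveSum N (x / 2 * 2 ^ j)|) := by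
    have : Tendsto (fun T => m + T) atTop atTop := tendsto_atTop_mono (fun T => Nat.le_add_left T m) tendsto_id
    exact ((hF.comp this).sub_const _).abs
  refine le_of_tendsto' hlim fun T => ?_
  rw [Finset.sum_sub_distrib, Finset.sum_range_add]
  have c1 : |∑ j ∈ Finset.range T, sqWaveSum N (x / 2 * 2 ^ (m + j))| ≤ 280 * A * (2 / 2 ^ m) := by
    refine (Finset.abs_sum_le_sum_abs _ _).trans ?_
    refine le_trans (Finset.sum_le_sum fun j _ => b (m + j)) ?_
    have : ∀ j, 280 * A / 2 ^ (m + j) = 280 * A * (1 / 2 ^ (m + j)) := fun j => by ring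
    simp_rw [this]
    rw [← Finset.mul_sum]
    exact mul_le_mul_of_nonneg_left (geo m T) (by positivity)
  have c2 : |∑ j ∈ Finset.range (m + T), sqWaveSum 0 (x / 2 * 2 ^ j)| ≤ 560 := by
    refine (Finset.abs_sum_le_sum_abs _ _).trans ?_
    refine le_trans (Finset.sum_le_sum fun j _ => b0 j) ?_
    have h0 := geo 0 (m + T)
    simp only [zero_add, pow_zero, div_one] at h0
    have : ∀ j : ℕ, (280 : ℝ) / 2 ^ j = 280 * (1 / 2 ^ j) := fun j => by ring
    simp_rw [this]
    rw [← Finset.mul_sum]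
    linarith
  have e : 560 * A / 2 ^ m = 280 * A * (2 / 2 ^ m) := by ring
  rw [e]
  generalize ∑ j ∈ Finset.range m, sqWaveSum N (x / 2 * 2 ^ j) = S
  rw [abs_le] at *
  constructor <;> linarith [c1.1, c1.2, c2.1, c2.2]

/-- The sum of the square wave over the first `n + 1` points of the doubling orbit of `x`. -/
noncomputable def orbitSum (x : ℝ) (n : ℕ) : ℝ := ∑ j ∈ Finset.range (n + 1), sqWave (x * 2 ^ j)

/-- The total effect at scale `2 ^ n` of the points of the doubling orbit close to integers. -/
noncomputable def orbitDefect (x : ℝ) (n : ℕ) : ℝ :=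
  ∑ j ∈ Finset.range (n + 1), min 1 (2 ^ j / 2 ^ n / distInt (x * 2 ^ j))

lemma log_le_of_le_two_pow {u : ℝ} (hu : 0 < u) {a : ℕ} (h : u ≤ 2 ^ a) : Real.log u ≤ a := by
  have h1 := Real.log_le_log hu h
  rw [Real.log_pow] at h1
  have h2 : Real.log 2 ≤ 1 := by linarith [Real.log_two_lt_d9]
  nlinarith [(a.cast_nonneg : (0 : ℝ) ≤ a)]

lemma two_mul_add_one_bounds {n N : ℕ} (h1 : 2 ^ n ≤ N) (h2 : N < 2 ^ (n + 1)) :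
    (2 : ℝ) * 2 ^ n ≤ 2 * N + 1 ∧ (2 * N + 1 : ℝ) ≤ 2 ^ (n + 2) := by
  have h1' : ((2 ^ n : ℕ) : ℝ) ≤ N := by exact_mod_cast h1
  have h2' : ((N + 1 : ℕ) : ℝ) ≤ ((2 ^ (n + 1) : ℕ) : ℝ) := by exact_mod_cast h2
  push_cast at h1' h2'
  rw [pow_succ] at h2'
  constructor
  · linarith
  · rw [pow_add]; linarith

lemma abs_sqWaveSum_sub_sqWave_le {x : ℝ} (hx : 1 ≤ x) (hx2 : x ≤ 2) {n N : ℕ} (h1 : 2 ^ n ≤ N)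
    (h2 : N < 2 ^ (n + 1)) {i : ℕ} (hi : i ≤ n) (hirr : Irrational (x * 2 ^ i)) :
    |sqWaveSum N (x * 2 ^ i) - sqWave (x * 2 ^ i)|
      ≤ 4 * min 1 (2 ^ i / 2 ^ n / distInt (x * 2 ^ i)) + 12 * (n + 4) / 2 ^ n * 2 ^ i := by
  obtain ⟨hN1, hN2⟩ := two_mul_add_one_bounds h1 h2
  have hX : 0 < x * 2 ^ i := by positivity
  have hd := distInt_pos hirr
  refine (abs_sqWaveSum_sub_le N hX hd (distInt_le _)).trans ?_
  have hq : 2 * (x * 2 ^ i) / (2 * N + 1) ≤ 2 * (2 ^ i / 2 ^ n) := by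
    have e : 2 * ((2 : ℝ) ^ i / 2 ^ n) = 2 * (2 * 2 ^ i) / (2 * 2 ^ n) := by
      field_simp
    rw [e]
    gcongr
  have hq' : 12 * (x * 2 ^ i) / (2 * N + 1) ≤ 12 * (2 ^ i / 2 ^ n) := by
    have e1 : 12 * (x * 2 ^ i) / (2 * N + 1) = 6 * (2 * (x * 2 ^ i) / (2 * N + 1)) := by ring
    rw [e1]; linarith
  have hlog : 1 + Real.log (2 * (x * 2 ^ i) + 1) ≤ n + 4 := by
    have : Real.log (2 * (x * 2 ^ i) + 1) ≤ (n + 3 : ℕ) := by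
      refine log_le_of_le_two_pow (by positivity) ?_
      have h3 : (2 : ℝ) ^ i ≤ 2 ^ n := pow_le_pow_right₀ (by norm_num) hi
      have h4 : (1 : ℝ) ≤ 2 ^ i := one_le_pow₀ (by norm_num)
      rw [pow_add]
      nlinarith
    push_cast at this
    linarith
  have hlog0 : 0 ≤ 1 + Real.log (2 * (x * 2 ^ i) + 1) := by
    have := Real.log_nonneg (by linarith : 1 ≤ 2 * (x * 2 ^ i) + 1)
    linarith
  refine add_le_add ?_ ?_
  · have : min 2 (2 * (x * 2 ^ i) / (2 * N + 1) / distInt (x * 2 ^ i))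
        ≤ 2 * min 1 (2 ^ i / 2 ^ n / distInt (x * 2 ^ i)) := by
      rw [mul_min_of_nonneg _ _ (by norm_num : (0 : ℝ) ≤ 2)]
      refine min_le_min (by norm_num) ?_
      rw [← mul_div_assoc]
      gcongr
    linarith
  · calc _ ≤ 12 * ((2 : ℝ) ^ i / 2 ^ n) * (n + 4) := mul_le_mul hq' hlog hlog0 (by positivity)
      _ = _ := by ring

lemma sum_two_pow_le (k : ℕ) : ∑ i ∈ Finset.range k, (2 : ℝ) ^ i ≤ 2 ^ k := by
  rw [geom_sum_eq (by norm_num)]; norm_num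

lemma abs_sub_orbitSum_le {x : ℝ} (hx : 1 ≤ x) (hx2 : x ≤ 2)
    (hirr : ∀ j : ℕ, Irrational (x * 2 ^ j)) (hirr' : Irrational (x / 2)) {δ K : ℝ} (hδ : 0 < δ)
    (hK : ∀ (N : ℕ) (X : ℝ), 2 ≤ X → |sqWaveSum N X| ≤ K + 4 * (2 * N + 1) / X + 2 * δ * Real.log X)
    {k s N : ℕ} (h1 : 2 ^ (k + s) ≤ N) (h2 : N < 2 ^ (k + s + 1)) {F : ℝ}
    (hF : Tendsto (fun T : ℕ => ∑ j ∈ Finset.range T,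
        (sqWaveSum N (x / 2 * 2 ^ j) - sqWaveSum 0 (x / 2 * 2 ^ j))) atTop (𝓝 F)) :
    |F - orbitSum x (k + s)| ≤ 4 * orbitDefect x (k + s) + 584 * ((k + s : ℕ) + 4) / 2 ^ s
      + 2 * s * (K + 2 ^ (s + 3) + 2 * δ * (2 * (k + s : ℕ) + 1)) + s / 2 + 601 := by
  obtain ⟨hN1, hN2⟩ := two_mul_add_one_bounds h1 h2
  set n := k + s with hn
  have hNpos : (0 : ℝ) < 2 * N + 1 := by positivity
  have hN1' : (1 : ℝ) ≤ 2 * N + 1 := by linarith [(N.cast_nonneg : (0 : ℝ) ≤ N)]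
  have hup : 560 * ((2 * N + 1) * (1 + Real.log (2 * N + 1))) / 2 ^ (1 + (k + 1 + 2 * s))
      ≤ 560 * (n + 4 : ℝ) / 2 ^ s := by
    have hl := log_le_of_le_two_pow hNpos hN2
    have hl0 := Real.log_nonneg hN1'
    push_cast at hl
    have e : 560 * (n + 4 : ℝ) / 2 ^ s
        = 560 * (2 ^ (n + 2) * (n + 4)) / 2 ^ (1 + (k + 1 + 2 * s)) := by
      rw [hn]; field_simp; ring
    rw [e]
    have hle : 1 + Real.log (2 * N + 1) ≤ n + 4 := by linarith
    have := mul_le_mul hN2 hle (by linarith) (by positivity)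
    exact div_le_div_of_nonneg_right (mul_le_mul_of_nonneg_left this (by norm_num)) (by positivity)
  have hU := abs_sub_sum_sqWaveSum_le hx N hF (1 + (k + 1 + 2 * s))
  rw [Finset.sum_range_add _ 1, Finset.sum_range_one] at hU
  have e0 : ∀ i, x / 2 * 2 ^ (1 + i) = x * 2 ^ i := fun i => by rw [pow_add]; ring
  simp only [e0, pow_zero, mul_one] at hU
  rw [Finset.sum_range_add] at hU
  have hfirst : |sqWaveSum N (x / 2)| ≤ 41 := by
    have h := abs_sqWaveSum_sub_le N (by linarith : 0 < x / 2) (distInt_pos hirr') (distInt_le _)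
    have hm : min 2 (2 * (x / 2) / (2 * N + 1) / distInt (x / 2)) ≤ 2 := min_le_left _ _
    have hd : 12 * (x / 2) / (2 * N + 1) ≤ 12 := by
      rw [div_le_iff₀ hNpos]; nlinarith
    have hl : Real.log (2 * (x / 2) + 1) ≤ (2 : ℕ) :=
      log_le_of_le_two_pow (by linarith) (by norm_num; linarith)
    have hl0 : 0 ≤ Real.log (2 * (x / 2) + 1) := Real.log_nonneg (by linarith)
    have hp : 12 * (x / 2) / (2 * N + 1) * (1 + Real.log (2 * (x / 2) + 1)) ≤ 12 * 3 := by
      push_cast at hl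
      exact mul_le_mul hd (by linarith) (by linarith) (by norm_num)
    have hr := abs_sqWave (x / 2)
    have := abs_sub_abs_le_abs_sub (sqWaveSum N (x / 2)) (sqWave (x / 2))
    linarith
  have hlow : |∑ i ∈ Finset.range (k + 1), (sqWaveSum N (x * 2 ^ i) - sqWave (x * 2 ^ i))|
      ≤ 4 * orbitDefect x n + 24 * (n + 4) / 2 ^ s := by
    refine (Finset.abs_sum_le_sum_abs _ _).trans ?_
    refine (Finset.sum_le_sum fun i hi => abs_sqWaveSum_sub_sqWave_le hx hx2 h1 h2
      (by have := Finset.mem_range.1 hi; omega) (hirr i)).trans ?_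
    rw [Finset.sum_add_distrib, ← Finset.mul_sum, ← Finset.mul_sum]
    refine add_le_add (mul_le_mul_of_nonneg_left ?_ (by norm_num)) ?_
    · refine Finset.sum_le_sum_of_subset_of_nonneg
        (Finset.range_subset_range.2 (by omega)) fun j _ _ => ?_
      have := (distInt_pos (hirr j)).le
      positivity
    · calc _ ≤ 12 * (n + 4 : ℝ) / 2 ^ n * 2 ^ (k + 1) :=
            mul_le_mul_of_nonneg_left (sum_two_pow_le _) (by positivity)
        _ = _ := by rw [hn]; field_simp; ring
  have hwin : |∑ i ∈ Finset.range (2 * s), sqWaveSum N (x * 2 ^ (k + 1 + i))|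
      ≤ 2 * s * (K + 2 ^ (s + 3) + 2 * δ * (2 * n + 1)) := by
    refine (Finset.abs_sum_le_sum_abs _ _).trans ?_
    have : ∀ i ∈ Finset.range (2 * s), |sqWaveSum N (x * 2 ^ (k + 1 + i))|
        ≤ K + 2 ^ (s + 3) + 2 * δ * (2 * n + 1) := by
      intro i hi
      have hi := Finset.mem_range.1 hi
      have hp : (2 : ℝ) ^ (k + 1) ≤ 2 ^ (k + 1 + i) := pow_le_pow_right₀ (by norm_num) (by omega)
      have hp2 : (2 : ℝ) ≤ 2 ^ (k + 1) := by
        rw [pow_succ]; linarith [(one_le_pow₀ (by norm_num) : (1 : ℝ) ≤ 2 ^ k)]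
      have hX : (2 : ℝ) ^ (k + 1) ≤ x * 2 ^ (k + 1 + i) := by nlinarith
      refine (hK N _ (by linarith)).trans ?_
      have hl : Real.log (x * 2 ^ (k + 1 + i)) ≤ (k + 1 + i + 1 : ℕ) := by
        refine log_le_of_le_two_pow (by linarith) ?_
        rw [pow_succ _ (k + 1 + i), mul_comm]
        gcongr
      have hl2 : ((k + 1 + i + 1 : ℕ) : ℝ) ≤ 2 * n + 1 := by
        have : k + 1 + i + 1 ≤ 2 * n + 1 := by omega
        exact_mod_cast this
      have hq : 4 * (2 * N + 1) / (x * 2 ^ (k + 1 + i)) ≤ 2 ^ (s + 3) := by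
        calc _ ≤ 4 * (2 : ℝ) ^ (n + 2) / 2 ^ (k + 1) := by gcongr
          _ = _ := by rw [hn]; field_simp; ring
      have := mul_le_mul_of_nonneg_left (hl.trans hl2) (by linarith : 0 ≤ 2 * δ)
      linarith
    refine (Finset.sum_le_sum this).trans (le_of_eq ?_)
    simp only [Finset.sum_const, Finset.card_range, nsmul_eq_mul]
    push_cast
    ring
  have htail : |∑ i ∈ Finset.range s, sqWave (x * 2 ^ (k + 1 + i))| ≤ s / 2 := by
    refine (Finset.abs_sum_le_sum_abs _ _).trans ?_
    simp only [abs_sqWave, Finset.sum_const, Finset.card_range, nsmul_eq_mul]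
    linarith
  have hE : orbitSum x n = ∑ i ∈ Finset.range (k + 1), sqWave (x * 2 ^ i)
      + ∑ i ∈ Finset.range s, sqWave (x * 2 ^ (k + 1 + i)) := by
    rw [orbitSum, ← Finset.sum_range_add]; congr 2; omega
  rw [hE]
  rw [Finset.sum_sub_distrib] at hlow
  have e2 : 584 * ((n : ℝ) + 4) / 2 ^ s = 560 * (n + 4 : ℝ) / 2 ^ s + 24 * (n + 4) / 2 ^ s := by ring
  rw [e2]
  rw [abs_le] at *
  constructor <;> linarith [hU.1, hU.2, hfirst.1, hfirst.2, hlow.1, hlow.2, hwin.1, hwin.2,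
    htail.1, htail.2]

lemma exists_abs_sub_orbitSum_le {x : ℝ} (hx : 1 ≤ x) (hx2 : x ≤ 2)
    (hirr : ∀ j : ℕ, Irrational (x * 2 ^ j)) (hirr' : Irrational (x / 2)) {ε : ℝ} (hε : 0 < ε) :
    ∃ (C : ℝ) (n₀ : ℕ), ∀ n, n₀ ≤ n → ∀ N : ℕ, 2 ^ n ≤ N → N < 2 ^ (n + 1) → ∀ F : ℝ,
      Tendsto (fun T : ℕ => ∑ j ∈ Finset.range T,
        (sqWaveSum N (x / 2 * 2 ^ j) - sqWaveSum 0 (x / 2 * 2 ^ j))) atTop (𝓝 F) →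
      |F - orbitSum x n| ≤ ε * n + C + 4 * orbitDefect x n := by
  obtain ⟨s, hs⟩ : ∃ s : ℕ, 584 * (1 / 2 : ℝ) ^ s < ε / 2 := by
    obtain ⟨s, hs⟩ := exists_pow_lt_of_lt_one (by positivity : 0 < ε / 1168)
      (by norm_num : (1 / 2 : ℝ) < 1)
    exact ⟨s, by linarith⟩
  set δ : ℝ := min 1 (ε / (16 * (s + 1))) with hδ
  have hδ0 : 0 < δ := by positivity
  have hδ2 : δ * (16 * (s + 1)) ≤ ε := by
    rw [← le_div_iff₀ (by positivity)]; exact min_le_right _ _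
  obtain ⟨K, hK0, hK⟩ := exists_abs_sqWaveSum_le hδ0 (min_le_left _ _)
  refine ⟨584 * 4 / 2 ^ s + 2 * s * (K + 2 ^ (s + 3) + 2 * δ) + s / 2 + 601, s,
    fun n hn N h1 h2 F hF => ?_⟩
  obtain ⟨k, rfl⟩ := Nat.exists_eq_add_of_le' hn
  refine (abs_sub_orbitSum_le hx hx2 hirr hirr' hδ0 hK h1 h2 hF).trans ?_
  set n := k + s
  have hn0 : (0 : ℝ) ≤ n := n.cast_nonneg
  have a1 : 584 * ((n : ℝ) + 4) / 2 ^ s = 584 * (1 / 2) ^ s * n + 584 * 4 / 2 ^ s := by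
    rw [one_div, inv_pow]; ring
  have a2 : 584 * (1 / 2 : ℝ) ^ s * n ≤ ε / 2 * n := by gcongr
  have a3 : 8 * (s * δ) * n ≤ ε / 2 * n := by
    refine mul_le_mul_of_nonneg_right ?_ hn0
    nlinarith
  rw [a1]
  linarith

lemma round_two_mul {u : ℝ} (h : distInt u < 1 / 4) : round (2 * u) = 2 * round u := by
  rw [distInt, abs_lt] at h
  rw [round_eq, Int.floor_eq_iff]
  push_cast
  constructor <;> linarith [h.1, h.2]

lemma sub_round_orbit {x : ℝ} {a : ℕ} (d : ℕ)
    (h : ∀ j, a ≤ j → j < a + d → distInt (x * 2 ^ j) < 1 / 4) :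
    x * 2 ^ (a + d) - round (x * 2 ^ (a + d)) = 2 ^ d * (x * 2 ^ a - round (x * 2 ^ a)) := by
  induction d with
  | zero => simp
  | succ d ih =>
    have e : x * 2 ^ (a + (d + 1)) = 2 * (x * 2 ^ (a + d)) := by rw [← add_assoc, pow_succ]; ring
    rw [e, round_two_mul (h _ (by omega) (by omega)), pow_succ]
    push_cast
    linear_combination 2 * ih (fun j h1 h2 => h j h1 (by omega))

lemma sqWave_two_mul {u : ℝ} (hu : Irrational u) (h : distInt u < 1 / 4) :
    sqWave (2 * u) = if u - round u < 0 then 1 / 2 else -(1 / 2) := by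
  rw [distInt, abs_lt] at h
  have hne : u - round u ≠ 0 := sub_ne_zero.2 (hu.ne_int _)
  split_ifs with h0
  · have : ⌊2 * u⌋ = 2 * (round u - 1) + 1 := by
      rw [Int.floor_eq_iff]; push_cast; constructor <;> linarith [h.1]
    rw [sqWave, this, if_pos (odd_two_mul_add_one _)]
  · have : ⌊2 * u⌋ = 2 * round u := by
      have := lt_of_le_of_ne (not_lt.1 h0) hne.symm
      rw [Int.floor_eq_iff]; push_cast; constructor <;> linarith [h.2]
    rw [sqWave, this, if_neg (by simp)]

lemma orbitSum_succ (x : ℝ) (n : ℕ) : orbitSum x (n + 1) = orbitSum x n + sqWave (x * 2 ^ (n + 1)) :=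
  Finset.sum_range_succ _ _

lemma abs_orbitSum_sub_le (x : ℝ) (a d : ℕ) : |orbitSum x (a + d) - orbitSum x a| ≤ d / 2 := by
  induction d with
  | zero => simp
  | succ d ih =>
    have h := abs_sqWave (x * 2 ^ (a + d + 1))
    rw [← add_assoc, orbitSum_succ]
    push_cast
    have := abs_add_le (orbitSum x (a + d) - orbitSum x a) (sqWave (x * 2 ^ (a + d + 1)))
    have e : orbitSum x (a + d) + sqWave (x * 2 ^ (a + d + 1)) - orbitSum x a
      = orbitSum x (a + d) - orbitSum x a + sqWave (x * 2 ^ (a + d + 1)) := by ring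
    rw [e]
    linarith

lemma abs_orbitSum_sub_eq {x : ℝ} (hirr : ∀ j : ℕ, Irrational (x * 2 ^ j)) {a : ℕ} (d : ℕ)
    (h : ∀ j, a ≤ j → j < a + d → distInt (x * 2 ^ j) < 1 / 4) :
    |orbitSum x (a + d) - orbitSum x a| = d / 2 := by
  have key : orbitSum x (a + d) - orbitSum x a
      = d * (if x * 2 ^ a - round (x * 2 ^ a) < 0 then 1 / 2 else -(1 / 2)) := by
    induction d with
    | zero => simp
    | succ d ih =>
      have e : x * 2 ^ (a + d + 1) = 2 * (x * 2 ^ (a + d)) := by rw [pow_succ]; ring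
      have h1 := ih fun j h1 h2 => h j h1 (by omega)
      have h2 := sub_round_orbit d fun j h1 h2 => h j h1 (by omega)
      have h3 : x * 2 ^ (a + d) - round (x * 2 ^ (a + d)) < 0
          ↔ x * 2 ^ a - round (x * 2 ^ a) < 0 := by
        rw [h2]
        exact ⟨fun h => by
          by_contra h'
          exact absurd (mul_nonneg (by positivity) (not_lt.1 h')) (not_le.2 h),
          fun h => mul_neg_of_pos_of_neg (by positivity) h⟩
      rw [← add_assoc, orbitSum_succ, e, sqWave_two_mul (hirr _) (h _ (by omega) (by omega))]
      simp only [h3]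
      push_cast
      linear_combination h1
  rw [key, abs_mul, Nat.abs_cast]
  split_ifs <;> norm_num [abs_of_pos] <;> ring

lemma exists_le_distInt {x : ℝ} (hirr : ∀ j : ℕ, Irrational (x * 2 ^ j)) (a : ℕ) :
    ∃ i, a ≤ i ∧ 1 / 4 ≤ distInt (x * 2 ^ i) := by
  by_contra! hcon
  have hp := distInt_pos (hirr a)
  obtain ⟨d, hd⟩ := pow_unbounded_of_one_lt (1 / distInt (x * 2 ^ a)) (by norm_num : (1 : ℝ) < 2)
  have h1 := sub_round_orbit d fun j h1 _ => hcon j h1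
  have h2 := hcon (a + d) (by omega)
  rw [distInt, h1, abs_mul, abs_of_pos (by positivity : (0 : ℝ) < 2 ^ d)] at h2
  rw [div_lt_iff₀ hp, distInt] at hd
  linarith

lemma distInt_two_pow_le (u : ℝ) (d : ℕ) : distInt (u * 2 ^ d) ≤ 2 ^ d * distInt u := by
  have := distInt_le (u * 2 ^ d) (round u * 2 ^ d)
  push_cast at this
  rw [← sub_mul, abs_mul, abs_of_pos (by positivity : (0 : ℝ) < 2 ^ d)] at this
  rw [mul_comm (2 ^ d)]
  exact this

lemma orbitDefect_le {x : ℝ} (hirr : ∀ j : ℕ, Irrational (x * 2 ^ j)) {i : ℕ} (t : ℕ)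
    (hi : 1 / 4 ≤ distInt (x * 2 ^ i)) :
    orbitDefect x (i + t) ≤ 4 * (i + 1) / 2 ^ t + t := by
  have e : i + t + 1 = (i + 1) + t := by ring
  rw [orbitDefect, e, Finset.sum_range_add]
  refine add_le_add ?_ ?_
  · have : ∀ j ∈ Finset.range (i + 1), min 1 (2 ^ j / 2 ^ (i + t) / distInt (x * 2 ^ j))
        ≤ 4 / 2 ^ t := by
      intro j hj
      have hj := Finset.mem_range.1 hj
      obtain ⟨d, rfl⟩ := Nat.exists_eq_add_of_le (by omega : j ≤ i)
      refine (min_le_right _ _).trans ?_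
      have h1 := distInt_two_pow_le (x * 2 ^ j) d
      rw [mul_assoc, ← pow_add] at h1
      have h2 : 1 ≤ 4 * (2 ^ d * distInt (x * 2 ^ j)) := by linarith
      rw [div_le_iff₀ (distInt_pos (hirr j))]
      calc (2 : ℝ) ^ j / 2 ^ (j + d + t) = 1 / 2 ^ (d + t) := by rw [add_assoc, pow_add]; field_simp
        _ ≤ 4 * (2 ^ d * distInt (x * 2 ^ j)) / 2 ^ (d + t) := by gcongr
        _ = _ := by rw [pow_add]; field_simp
    refine (Finset.sum_le_sum this).trans (le_of_eq ?_)
    simp only [Finset.sum_const, Finset.card_range, nsmul_eq_mul]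
    push_cast
    ring
  · refine (Finset.sum_le_sum fun j _ => min_le_left _ _).trans (le_of_eq ?_)
    simp

lemma orbitDefect_le_of_le {x : ℝ} (hirr : ∀ j : ℕ, Irrational (x * 2 ^ j)) {i t : ℕ} {η : ℝ}
    (hη : 0 < η) (hi1 : 1 ≤ i) (ht : η * i ≤ t) (hi : 1 / 4 ≤ distInt (x * 2 ^ i)) :
    orbitDefect x (i + t) ≤ 8 / η + t := by
  refine (orbitDefect_le hirr t hi).trans (add_le_add ?_ le_rfl)
  have h1 : (t : ℝ) ≤ 2 ^ t := by exact_mod_cast Nat.lt_two_pow_self.le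
  have h2 : (1 : ℝ) ≤ i := by exact_mod_cast hi1
  rw [div_le_div_iff₀ (by positivity) hη]
  nlinarith

lemma eventually_le_mul_of_exists_add {u : ℕ → ℝ}
    (h : ∀ ε : ℝ, 0 < ε → ε ≤ 1 → ∃ C, ∀ᶠ n : ℕ in atTop, u n ≤ ε * n + C) {ε : ℝ} (hε : 0 < ε) :
    ∀ᶠ n : ℕ in atTop, u n ≤ ε * n := by
  obtain ⟨C, hC⟩ := h (min 1 (ε / 2)) (by positivity) (min_le_left _ _)
  filter_upwards [hC, tendsto_natCast_atTop_atTop.eventually_ge_atTop (2 * C / ε)] with n h1 h2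
  rw [div_le_iff₀ hε] at h2
  have : min 1 (ε / 2) * (n : ℝ) ≤ ε / 2 * n := by gcongr; exact min_le_right _ _
  linarith

lemma orbitDefect_isLittleO {x : ℝ} (hirr : ∀ j : ℕ, Irrational (x * 2 ^ j))
    (hE : ∀ ε : ℝ, 0 < ε → ∀ᶠ n : ℕ in atTop, |orbitSum x n| ≤ ε * n) {ε : ℝ} (hε : 0 < ε) :
    ∀ᶠ n : ℕ in atTop, orbitDefect x n ≤ ε * n := by
  refine eventually_le_mul_of_exists_add (fun ε hε hε1 => ?_) hε
  set η := ε / 16 with hη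
  have hη0 : 0 < η := by positivity
  refine ⟨8 / η + 2, ?_⟩
  obtain ⟨m₀, hm⟩ := eventually_atTop.1 (hE η hη0)
  filter_upwards [tendsto_natCast_atTop_atTop.eventually_ge_atTop (4 * ((m₀ : ℝ) + 3))] with n hn
  set t := ⌊4 * η * n⌋₊ + 1 with ht
  have hn0 : (0 : ℝ) ≤ n := n.cast_nonneg
  have ht1 : 4 * η * n < t := by rw [ht]; push_cast; exact Nat.lt_floor_add_one _
  have ht2 : (t : ℝ) ≤ 4 * η * n + 1 := by
    rw [ht]; push_cast; linarith [Nat.floor_le (by positivity : 0 ≤ 4 * η * n)]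
  have ht3 : 2 * t + m₀ + 1 ≤ n := by
    have : (2 * t + m₀ + 1 : ℝ) ≤ n := by nlinarith
    exact_mod_cast this
  clear_value t
  clear ht
  obtain ⟨a, rfl⟩ := Nat.exists_eq_add_of_le' (by omega : 2 * t ≤ n)
  have hbad : ∃ i, a ≤ i ∧ i < a + t ∧ 1 / 4 ≤ distInt (x * 2 ^ i) := by
    by_contra! hcon
    have h1 := abs_orbitSum_sub_eq hirr t hcon
    have h2 := hm a (by omega)
    have h3 := hm (a + t) (by omega)
    have h4 := abs_sub (orbitSum x (a + t)) (orbitSum x a)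
    have h5 : η * (a + t : ℕ) ≤ η * (a + 2 * t : ℕ) := by gcongr; omega
    have h6 : η * a ≤ η * (a + 2 * t : ℕ) := by gcongr; omega
    linarith
  obtain ⟨i, hai, hia, hi⟩ := hbad
  obtain ⟨r, hr⟩ := Nat.exists_eq_add_of_le (by omega : i ≤ a + 2 * t)
  have htr : t ≤ r := by omega
  have hr2 : r ≤ 2 * t := by omega
  have hin : (i : ℝ) ≤ (a + 2 * t : ℕ) := by exact_mod_cast (by omega : i ≤ a + 2 * t)
  have htr' : (t : ℝ) ≤ r := by exact_mod_cast htr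
  have hr2' : (r : ℝ) ≤ 2 * t := by exact_mod_cast hr2
  have h1 := orbitDefect_le_of_le (t := r) hirr hη0 (by omega) (by nlinarith) hi
  rw [← hr] at h1
  have h2 : 8 * η * (a + 2 * t : ℕ) ≤ ε * (a + 2 * t : ℕ) :=
    mul_le_mul_of_nonneg_right (by linarith) hn0
  linarith

lemma orbitSum_le_of_distInt {x : ℝ} (hirr : ∀ j : ℕ, Irrational (x * 2 ^ j))
    (h : ∀ ε : ℝ, 0 < ε → ∃ C, ∀ᶠ n : ℕ in atTop, |orbitSum x n| ≤ ε * n + C + 4 * orbitDefect x n)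
    {ε : ℝ} (hε : 0 < ε) (hε1 : ε ≤ 1) :
    ∃ C, ∀ᶠ i : ℕ in atTop, 1 / 4 ≤ distInt (x * 2 ^ i) → |orbitSum x i| ≤ ε * i + C := by
  set η := ε / 16 with hη
  have hη0 : 0 < η := by positivity
  obtain ⟨C, hC⟩ := h η hη0
  obtain ⟨m₀, hm⟩ := eventually_atTop.1 hC
  refine ⟨C + 4 * (8 / η) + 6, ?_⟩
  filter_upwards [eventually_ge_atTop (m₀ + 1)] with i hi hd
  set t := ⌊η * i⌋₊ + 1 with ht
  have hi0 : (0 : ℝ) ≤ i := i.cast_nonneg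
  have ht1 : η * i < t := by rw [ht]; push_cast; exact Nat.lt_floor_add_one _
  have ht2 : (t : ℝ) ≤ η * i + 1 := by
    rw [ht]; push_cast; linarith [Nat.floor_le (by positivity : 0 ≤ η * i)]
  have h1 := orbitDefect_le_of_le hirr hη0 (by omega) ht1.le hd
  have h2 := hm (i + t) (by omega)
  have h3 := abs_orbitSum_sub_le x i t
  have h4 := abs_sub_abs_le_abs_sub (orbitSum x i) (orbitSum x (i + t))
  rw [abs_sub_comm] at h4
  push_cast at h2
  have h5 : η * (i + t) ≤ η * i + t := by nlinarith [(t.cast_nonneg : (0 : ℝ) ≤ t)]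
  nlinarith

lemma orbitSum_isLittleO {x : ℝ} (hirr : ∀ j : ℕ, Irrational (x * 2 ^ j))
    (h : ∀ ε : ℝ, 0 < ε → ∃ C, ∀ᶠ n : ℕ in atTop, |orbitSum x n| ≤ ε * n + C + 4 * orbitDefect x n)
    {ε : ℝ} (hε : 0 < ε) : ∀ᶠ n : ℕ in atTop, |orbitSum x n| ≤ ε * n := by
  refine eventually_le_mul_of_exists_add (fun ε hε hε1 => ?_) hε
  set η := ε / 8 with hη
  have hη0 : 0 < η := by positivity
  obtain ⟨C, hC⟩ := orbitSum_le_of_distInt hirr h hη0 (by linarith)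
  obtain ⟨m₀, hm⟩ := eventually_atTop.1 hC
  refine ⟨5 * C + 2, ?_⟩
  obtain ⟨i₀, hi₀, hd₀⟩ := exists_le_distInt hirr m₀
  filter_upwards [eventually_ge_atTop i₀] with n hn
  classical
  obtain ⟨i, hmi, hin, hdi, hmax⟩ : ∃ i, m₀ ≤ i ∧ i ≤ n ∧ 1 / 4 ≤ distInt (x * 2 ^ i) ∧
      ∀ j, i < j → j ≤ n → distInt (x * 2 ^ j) < 1 / 4 := by
    let Q : ℕ → Prop := fun i => 1 / 4 ≤ distInt (x * 2 ^ i)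
    refine ⟨Nat.findGreatest Q n, hi₀.trans (Nat.le_findGreatest hn hd₀), Nat.findGreatest_le n,
      Nat.findGreatest_spec (P := Q) hn hd₀, fun j h1 h2 => ?_⟩
    exact not_le.1 (Nat.findGreatest_is_greatest (P := Q) h1 h2)
  obtain ⟨i', hni', hdi', hmin⟩ : ∃ i', n < i' ∧ 1 / 4 ≤ distInt (x * 2 ^ i') ∧
      ∀ j, n < j → j < i' → distInt (x * 2 ^ j) < 1 / 4 := by
    have hex : ∃ i, n + 1 ≤ i ∧ 1 / 4 ≤ distInt (x * 2 ^ i) := exists_le_distInt hirr (n + 1)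
    refine ⟨Nat.find hex, (Nat.find_spec hex).1, (Nat.find_spec hex).2, fun j h1 h2 => ?_⟩
    have := Nat.find_min hex h2
    push Not at this
    exact this h1
  obtain ⟨d, rfl⟩ := Nat.exists_eq_add_of_le (by omega : i + 1 ≤ i')
  obtain ⟨r, rfl⟩ := Nat.exists_eq_add_of_le hin
  have h1 := abs_orbitSum_sub_eq hirr (a := i + 1) d fun j h1 h2 => by
    by_cases hj : j ≤ i + r
    · exact hmax j (by omega) hj
    · exact hmin j (by omega) h2
  have h2 := hm i hmi hdi
  have h3 := hm (i + 1 + d) (by omega) hdi'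
  have h4 := abs_orbitSum_sub_le x i 1
  have h5 := abs_orbitSum_sub_le x i r
  have hrd : (r : ℝ) ≤ d := by exact_mod_cast (by omega : r ≤ d)
  have hi0 : (0 : ℝ) ≤ i := i.cast_nonneg
  have hr0 : (0 : ℝ) ≤ r := r.cast_nonneg
  push_cast at h3 h4 ⊢
  have h6 : (d : ℝ) / 2 ≤ η * (i + 1 + d) + C + (η * i + C) + 1 / 2 := by
    rw [← h1]
    have a1 := abs_add_le (orbitSum x (i + 1 + d) - orbitSum x i) (orbitSum x i - orbitSum x (i + 1))
    have a2 := abs_sub (orbitSum x (i + 1 + d)) (orbitSum x i)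
    rw [abs_sub_comm (orbitSum x i)] at a1
    rw [sub_add_sub_cancel] at a1
    linarith
  have h7 : |orbitSum x (i + r)| ≤ η * i + C + r / 2 := by
    have := abs_sub_abs_le_abs_sub (orbitSum x (i + r)) (orbitSum x i)
    linarith
  nlinarith

lemma tendsto_div_zero_iff_orbitSum {x : ℝ} (hx : 1 ≤ x) (hx2 : x ≤ 2)
    (hirr : ∀ j : ℕ, Irrational (x * 2 ^ j)) (hirr' : Irrational (x / 2)) {F : ℕ → ℝ}
    (hF : ∀ N, Tendsto (fun T : ℕ => ∑ j ∈ Finset.range T,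
        (sqWaveSum N (x / 2 * 2 ^ j) - sqWaveSum 0 (x / 2 * 2 ^ j))) atTop (𝓝 (F N))) :
    Tendsto (fun l : ℝ => F ⌊(2 : ℝ) ^ l⌋₊ / l) atTop (𝓝 0) ↔
      ∀ ε : ℝ, 0 < ε → ∀ᶠ n : ℕ in atTop, |orbitSum x n| ≤ ε * n := by
  constructor
  · intro h ε hε
    refine orbitSum_isLittleO hirr (fun ε hε => ?_) hε
    obtain ⟨C, n₀, hC⟩ := exists_abs_sub_orbitSum_le hx hx2 hirr hirr' (half_pos hε)
    have h1 := h.comp tendsto_natCast_atTop_atTop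
    have h2 := (Metric.tendsto_nhds.1 h1) (ε / 2) (half_pos hε)
    refine ⟨C, ?_⟩
    filter_upwards [h2, eventually_ge_atTop n₀, eventually_gt_atTop 0] with n hn hn₀ hpos
    have e : ⌊(2 : ℝ) ^ (n : ℝ)⌋₊ = 2 ^ n := by
      rw [Real.rpow_natCast]; exact_mod_cast Nat.floor_natCast (R := ℝ) (2 ^ n)
    have hn' : (0 : ℝ) < n := by exact_mod_cast hpos
    rw [Function.comp_apply, e, Real.dist_eq, sub_zero, abs_div, abs_of_pos hn',
      div_lt_iff₀ hn'] at hn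
    have h3 := hC n hn₀ (2 ^ n) le_rfl (Nat.pow_lt_pow_right (by norm_num) (by omega)) _ (hF _)
    have h4 := abs_sub_abs_le_abs_sub (orbitSum x n) (F (2 ^ n))
    rw [abs_sub_comm] at h4
    linarith
  · intro h
    rw [Metric.tendsto_nhds]
    intro ε hε
    obtain ⟨C, n₀, hC⟩ := exists_abs_sub_orbitSum_le hx hx2 hirr hirr'
      (by positivity : 0 < ε / 16)
    have h1 := h (ε / 16) (by positivity)
    have h2 := orbitDefect_isLittleO hirr h (by positivity : 0 < ε / 16)
    have h3 := tendsto_nat_floor_atTop (α := ℝ)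
    filter_upwards [h3.eventually h1, h3.eventually h2, h3.eventually_ge_atTop n₀,
      eventually_gt_atTop 0, eventually_gt_atTop (2 * C / ε)] with l l1 l2 l3 l4 l5
    have h4 := Nat.floor_le l4.le
    have h5 := Nat.lt_floor_add_one l
    set n := ⌊l⌋₊
    have b1 : 2 ^ n ≤ ⌊(2 : ℝ) ^ l⌋₊ := by
      refine Nat.le_floor ?_
      push_cast
      rw [← Real.rpow_natCast]
      exact Real.rpow_le_rpow_of_exponent_le (by norm_num) h4
    have b2 : ⌊(2 : ℝ) ^ l⌋₊ < 2 ^ (n + 1) := by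
      rw [Nat.floor_lt (by positivity)]
      push_cast
      rw [← Real.rpow_natCast]
      exact Real.rpow_lt_rpow_of_exponent_lt (by norm_num) (by push_cast; exact h5)
    have h6 := hC n l3 _ b1 b2 _ (hF _)
    have h7 := abs_sub_abs_le_abs_sub (F ⌊(2 : ℝ) ^ l⌋₊) (orbitSum x n)
    rw [Real.dist_eq, sub_zero, abs_div, abs_of_pos l4, div_lt_iff₀ l4]
    rw [div_lt_iff₀ hε] at l5
    have h8 : ε * n ≤ ε * l := mul_le_mul_of_nonneg_left h4 hε.le
    linarith [mul_pos hε l4]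

open scoped Classical in
lemma card_odd_floor_eq (x : ℝ) (n : ℕ) :
    (((Finset.range (n + 1)).filter (fun d => Odd ⌊(2 : ℝ) ^ d * x⌋)).card : ℝ)
      = orbitSum x n + (n + 1) / 2 := by
  rw [Finset.card_filter]
  push_cast
  have : ((n : ℝ) + 1) / 2 = ∑ d ∈ Finset.range (n + 1), (1 / 2 : ℝ) := by simp; ring
  rw [this, orbitSum, ← Finset.sum_add_distrib]
  refine Finset.sum_congr rfl fun d _ => ?_
  rw [mul_comm x, sqWave]
  split_ifs <;> norm_num

lemma tendsto_add_half_iff {E : ℕ → ℝ} :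
    Tendsto (fun l : ℝ => (E ⌊l⌋₊ + ((⌊l⌋₊ : ℝ) + 1) / 2) / l) atTop (𝓝 (1 / 2)) ↔
      ∀ ε : ℝ, 0 < ε → ∀ᶠ n : ℕ in atTop, |E n| ≤ ε * n := by
  constructor
  · intro h ε hε
    have h2 := (Metric.tendsto_nhds.1 (h.comp tendsto_natCast_atTop_atTop)) (ε / 2) (half_pos hε)
    filter_upwards [h2, eventually_gt_atTop 0,
      tendsto_natCast_atTop_atTop.eventually_ge_atTop (1 / ε)] with n h1 h2 h3
    have hn' : (0 : ℝ) < n := by exact_mod_cast h2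
    rw [Function.comp_apply, Nat.floor_natCast, Real.dist_eq, div_sub' hn'.ne', abs_div,
      abs_of_pos hn', div_lt_iff₀ hn', abs_lt] at h1
    rw [div_le_iff₀ hε] at h3
    rw [abs_le]
    constructor <;> linarith [h1.1, h1.2]
  · intro h
    rw [Metric.tendsto_nhds]
    intro ε hε
    filter_upwards [(tendsto_nat_floor_atTop (α := ℝ)).eventually (h (ε / 2) (half_pos hε)),
      eventually_gt_atTop 0, eventually_gt_atTop (2 / ε)] with l l1 l2 l3
    have h4 := Nat.floor_le l2.le
    have h5 := Nat.lt_floor_add_one l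
    rw [Real.dist_eq, div_sub' l2.ne', abs_div, abs_of_pos l2, div_lt_iff₀ l2, abs_lt]
    rw [div_lt_iff₀ hε] at l3
    have h8 : ε * (⌊l⌋₊ : ℝ) ≤ ε * l := mul_le_mul_of_nonneg_left h4 hε.le
    rw [abs_le] at l1
    constructor <;> linarith [l1.1, l1.2]

lemma irrational_two_rpow_div {p q : ℕ} (hpq : p < q) (hp : 1 ≤ p) :
    Irrational ((2 : ℝ) ^ ((p : ℝ) / q)) := by
  have hq : (0 : ℝ) < q := by exact_mod_cast (by omega : 0 < q)
  refine irrational_nrt_of_notint_nrt q (2 ^ p) ?_ ?_ (by omega)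
  · rw [← Real.rpow_natCast, ← Real.rpow_mul (by norm_num), div_mul_cancel₀ _ hq.ne',
      Real.rpow_natCast]
    push_cast
    rfl
  · rintro ⟨z, hz⟩
    have h1 : (1 : ℝ) < 2 ^ ((p : ℝ) / q) := Real.one_lt_rpow (by norm_num) (by positivity)
    have h2 : (2 : ℝ) ^ ((p : ℝ) / q) < 2 ^ (1 : ℝ) := by
      refine Real.rpow_lt_rpow_of_exponent_lt (by norm_num) ?_
      rw [div_lt_one (by positivity)]
      exact_mod_cast hpq
    rw [Real.rpow_one] at h2
    rw [hz] at h1 h2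
    have h1' : 1 < z := by exact_mod_cast h1
    have h2' : z < 2 := by exact_mod_cast h2
    omega

end

open Complex Filter

open scoped Classical

/-- `lim_{l→∞} (1/l) ∑_{0<|n|≤2^l} ζ(2nπi/log 2) e^{2nπi p/q}/n = 0`
if and only if `2^{p/q}` is simply normal to base 2, i.e.
`A₂(l; 1, 2^{p/q})/l → 1/2` where `A₂(l; 1, 2^{p/q})` counts `0 ≤ d ≤ l` with
`⌊2^d · 2^{p/q}⌋` odd. -/
theorem stmt_19 (p q : ℕ) (hcop : Nat.Coprime p q) (hp : 1 ≤ p) (hpq : p < q) :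
    Tendsto
      (fun l : ℝ =>
        (1 / (l : ℂ)) *
          ∑ n ∈ (Finset.Icc (-⌊(2 : ℝ) ^ l⌋) ⌊(2 : ℝ) ^ l⌋).erase 0,
            riemannZeta (2 * (n : ℂ) * (Real.pi : ℂ) * I / (Real.log 2 : ℂ)) *
              Complex.exp (2 * (n : ℂ) * (Real.pi : ℂ) * I * (p : ℂ) / (q : ℂ)) / (n : ℂ))
      atTop (nhds 0) ↔
    Tendsto
      (fun l : ℝ =>
        (((Finset.range (⌊l⌋₊ + 1)).filter
              (fun d => Odd ⌊(2 : ℝ) ^ d * (2 : ℝ) ^ ((p : ℝ) / (q : ℝ))⌋)).card : ℝ) / l)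
      atTop (nhds (1 / 2)) := by
  have hq : (0 : ℝ) < q := by exact_mod_cast (by omega : 0 < q)
  have hy1 : (p : ℝ) / q ≤ 1 := by rw [div_le_one hq]; exact_mod_cast hpq.le
  have hx1 : (1 : ℝ) ≤ 2 ^ ((p : ℝ) / q) := Real.one_le_rpow (by norm_num) (by positivity)
  have hx2 : (2 : ℝ) ^ ((p : ℝ) / q) ≤ 2 := by
    simpa using Real.rpow_le_rpow_of_exponent_le (by norm_num : (1 : ℝ) ≤ 2) hy1
  have hirr := irrational_two_rpow_div hpq hp
  choose F hF1 hF2 using fun N => exists_zetaSum_eq (by linarith : (p : ℝ) / q ≤ 3 / 2) N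
  have key := tendsto_div_zero_iff_orbitSum hx1 hx2
    (fun j => by exact_mod_cast hirr.mul_natCast (m := 2 ^ j) (by positivity))
    (by exact_mod_cast hirr.div_natCast (m := 2) (by norm_num)) hF2
  have hleft : ∀ l : ℝ, (1 / (l : ℂ)) *
          ∑ n ∈ (Finset.Icc (-⌊(2 : ℝ) ^ l⌋) ⌊(2 : ℝ) ^ l⌋).erase 0,
            riemannZeta (2 * (n : ℂ) * (Real.pi : ℂ) * I / (Real.log 2 : ℂ)) *
              Complex.exp (2 * (n : ℂ) * (Real.pi : ℂ) * I * (p : ℂ) / (q : ℂ)) / (n : ℂ)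
      = -(2 * Real.pi * I) * ((F ⌊(2 : ℝ) ^ l⌋₊ / l : ℝ) : ℂ) := by
    intro l
    have e : ⌊(2 : ℝ) ^ l⌋ = (⌊(2 : ℝ) ^ l⌋₊ : ℤ) := by
      rw [Int.natCast_floor_eq_floor (by positivity)]
    have h := hF1 ⌊(2 : ℝ) ^ l⌋₊
    rw [← e] at h
    have h' : ∑ n ∈ (Finset.Icc (-⌊(2 : ℝ) ^ l⌋) ⌊(2 : ℝ) ^ l⌋).erase 0,
            riemannZeta (2 * (n : ℂ) * (Real.pi : ℂ) * I / (Real.log 2 : ℂ)) *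
              Complex.exp (2 * (n : ℂ) * (Real.pi : ℂ) * I * (p : ℂ) / (q : ℂ)) / (n : ℂ)
        = -(2 * Real.pi * I) * F ⌊(2 : ℝ) ^ l⌋₊ := by
      rw [← h]
      refine Finset.sum_congr (by congr!) fun n _ => ?_
      rw [zetaTerm, zetaPt]
      push_cast
      rw [mul_div_assoc _ (p : ℂ)]
    rw [h']
    push_cast
    ring
  simp_rw [hleft, card_odd_floor_eq]
  rw [tendsto_add_half_iff, ← key]
  have hc : (-(2 * Real.pi * I) : ℂ) ≠ 0 := by simp [Real.pi_ne_zero]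
  constructor
  · intro h
    have h1 := (h.const_mul (-(2 * Real.pi * I) : ℂ)⁻¹)
    simp only [inv_mul_cancel_left₀ hc, mul_zero] at h1
    exact_mod_cast (Complex.continuous_re.tendsto 0).comp h1
  · intro h
    have h1 := ((Complex.continuous_ofReal.tendsto 0).comp h).const_mul (-(2 * Real.pi * I) : ℂ)
    simpa using h1
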